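/- Let x,y ∈ K. (a) If n ≥ 1, k ∈ {2,…,l_n} and d(x,y) ∈ [(k−1)/L_n, k/L_n), then (1/48)·k·R_n ≤ R_E(x,y) ≤ (7/3)·k·R_n; moreover d(x,y) < 3 always, R_E(x,y) < 4 always, and d(x,y) ≥ 1 implies R_E(x,y) ≥ 1/14. (b) If x ≠ y, then 6⁻⁴ · Ψ(d(x,y))/m(B_d(x,d(x,y))) ≤ R_E(x,y) ≤ 2⁸ · Ψ(d(x,y))/m(B_d(x,d(x,y))). -/

import Mathlib

open scoped BigOperators ENNReal
open Set Filter MeasureTheory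

noncomputable section

abbrev E2 : Type := EuclideanSpace ℝ (Fin 2)

/-- The index set `S_l` of the level-`l` thin Sierpinski gasket. -/
def Sset (l : ℕ) : Set (ℕ × ℕ) :=
  {p | p.1 + p.2 ≤ l - 1 ∧ p.1 * p.2 * (l - 1 - p.1 - p.2) = 0}

/-- The contraction `f^l_i`. -/
def fmap (q : Fin 3 → E2) (l : ℕ) (i : ℕ × ℕ) (x : E2) : E2 :=
  q 0 + ((i.1 : ℝ) / l) • (q 1 - q 0) + ((i.2 : ℝ) / l) • (q 2 - q 0)
    + (l : ℝ)⁻¹ • (x - q 0)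

/-- The closed equilateral triangle `△`. -/
def Tri (q : Fin 3 → E2) : Set E2 := convexHull ℝ (Set.range q)

def V0 (q : Fin 3 → E2) : Set E2 := Set.range q

/-- Words of length `n` (padded by `(0,0)` beyond position `n`). -/
def Wn (l : ℕ → ℕ) (n : ℕ) : Set (ℕ → ℕ × ℕ) :=
  {w | (∀ k, k < n → w k ∈ Sset (l k)) ∧ ∀ k, n ≤ k → w k = (0, 0)}

/-- `wordMap q l w n = f^{l_1}_{w_1} ∘ ⋯ ∘ f^{l_n}_{w_n}` (0-indexed). -/
def wordMap (q : Fin 3 → E2) (l : ℕ → ℕ) (w : ℕ → ℕ × ℕ) : ℕ → E2 → E2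
  | 0 => id
  | n + 1 => wordMap q l w n ∘ fmap q (l n) (w n)

/-- The thin scale irregular Sierpinski gasket `K`. -/
def Gasket (q : Fin 3 → E2) (l : ℕ → ℕ) : Set E2 :=
  ⋂ n, ⋃ w ∈ Wn l n, wordMap q l w n '' Tri q

/-- The cell `K_w = K ∩ f_w(△)`. -/
def Cell (q : Fin 3 → E2) (l : ℕ → ℕ) (n : ℕ) (w : ℕ → ℕ × ℕ) : Set E2 :=
  Gasket q l ∩ wordMap q l w n '' Tri q

def Vn (q : Fin 3 → E2) (l : ℕ → ℕ) (n : ℕ) : Set E2 :=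
  ⋃ w ∈ Wn l n, wordMap q l w n '' V0 q

def Vstar (q : Fin 3 → E2) (l : ℕ → ℕ) : Set E2 := ⋃ n, Vn q l n

def Ln (l : ℕ → ℕ) (n : ℕ) : ℕ := ∏ k ∈ Finset.range n, l k

def Mn (l : ℕ → ℕ) (n : ℕ) : ℕ := ∏ k ∈ Finset.range n, (3 * l k - 3)

def rl (l : ℕ) : ℝ := (2 * (l : ℝ) / 3 + 1 / 9)⁻¹

def Rn (l : ℕ → ℕ) (n : ℕ) : ℝ := ∏ k ∈ Finset.range n, rl (l k)

def Tn (l : ℕ → ℕ) (n : ℕ) : ℝ := (Mn l n : ℝ) / Rn l n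

/-- The basic energy form `E⁰` on `ℝ^{V₀}`. -/
def E0 (q : Fin 3 → E2) (u v : E2 → ℝ) : ℝ :=
  (1 / 2) * ∑ j : Fin 3, ∑ k : Fin 3, (u (q j) - u (q k)) * (v (q j) - v (q k))

/-- The level-`n` energy form `Eⁿ`. -/
def En (q : Fin 3 → E2) (l : ℕ → ℕ) (n : ℕ) (u v : E2 → ℝ) : ℝ :=
  (Rn l n)⁻¹ * ∑ᶠ w ∈ Wn l n, E0 q (u ∘ wordMap q l w n) (v ∘ wordMap q l w n)

/-- The domain `F` of the limit resistance form. -/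
def FDom (q : Fin 3 → E2) (l : ℕ → ℕ) : Set (E2 → ℝ) :=
  {u | ∃ C : ℝ, ∀ n, En q l n u u ≤ C}

/-- The limit form `E(u,v) = lim_n Eⁿ(u,v)`. -/
def EForm (q : Fin 3 → E2) (l : ℕ → ℕ) (u v : E2 → ℝ) : ℝ :=
  limUnder atTop fun n => En q l n u v

/-- The intrinsic (geodesic) distance on `K`, with values in `ℝ≥0∞`. -/
def pdist (q : Fin 3 → E2) (l : ℕ → ℕ) (x y : E2) : ℝ≥0∞ :=
  ⨅ (γ : ℝ → E2) (_ : ContinuousOn γ (Set.Icc 0 1))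
    (_ : Set.MapsTo γ (Set.Icc 0 1) (Gasket q l)) (_ : γ 0 = x) (_ : γ 1 = y),
    eVariationOn γ (Set.Icc 0 1)

def gdist (q : Fin 3 → E2) (l : ℕ → ℕ) (x y : E2) : ℝ := (pdist q l x y).toReal

/-- The set of resistance quotients used to define `R_E`. -/
def REset (q : Fin 3 → E2) (l : ℕ → ℕ) (x y : E2) : Set ℝ :=
  {t | ∃ u ∈ FDom q l, 0 < EForm q l u u ∧ t = (u x - u y) ^ 2 / EForm q l u u}

/-- The resistance metric `R_E`. -/
def RE (q : Fin 3 → E2) (l : ℕ → ℕ) (x y : E2) : ℝ := sSup (REset q l x y)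

/-- Resistance quotients over continuous representatives (i.e. `F` viewed in `C(K)`). -/
def REcSet (q : Fin 3 → E2) (l : ℕ → ℕ) (x y : E2) : Set ℝ :=
  {t | ∃ u ∈ FDom q l, ContinuousOn u (Gasket q l) ∧ 0 < EForm q l u u ∧
    t = (u x - u y) ^ 2 / EForm q l u u}

def REc (q : Fin 3 → E2) (l : ℕ → ℕ) (x y : E2) : ℝ := sSup (REcSet q l x y)

/-- The open `d`-ball in `K`. -/
def Bd (q : Fin 3 → E2) (l : ℕ → ℕ) (x : E2) (s : ℝ) : Set E2 :=
  {y ∈ Gasket q l | gdist q l x y < s}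

/-- The open `R_E`-ball in `K`. -/
def BRc (q : Fin 3 → E2) (l : ℕ → ℕ) (x : E2) (s : ℝ) : Set E2 :=
  {y ∈ Gasket q l | REc q l x y < s}

/-- `Λ^{(k)}_{n,w}`: words within `k` cell-steps of `w`. -/
def Lam (q : Fin 3 → E2) (l : ℕ → ℕ) (n : ℕ) (w : ℕ → ℕ × ℕ) (k : ℕ) :
    Set (ℕ → ℕ × ℕ) :=
  {v ∈ Wn l n | ∃ c : ℕ → ℕ → ℕ × ℕ, c 0 = w ∧ c k = v ∧ (∀ j ≤ k, c j ∈ Wn l n) ∧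
    ∀ j < k, (Cell q l n (c j) ∩ Cell q l n (c (j + 1))).Nonempty}

/-- `U^{(k)}_{n,w}`. -/
def Unwk (q : Fin 3 → E2) (l : ℕ → ℕ) (n : ℕ) (w : ℕ → ℕ × ℕ) (k : ℕ) : Set E2 :=
  ⋃ v ∈ Lam q l n w k, Cell q l n v

def betaZero (l : ℕ → ℕ) : ℝ :=
  ⨅ n : ℕ, Real.logb (l n) (2 * (l n : ℝ) ^ 2 - (5 / 3) * (l n : ℝ) - 1 / 3)

def betaOne (l : ℕ → ℕ) : ℝ :=
  ⨆ n : ℕ, Real.logb (l n) (2 * (l n : ℝ) ^ 2 - (5 / 3) * (l n : ℝ) - 1 / 3)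

def betaM (l : ℕ → ℕ) : ℝ := ⨅ n : ℕ, Real.logb (l n) (3 * (l n : ℝ) - 3)

def betaR (l : ℕ → ℕ) : ℝ := ⨆ n : ℕ, Real.logb (l n) ((rl (l n))⁻¹)

/-- The value of `Ψ` on the interval `[1/L_{n+1}, 1/L_n]`. -/
def psiPiece (l : ℕ → ℕ) (n : ℕ) (s : ℝ) : ℝ :=
  (Tn l (n + 1))⁻¹
    * (1 + ((3 * (l n : ℝ) - 4) / ((l n : ℝ) - 1)) * ((Ln l (n + 1) : ℝ) * s - 1))
    * (1 + (((2 / 3) * (l n : ℝ) - 8 / 9) / ((l n : ℝ) - 1)) * ((Ln l (n + 1) : ℝ) * s - 1))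

/-- `Ψ = Ψ_𝒍` is characterized by these defining clauses. -/
def IsPsi (l : ℕ → ℕ) (Psi : ℝ → ℝ) : Prop :=
  (∀ n : ℕ, ∀ s : ℝ, ((Ln l (n + 1) : ℝ))⁻¹ ≤ s → s ≤ ((Ln l n : ℝ))⁻¹ →
      Psi s = psiPiece l n s) ∧
  (∀ s : ℝ, 1 ≤ s → Psi s = s ^ betaZero l) ∧ Psi 0 = 0

def psiMPiece (l : ℕ → ℕ) (n : ℕ) (s : ℝ) : ℝ :=
  ((Mn l (n + 1) : ℝ))⁻¹
    * (1 + ((3 * (l n : ℝ) - 4) / ((l n : ℝ) - 1)) * ((Ln l (n + 1) : ℝ) * s - 1))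

def IsPsiM (l : ℕ → ℕ) (PsiM : ℝ → ℝ) : Prop :=
  (∀ n : ℕ, ∀ s : ℝ, ((Ln l (n + 1) : ℝ))⁻¹ ≤ s → s ≤ ((Ln l n : ℝ))⁻¹ →
      PsiM s = psiMPiece l n s) ∧
  (∀ s : ℝ, 1 ≤ s → PsiM s = s ^ betaM l) ∧ PsiM 0 = 0

def psiRPiece (l : ℕ → ℕ) (n : ℕ) (s : ℝ) : ℝ :=
  Rn l (n + 1)
    * (1 + (((2 / 3) * (l n : ℝ) - 8 / 9) / ((l n : ℝ) - 1)) * ((Ln l (n + 1) : ℝ) * s - 1))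

def IsPsiR (l : ℕ → ℕ) (PsiR : ℝ → ℝ) : Prop :=
  (∀ n : ℕ, ∀ s : ℝ, ((Ln l (n + 1) : ℝ))⁻¹ ≤ s → s ≤ ((Ln l n : ℝ))⁻¹ →
      PsiR s = psiRPiece l n s) ∧
  (∀ s : ℝ, 1 ≤ s → PsiR s = s ^ betaR l) ∧ PsiR 0 = 0

/-- `μ` is the uniform distribution on `K`: a Borel measure carried by `K`
with `μ(K_w) = 1/M_{|w|}` for every word `w`. -/
def IsUnif (q : Fin 3 → E2) (l : ℕ → ℕ) (μ : Measure E2) : Prop :=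
  μ (Gasket q l)ᶜ = 0 ∧ ∀ n : ℕ, ∀ w ∈ Wn l n, μ (Cell q l n w) = ((Mn l n : ℝ≥0∞))⁻¹

/-- `μ` is the energy measure of `u`: a Borel measure carried by `K` with
`μ(K_w) = R_{|w|}⁻¹ E^{𝒍^{|w|}}(u∘F_w, u∘F_w)` for every word `w`. -/
def IsEnergyMeasure (q : Fin 3 → E2) (l : ℕ → ℕ) (u : E2 → ℝ) (μ : Measure E2) : Prop :=
  μ (Gasket q l)ᶜ = 0 ∧ ∀ n : ℕ, ∀ w ∈ Wn l n,
    μ (Cell q l n w) = ENNReal.ofReal ((Rn l n)⁻¹ *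
      EForm q (fun k => l (k + n)) (u ∘ wordMap q l w n) (u ∘ wordMap q l w n))




namespace TG

structure Hyp (q : Fin 3 → E2) (l : ℕ → ℕ) : Prop where
  hq : ∀ j k : Fin 3, j ≠ k → dist (q j) (q k) = 1
  hl : ∀ m, 5 ≤ l m

/-- barycentric combination -/
def comb (q : Fin 3 → E2) (c : Fin 3 → ℝ) : E2 := ∑ t, c t • q t

lemma comb_add (q : Fin 3 → E2) (c d : Fin 3 → ℝ) : comb q (c + d) = comb q c + comb q d := by
  simp [comb, add_smul, Finset.sum_add_distrib]

lemma comb_smul (q : Fin 3 → E2) (a : ℝ) (c : Fin 3 → ℝ) : comb q (a • c) = a • comb q c := by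
  simp [comb, Finset.smul_sum, smul_smul]

lemma comb_sub (q : Fin 3 → E2) (c d : Fin 3 → ℝ) : comb q (c - d) = comb q c - comb q d := by
  simp [comb, sub_smul, Finset.sum_sub_distrib]

lemma comb_single (q : Fin 3 → E2) (j : Fin 3) : comb q (Pi.single j 1) = q j := by
  simp [comb, Pi.single_apply]

variable {q : Fin 3 → E2} {l : ℕ → ℕ}

lemma normsq_comb (H : Hyp q l) (d : Fin 3 → ℝ) (hd : ∑ t, d t = 0) :
    ‖comb q d‖ ^ 2 = d 1 ^ 2 + d 1 * d 2 + d 2 ^ 2 := by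
  have h1 : ‖q 1 - q 0‖ = 1 := by rw [← dist_eq_norm]; exact H.hq 1 0 (by decide)
  have h2 : ‖q 2 - q 0‖ = 1 := by rw [← dist_eq_norm]; exact H.hq 2 0 (by decide)
  have h3 : ‖(q 1 - q 0) - (q 2 - q 0)‖ = 1 := by
    rw [sub_sub_sub_cancel_right, ← dist_eq_norm]; exact H.hq 1 2 (by decide)
  have h4 : inner ℝ (q 1 - q 0) (q 2 - q 0) = 1 / 2 := by
    have := norm_sub_sq_real (q 1 - q 0) (q 2 - q 0)
    rw [h1, h2, h3] at this
    linarith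
  have e : comb q d = d 1 • (q 1 - q 0) + d 2 • (q 2 - q 0) := by
    rw [Fin.sum_univ_three] at hd
    have : d 0 = - d 1 - d 2 := by linarith
    simp only [comb, Fin.sum_univ_three, this]
    module
  rw [e, norm_add_sq_real, norm_smul, norm_smul, h1, h2, inner_smul_left, inner_smul_right, h4]
  simp
  ring

lemma bary_inj (H : Hyp q l) {c d : Fin 3 → ℝ} (hs : ∑ t, c t = ∑ t, d t)
    (h : comb q c = comb q d) : c = d := by
  have h0 : ∑ t, (c - d) t = 0 := by simp [hs]
  have := normsq_comb H (c - d) h0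
  rw [comb_sub, h, sub_self, norm_zero] at this
  simp only [Pi.sub_apply] at this
  rw [Fin.sum_univ_three] at h0
  simp only [Pi.sub_apply] at h0
  have a1 : (c 1 - d 1) = 0 := by
    nlinarith [sq_nonneg (c 1 - d 1), sq_nonneg (c 2 - d 2 + (c 1 - d 1) / 2)]
  have a2 : (c 2 - d 2) = 0 := by
    nlinarith [sq_nonneg (c 1 - d 1), sq_nonneg (c 1 - d 1 + (c 2 - d 2) / 2)]
  ext t
  fin_cases t
  · simp; linarith
  · simp; linarith
  · simp; linarith

lemma mem_Tri {z : E2} : z ∈ Tri q ↔ ∃ c : Fin 3 → ℝ, (∀ t, 0 ≤ c t) ∧ ∑ t, c t = 1 ∧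
    z = comb q c := by
  constructor
  · intro h
    have : Tri q ⊆ {z | ∃ c : Fin 3 → ℝ, (∀ t, 0 ≤ c t) ∧ ∑ t, c t = 1 ∧ z = comb q c} := by
      apply convexHull_min
      · rintro _ ⟨j, rfl⟩
        refine ⟨Pi.single j 1, ?_, by simp, (comb_single q j).symm⟩
        intro t
        by_cases htj : t = j
        · subst htj; simp
        · simp [htj]
      · rintro x ⟨c, hc, hc1, rfl⟩ y ⟨d, hd, hd1, rfl⟩ a b ha hb hab
        refine ⟨a • c + b • d, ?_, ?_, ?_⟩
        · intro t
          simp only [Pi.add_apply, Pi.smul_apply, smul_eq_mul]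
          have := hc t
          have := hd t
          positivity
        · simp [Finset.sum_add_distrib, ← Finset.mul_sum, hc1, hd1, hab]
        · rw [comb_add, comb_smul, comb_smul]
    exact this h
  · rintro ⟨c, hc, hc1, rfl⟩
    exact (convex_convexHull ℝ _).sum_mem (fun t _ => hc t) hc1
      (fun t _ => subset_convexHull ℝ _ ⟨t, rfl⟩)

/-! ### lattice coordinates of words -/

/-- triple coordinates of a letter -/
def co (l : ℕ) (i : ℕ × ℕ) : Fin 3 → ℕ := ![l - 1 - i.1 - i.2, i.1, i.2]

lemma co_sum {L : ℕ} {i : ℕ × ℕ} (h : i ∈ Sset L) : co L i 0 + co L i 1 + co L i 2 = L - 1 := by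
  have := h.1
  simp [co]
  omega

/-- lattice base of a word -/
def bs (l : ℕ → ℕ) (w : ℕ → ℕ × ℕ) : ℕ → Fin 3 → ℕ
  | 0 => 0
  | n + 1 => fun t => l n * bs l w n t + co (l n) (w n) t

/-- lattice vertex of a word -/
def vt (l : ℕ → ℕ) (n : ℕ) (w : ℕ → ℕ × ℕ) (j : Fin 3) : Fin 3 → ℕ :=
  bs l w n + Pi.single j 1

/-- words valid up to `n` -/
def Val (l : ℕ → ℕ) (n : ℕ) (w : ℕ → ℕ × ℕ) : Prop := ∀ k, k < n → w k ∈ Sset (l k)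

lemma Wn_val {n : ℕ} {w : ℕ → ℕ × ℕ} (h : w ∈ Wn l n) : Val l n w := h.1

lemma Val.mono {n m : ℕ} {w : ℕ → ℕ × ℕ} (h : Val l n w) (hm : m ≤ n) : Val l m w :=
  fun k hk => h k (lt_of_lt_of_le hk hm)

lemma Ln_succ (l : ℕ → ℕ) (n : ℕ) : Ln l (n + 1) = Ln l n * l n := by
  simp [Ln, Finset.prod_range_succ]

lemma Ln_zero (l : ℕ → ℕ) : Ln l 0 = 1 := by simp [Ln]

lemma Ln_pos (H : Hyp q l) (n : ℕ) : 0 < Ln l n :=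
  Finset.prod_pos fun k _ => by have := H.hl k; omega

lemma Ln_posR (H : Hyp q l) (n : ℕ) : (0 : ℝ) < Ln l n := by exact_mod_cast Ln_pos H n

lemma Ln_ge (H : Hyp q l) (n : ℕ) : 5 ^ n ≤ Ln l n := by
  induction n with
  | zero => simp [Ln_zero]
  | succ n ih =>
    rw [Ln_succ, pow_succ]
    exact Nat.mul_le_mul ih (H.hl n)

lemma bs_sum (H : Hyp q l) {n : ℕ} {w : ℕ → ℕ × ℕ} (h : Val l n w) :
    bs l w n 0 + bs l w n 1 + bs l w n 2 + 1 = Ln l n := by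
  induction n with
  | zero => simp [bs, Ln_zero]
  | succ n ih =>
    have h1 := ih (h.mono (Nat.le_succ n))
    have h2 := co_sum (h n (Nat.lt_succ_self n))
    have h3 := H.hl n
    rw [Ln_succ, ← h1]
    simp only [bs]
    have : (bs l w n 0 + bs l w n 1 + bs l w n 2 + 1) * l n =
      l n * bs l w n 0 + l n * bs l w n 1 + l n * bs l w n 2 + l n := by ring
    omega

lemma vt_sum (H : Hyp q l) {n : ℕ} {w : ℕ → ℕ × ℕ} (h : Val l n w) (j : Fin 3) :
    vt l n w j 0 + vt l n w j 1 + vt l n w j 2 = Ln l n := by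
  rw [← bs_sum H h]
  fin_cases j <;> simp [vt, Pi.single_apply] <;> omega

/-- lattice point at scale `L`. -/
def pt (q : Fin 3 → E2) (L : ℕ) (P : Fin 3 → ℕ) : E2 := comb q fun t => (P t : ℝ) / L

lemma pt_inj (H : Hyp q l) {n : ℕ} {P Q : Fin 3 → ℕ} (hP : P 0 + P 1 + P 2 = Ln l n)
    (hQ : Q 0 + Q 1 + Q 2 = Ln l n) (h : pt q (Ln l n) P = pt q (Ln l n) Q) : P = Q := by
  have hL := Ln_posR H n
  have := bary_inj H (c := fun t => (P t : ℝ) / Ln l n) (d := fun t => (Q t : ℝ) / Ln l n) ?_ h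
  · ext t
    have := congrFun this t
    rw [div_left_inj' hL.ne'] at this
    exact_mod_cast this
  · simp only [Fin.sum_univ_three, ← add_div]
    congr 1
    exact_mod_cast hP.trans hQ.symm

lemma fmap_eq {L : ℕ} (hL : 5 ≤ L) {i : ℕ × ℕ} (h : i ∈ Sset L) (x : E2) :
    fmap q L i x = comb q (fun t => (co L i t : ℝ) / L) + (L : ℝ)⁻¹ • x := by
  have hL0 : (L : ℝ) ≠ 0 := by positivity
  have h1 := h.1
  have e : ((L - 1 - i.1 - i.2 : ℕ) : ℝ) = (L : ℝ) - 1 - i.1 - i.2 := by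
    rw [Nat.cast_sub (by omega), Nat.cast_sub (by omega), Nat.cast_sub (by omega)]; simp
  simp only [fmap, comb, Fin.sum_univ_three, co, Matrix.cons_val_zero, Matrix.cons_val_one,
    Matrix.cons_val, e]
  rw [show ((L : ℝ) - 1 - i.1 - i.2) / L = 1 - (L : ℝ)⁻¹ - i.1 / L - i.2 / L by field_simp]
  module

lemma wordMap_eq (H : Hyp q l) {n : ℕ} {w : ℕ → ℕ × ℕ} (h : Val l n w) (x : E2) :
    wordMap q l w n x = comb q (fun t => (bs l w n t : ℝ) / Ln l n) + (Ln l n : ℝ)⁻¹ • x := by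
  induction n generalizing x with
  | zero => simp [wordMap, bs, Ln_zero, comb]
  | succ n ih =>
    have hL := (Ln_posR H n).ne'
    have hl0 : (l n : ℝ) ≠ 0 := by have := H.hl n; positivity
    simp only [wordMap, Function.comp_apply]
    rw [ih (h.mono (Nat.le_succ n)), fmap_eq (H.hl n) (h n (Nat.lt_succ_self n)), smul_add,
      ← add_assoc, ← comb_smul, ← comb_add, smul_smul]
    congr 2
    · ext t
      simp only [Pi.add_apply, Pi.smul_apply, smul_eq_mul, bs, Ln_succ]
      push_cast
      field_simp
    · rw [Ln_succ]; push_cast; rw [mul_inv]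

/-- `x` lies in the closed triangle of the word -/
def inC (q : Fin 3 → E2) (l : ℕ → ℕ) (n : ℕ) (w : ℕ → ℕ × ℕ) (x : E2) : Prop :=
  ∃ c : Fin 3 → ℝ, (∀ t, 0 ≤ c t) ∧ ∑ t, c t = 1 ∧
    x = comb q (fun t => ((bs l w n t : ℝ) + c t) / Ln l n)

lemma mem_image_iff (H : Hyp q l) {n : ℕ} {w : ℕ → ℕ × ℕ} (h : Val l n w) {x : E2} :
    x ∈ wordMap q l w n '' Tri q ↔ inC q l n w x := by
  have key : ∀ c : Fin 3 → ℝ, wordMap q l w n (comb q c) =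
      comb q (fun t => ((bs l w n t : ℝ) + c t) / Ln l n) := by
    intro c
    rw [wordMap_eq H h, ← comb_smul, ← comb_add]
    congr 1
    ext t
    simp only [Pi.add_apply, Pi.smul_apply, smul_eq_mul]
    ring
  constructor
  · rintro ⟨y, hy, rfl⟩
    obtain ⟨c, hc, hc1, rfl⟩ := mem_Tri.1 hy
    exact ⟨c, hc, hc1, key c⟩
  · rintro ⟨c, hc, hc1, rfl⟩
    exact ⟨comb q c, mem_Tri.2 ⟨c, hc, hc1, rfl⟩, key c⟩

lemma wordMap_q (H : Hyp q l) {n : ℕ} {w : ℕ → ℕ × ℕ} (h : Val l n w) (j : Fin 3) :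
    wordMap q l w n (q j) = pt q (Ln l n) (vt l n w j) := by
  rw [wordMap_eq H h, ← comb_single q j, ← comb_smul, ← comb_add, pt]
  congr 1
  ext t
  simp only [Pi.add_apply, Pi.smul_apply, smul_eq_mul, vt]
  by_cases htj : t = j
  · subst htj; simp; ring
  · simp [htj]

lemma inC_vt (q : Fin 3 → E2) (l : ℕ → ℕ) (n : ℕ) (w : ℕ → ℕ × ℕ) (j : Fin 3) :
    inC q l n w (pt q (Ln l n) (vt l n w j)) := by
  refine ⟨Pi.single j 1, ?_, by simp, ?_⟩
  · intro t
    by_cases htj : t = j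
    · subst htj; simp
    · simp [htj]
  · unfold pt
    congr 1
    ext t
    by_cases htj : t = j
    · subst htj; simp [vt]
    · simp [htj, vt]

lemma bs_congr {n : ℕ} {w v : ℕ → ℕ × ℕ} (h : ∀ k, k < n → w k = v k) :
    bs l w n = bs l v n := by
  induction n with
  | zero => rfl
  | succ n ih =>
    ext t
    simp only [bs]
    rw [ih (fun k hk => h k (by omega)), h n (Nat.lt_succ_self n)]

/-- truncation -/
def tr (n : ℕ) (w : ℕ → ℕ × ℕ) : ℕ → ℕ × ℕ := fun k => if k < n then w k else (0, 0)

lemma tr_mem {n : ℕ} {w : ℕ → ℕ × ℕ} (h : Val l n w) : tr n w ∈ Wn l n := by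
  constructor
  · intro k hk; simp [tr, hk, h k hk]
  · intro k hk; simp [tr, Nat.not_lt.2 hk]

lemma bs_tr {n m : ℕ} (hm : m ≤ n) (w : ℕ → ℕ × ℕ) : bs l (tr n w) m = bs l w m :=
  bs_congr fun k hk => by simp [tr, lt_of_lt_of_le hk hm]

lemma vt_tr {n m : ℕ} (hm : m ≤ n) (w : ℕ → ℕ × ℕ) (j : Fin 3) :
    vt l m (tr n w) j = vt l m w j := by simp [vt, bs_tr hm]

lemma inC_tr {n m : ℕ} (hm : m ≤ n) {w : ℕ → ℕ × ℕ} {x : E2} :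
    inC q l m (tr n w) x ↔ inC q l m w x := by simp [inC, bs_tr hm]

lemma co_lt {L : ℕ} (hL : 5 ≤ L) {i : ℕ × ℕ} (h : i ∈ Sset L) (t : Fin 3) : co L i t < L := by
  have := co_sum h
  fin_cases t <;> simp <;> omega

lemma bs_inj (H : Hyp q l) {n : ℕ} {w v : ℕ → ℕ × ℕ} (hw : Val l n w) (hv : Val l n v)
    (h : bs l w n = bs l v n) : ∀ k, k < n → w k = v k := by
  induction n with
  | zero => intro k hk; omega
  | succ n ih =>
    have hwn := hw n (Nat.lt_succ_self n)
    have hvn := hv n (Nat.lt_succ_self n)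
    have hl0 : 0 < l n := by have := H.hl n; omega
    have h1 : ∀ t, bs l w n t = bs l v n t ∧ co (l n) (w n) t = co (l n) (v n) t := by
      intro t
      have e := congrFun h t
      simp only [bs] at e
      have a := co_lt (H.hl n) hwn t
      have b := co_lt (H.hl n) hvn t
      constructor
      · have := congrArg (· / l n) e
        simp only [Nat.mul_add_div hl0, Nat.div_eq_of_lt a, Nat.div_eq_of_lt b] at this
        simpa using this
      · have := congrArg (· % l n) e
        simp only [Nat.mul_add_mod, Nat.mod_eq_of_lt a, Nat.mod_eq_of_lt b] at this
        exact this
    intro k hk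
    rcases Nat.lt_succ_iff_lt_or_eq.1 hk with h2 | rfl
    · exact ih (hw.mono (Nat.le_succ n)) (hv.mono (Nat.le_succ n)) (funext fun t => (h1 t).1) k h2
    · have a := (h1 1).2
      have b := (h1 2).2
      simp [co] at a b
      exact Prod.ext a b

lemma Wn_ext {n : ℕ} {w v : ℕ → ℕ × ℕ} (hw : w ∈ Wn l n) (hv : v ∈ Wn l n)
    (h : ∀ k, k < n → w k = v k) : w = v := by
  funext k
  by_cases hk : k < n
  · exact h k hk
  · rw [hw.2 k (by omega), hv.2 k (by omega)]

/-- two distinct cells meet only in common vertices -/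
lemma int_vertex (H : Hyp q l) {n : ℕ} {w v : ℕ → ℕ × ℕ} (hw : Val l n w) (hv : Val l n v)
    (hne : bs l w n ≠ bs l v n) {x : E2} (hxw : inC q l n w x) (hxv : inC q l n v x) :
    ∃ i j, vt l n w i = vt l n v j ∧ x = pt q (Ln l n) (vt l n w i) := by
  obtain ⟨c, hc, hc1, rfl⟩ := hxw
  obtain ⟨d, hd, hd1, he⟩ := hxv
  have hL := Ln_posR H n
  have hsw := bs_sum H hw
  have hsv := bs_sum H hv
  rw [Fin.sum_univ_three] at hc1 hd1
  have e := bary_inj H ?_ he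
  swap
  · simp only [Fin.sum_univ_three, ← add_div]
    congr 1
    have a : ((bs l w n 0 + bs l w n 1 + bs l w n 2 + 1 : ℕ) : ℝ) =
      ((bs l v n 0 + bs l v n 1 + bs l v n 2 + 1 : ℕ) : ℝ) := by rw [hsw, hsv]
    push_cast at a
    linarith
  have e' : ∀ t, (bs l w n t : ℝ) + c t = bs l v n t + d t := by
    intro t
    have := congrFun e t
    rwa [div_left_inj' hL.ne'] at this
  have hcast : (bs l w n 0 : ℝ) + bs l w n 1 + bs l w n 2 =
      (bs l v n 0 : ℝ) + bs l v n 1 + bs l v n 2 := by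
    have : bs l w n 0 + bs l w n 1 + bs l w n 2 = bs l v n 0 + bs l v n 1 + bs l v n 2 := by omega
    exact_mod_cast this
  -- some coordinate of v exceeds that of w
  have ex : ∃ t, bs l w n t < bs l v n t := by
    by_contra hcon
    push Not at hcon
    apply hne
    have h0 := hcon 0
    have h1 := hcon 1
    have h2 := hcon 2
    ext t
    fin_cases t <;> simp <;> omega
  have ex' : ∃ t, bs l v n t < bs l w n t := by
    by_contra hcon
    push Not at hcon
    apply hne
    have h0 := hcon 0
    have h1 := hcon 1
    have h2 := hcon 2
    ext t
    fin_cases t <;> simp <;> omega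
  obtain ⟨i, hi⟩ := ex
  obtain ⟨j, hj⟩ := ex'
  have hi' : (bs l w n i : ℝ) + 1 ≤ bs l v n i := by exact_mod_cast hi
  have hj' : (bs l v n j : ℝ) + 1 ≤ bs l w n j := by exact_mod_cast hj
  have cle : ∀ t, c t ≤ 1 := by
    intro t
    have h0 := hc 0
    have h1 := hc 1
    have h2 := hc 2
    fin_cases t <;> simp <;> linarith
  have dle : ∀ t, d t ≤ 1 := by
    intro t
    have h0 := hd 0
    have h1 := hd 1
    have h2 := hd 2
    fin_cases t <;> simp <;> linarith
  have ci : c i = 1 := by have := e' i; have := hd i; have := cle i; linarith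
  have dj : d j = 1 := by have := e' j; have := hc j; have := dle j; linarith
  have cs : c = Pi.single i 1 := by
    have h0 := hc 0
    have h1 := hc 1
    have h2 := hc 2
    ext t
    fin_cases i <;> fin_cases t <;> simp at ci ⊢ <;> linarith
  have ds : d = Pi.single j 1 := by
    have h0 := hd 0
    have h1 := hd 1
    have h2 := hd 2
    ext t
    fin_cases j <;> fin_cases t <;> simp at dj ⊢ <;> linarith
  refine ⟨i, j, ?_, ?_⟩
  · ext t
    have := e' t
    rw [cs, ds] at this
    have h1 : ((vt l n w i t : ℕ) : ℝ) = vt l n v j t := by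
      simp only [vt, Pi.add_apply]
      push_cast
      convert this using 2
      · by_cases h : t = i
        · subst h; simp
        · simp [h]
      · by_cases h : t = j
        · subst h; simp
        · simp [h]
    exact_mod_cast h1
  · unfold pt
    congr 1
    ext t
    rw [cs]
    by_cases h : t = i
    · subst h; simp [vt]
    · simp [h, vt]

end TG


namespace TG
variable {q : Fin 3 → E2} {l : ℕ → ℕ}

/-! ### letters and words as finsets -/

def SF (L : ℕ) : Finset (ℕ × ℕ) :=
  (Finset.range L ×ˢ Finset.range L).filter
    fun p => p.1 + p.2 ≤ L - 1 ∧ p.1 * p.2 * (L - 1 - p.1 - p.2) = 0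

lemma mem_SF {L : ℕ} (hL : 5 ≤ L) {i : ℕ × ℕ} : i ∈ SF L ↔ i ∈ Sset L := by
  simp only [SF, Finset.mem_filter, Finset.mem_product, Finset.mem_range, Sset, Set.mem_ofPred_eq]
  constructor
  · exact fun h => h.2
  · intro h
    refine ⟨?_, h⟩
    have := h.1
    omega

open Classical in
def WF (l : ℕ → ℕ) : ℕ → Finset (ℕ → ℕ × ℕ)
  | 0 => {fun _ => (0, 0)}
  | n + 1 => (WF l n ×ˢ SF (l n)).image fun p => Function.update p.1 n p.2

lemma mem_WF (H : Hyp q l) {n : ℕ} {w : ℕ → ℕ × ℕ} : w ∈ WF l n ↔ w ∈ Wn l n := by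
  induction n generalizing w with
  | zero =>
    simp only [WF, Finset.mem_singleton, Wn, Set.mem_ofPred_eq]
    constructor
    · rintro rfl; simp
    · intro h; funext k; exact h.2 k (Nat.zero_le k)
  | succ n ih =>
    simp only [WF, Finset.mem_image, Finset.mem_product, mem_SF (H.hl n)]
    constructor
    · rintro ⟨⟨v, i⟩, ⟨hv, hi⟩, rfl⟩
      dsimp only at hv hi ⊢
      rw [ih] at hv
      constructor
      · intro k hk
        by_cases h : k = n
        · subst h; simpa using hi
        · rw [Function.update_of_ne h]; exact hv.1 k (by omega)
      · intro k hk
        rw [Function.update_of_ne (by omega)]; exact hv.2 k (by omega)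
    · intro h
      refine ⟨⟨tr n w, w n⟩, ⟨ih.2 (tr_mem (fun k hk => h.1 k (by omega))), h.1 n (by omega)⟩, ?_⟩
      funext k
      by_cases hk : k = n
      · subst hk; simp
      · rw [Function.update_of_ne hk]
        by_cases h2 : k < n
        · simp [tr, h2]
        · simp only [tr, h2, if_false]; exact (h.2 k (by omega)).symm

lemma upd_mem (H : Hyp q l) {n : ℕ} {w : ℕ → ℕ × ℕ} (hw : w ∈ Wn l n) {i : ℕ × ℕ}
    (hi : i ∈ Sset (l n)) : Function.update w n i ∈ Wn l (n + 1) := by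
  rw [← mem_WF H]
  simp only [WF, Finset.mem_image, Finset.mem_product]
  exact ⟨⟨w, i⟩, ⟨(mem_WF H).2 hw, (mem_SF (H.hl n)).2 hi⟩, rfl⟩

lemma Val.upd {n : ℕ} {w : ℕ → ℕ × ℕ} (hw : Val l n w) {i : ℕ × ℕ}
    (hi : i ∈ Sset (l n)) : Val l (n + 1) (Function.update w n i) := by
  intro k hk
  by_cases h : k = n
  · subst h; simpa using hi
  · rw [Function.update_of_ne h]; exact hw k (by omega)

lemma sum_WF_succ (n : ℕ) (H : Hyp q l) (F : (ℕ → ℕ × ℕ) → ℝ) :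
    ∑ w ∈ WF l (n + 1), F w =
      ∑ w ∈ WF l n, ∑ i ∈ SF (l n), F (Function.update w n i) := by
  classical
  rw [WF, Finset.sum_image, Finset.sum_product]
  rintro ⟨w, i⟩ h ⟨v, j⟩ h' e
  simp only [Finset.coe_product, Set.mem_prod, Finset.mem_coe, mem_WF H] at h h' e
  have e1 : i = j := by have := congrFun e n; simpa using this
  have e2 : w = v := by
    refine Wn_ext h.1 h'.1 fun k hk => ?_
    have := congrFun e k
    rwa [Function.update_of_ne (by omega), Function.update_of_ne (by omega)] at this
  rw [e1, e2]

lemma finsum_WF (H : Hyp q l) (n : ℕ) (F : (ℕ → ℕ × ℕ) → ℝ) :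
    ∑ᶠ w ∈ Wn l n, F w = ∑ w ∈ WF l n, F w := by
  have : Wn l n = ((WF l n : Finset _) : Set (ℕ → ℕ × ℕ)) := by
    ext w; rw [Finset.mem_coe, mem_WF H]
  rw [this, finsum_mem_coe_finset]

lemma Wn_finite (H : Hyp q l) (n : ℕ) : (Wn l n).Finite := by
  have : Wn l n = ((WF l n : Finset _) : Set (ℕ → ℕ × ℕ)) := by
    ext w; rw [Finset.mem_coe, mem_WF H]
  rw [this]; exact Finset.finite_toSet _

/-- coordinates of side letters -/
def sco (L : ℕ) (j k : Fin 3) (s : ℕ) : Fin 3 → ℕ :=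
  fun t => if t = j then L - 1 - s else if t = k then s else 0

/-- side letter -/
def side (L : ℕ) (j k : Fin 3) (s : ℕ) : ℕ × ℕ := (sco L j k s 1, sco L j k s 2)

lemma co_side {L : ℕ} {j k : Fin 3} (hjk : j ≠ k) {s : ℕ} (hs : s ≤ L - 1) :
    co L (side L j k s) = sco L j k s := by
  ext t
  fin_cases j <;> fin_cases k <;> fin_cases t <;> simp [co, side, sco] at hjk ⊢ <;> omega

lemma side_mem {L : ℕ} {j k : Fin 3} (hjk : j ≠ k) {s : ℕ} (hs : s ≤ L - 1) :
    side L j k s ∈ Sset L := by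
  constructor
  · fin_cases j <;> fin_cases k <;> simp [side, sco] at hjk ⊢ <;> omega
  · fin_cases j <;> fin_cases k <;> simp [side, sco] at hjk ⊢ <;> omega

lemma co_ext {L : ℕ} {i i' : ℕ × ℕ} (h : co L i = co L i') : i = i' := by
  have a := congrFun h 1
  have b := congrFun h 2
  simp [co] at a b
  exact Prod.ext a b

lemma co_zero {L : ℕ} {i : ℕ × ℕ} (h : i ∈ Sset L) : ∃ t, co L i t = 0 := by
  have := h.2
  rcases Nat.mul_eq_zero.1 this with h1 | h1
  · rcases Nat.mul_eq_zero.1 h1 with h2 | h2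
    · exact ⟨1, by simpa [co] using h2⟩
    · exact ⟨2, by simpa [co] using h2⟩
  · exact ⟨0, by simpa [co] using h1⟩

/-- every letter with a zero coordinate `m` is a side letter -/
lemma eq_side {L : ℕ} {i : ℕ × ℕ} (h : i ∈ Sset L) {j k m : Fin 3} (hjk : j ≠ k) (hjm : j ≠ m)
    (hkm : k ≠ m) (hm : co L i m = 0) : co L i k ≤ L - 1 ∧ co L i j + co L i k = L - 1 ∧
      i = side L j k (co L i k) := by
  have hs := co_sum h
  have h1 : co L i j + co L i k = L - 1 := by
    fin_cases j <;> fin_cases k <;> fin_cases m <;> simp at hjk hjm hkm hm ⊢ <;> omega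
  refine ⟨by omega, h1, co_ext (L := L) ?_⟩
  rw [co_side hjk (by omega)]
  ext t
  simp only [sco]
  split_ifs with h2 h3
  · subst h2; omega
  · subst h3; rfl
  · have : t = m := by
      clear h1 hm; revert t j k m; decide
    rw [this, hm]

lemma sum_SF {L : ℕ} (hL : 5 ≤ L) (f : ℕ × ℕ → ℝ) :
    ∑ i ∈ SF L, f i = ∑ t ∈ Finset.range (L - 1),
      (f (side L 0 1 t) + f (side L 1 2 t) + f (side L 2 0 t)) := by
  classical
  have h01 : (0 : Fin 3) ≠ 1 := by decide
  have h12 : (1 : Fin 3) ≠ 2 := by decide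
  have h20 : (2 : Fin 3) ≠ 0 := by decide
  have e : SF L = ((Finset.range (L - 1)).image (side L 0 1) ∪
      (Finset.range (L - 1)).image (side L 1 2)) ∪ (Finset.range (L - 1)).image (side L 2 0) := by
    ext ⟨a, b⟩
    simp only [SF, Finset.mem_filter, Finset.mem_product, Finset.mem_range, Finset.mem_union,
      Finset.mem_image, side, sco, Prod.mk.injEq]
    simp only [Nat.mul_eq_zero, show (1 : Fin 3) ≠ 0 by decide, show (2 : Fin 3) ≠ 0 by decide,
      show (2 : Fin 3) ≠ 1 by decide, show (1 : Fin 3) ≠ 2 by decide,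
      show (0 : Fin 3) ≠ 1 by decide, show (0 : Fin 3) ≠ 2 by decide, if_true, if_false]
    constructor
    · rintro ⟨-, h1, h2⟩
      rcases h2 with (h2 | h2) | h2
      · by_cases hb : b = 0
        · left; left; exact ⟨0, by omega, by omega, by omega⟩
        · right; exact ⟨L - 1 - b, by omega, by omega, by omega⟩
      · by_cases ha : a = L - 1
        · left; right; exact ⟨0, by omega, by omega, by omega⟩
        · left; left; exact ⟨a, by omega, by omega, by omega⟩
      · by_cases ha : a = 0
        · right; exact ⟨0, by omega, by omega, by omega⟩
        · left; right; exact ⟨b, by omega, by omega, by omega⟩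
    · rintro ((⟨t, h1, h2, h3⟩ | ⟨t, h1, h2, h3⟩) | ⟨t, h1, h2, h3⟩) <;> omega
  rw [e, Finset.sum_union, Finset.sum_union, Finset.sum_image, Finset.sum_image, Finset.sum_image,
    Finset.sum_add_distrib, Finset.sum_add_distrib]
  · intro a ha b hb h; simp [side, sco] at h ha hb; omega
  · intro a ha b hb h; simp [side, sco] at h ha hb; omega
  · intro a ha b hb h; simp [side, sco] at h ha hb; omega
  · rw [Finset.disjoint_left]
    rintro ⟨a, b⟩ h h'
    simp [side, sco] at h h'
    obtain ⟨t, h1, h2, h3⟩ := h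
    obtain ⟨t', h1', h2', h3'⟩ := h'
    omega
  · rw [Finset.disjoint_left]
    rintro ⟨a, b⟩ h h'
    simp [side, sco] at h h'
    obtain ⟨t', h1', h2', h3'⟩ := h'
    rcases h with ⟨t, h1, h2, h3⟩ | ⟨t, h1, h2, h3⟩ <;> omega

/-- local vertex of a child -/
def lv (L : ℕ) (i : ℕ × ℕ) (j : Fin 3) : Fin 3 → ℕ := co L i + Pi.single j 1

lemma lv_sum {L : ℕ} (hL : 5 ≤ L) {i : ℕ × ℕ} (h : i ∈ Sset L) (j : Fin 3) :
    lv L i j 0 + lv L i j 1 + lv L i j 2 = L := by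
  have := co_sum h
  fin_cases j <;> simp [lv] <;> omega

lemma vt_succ (n : ℕ) (w : ℕ → ℕ × ℕ) (j t : Fin 3) :
    vt l (n + 1) w j t = l n * bs l w n t + lv (l n) (w n) j t := by
  simp [vt, bs, lv, add_assoc]

lemma bs_upd (n : ℕ) (w : ℕ → ℕ × ℕ) (i : ℕ × ℕ) : bs l (Function.update w n i) n = bs l w n :=
  bs_congr fun k hk => by rw [Function.update_of_ne (by omega)]

lemma vt_upd (n : ℕ) (w : ℕ → ℕ × ℕ) (i : ℕ × ℕ) (j : Fin 3) :
    vt l n (Function.update w n i) j = vt l n w j := by simp [vt, bs_upd]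

lemma vt_upd_succ (n : ℕ) (w : ℕ → ℕ × ℕ) (i : ℕ × ℕ) (j t : Fin 3) :
    vt l (n + 1) (Function.update w n i) j t = l n * bs l w n t + lv (l n) i j t := by
  rw [vt_succ, bs_upd]; simp

/-- corner letter -/
def cnr (L : ℕ) (j : Fin 3) : ℕ × ℕ := side L j (j + 1) 0

lemma ne_succ (j : Fin 3) : j ≠ j + 1 := by revert j; decide

lemma cnr_mem (L : ℕ) (j : Fin 3) : cnr L j ∈ Sset L := side_mem (ne_succ j) (Nat.zero_le _)

lemma co_cnr (L : ℕ) (j t : Fin 3) : co L (cnr L j) t = if t = j then L - 1 else 0 := by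
  rw [cnr, co_side (ne_succ j) (Nat.zero_le _)]
  simp [sco]

lemma vt_cnr {n : ℕ} (H : Hyp q l) (w : ℕ → ℕ × ℕ) (j : Fin 3) :
    vt l (n + 1) (Function.update w n (cnr (l n) j)) j = fun t => l n * vt l n w j t := by
  have := H.hl n
  ext t
  rw [vt_upd_succ]
  simp only [lv, Pi.add_apply, co_cnr, vt]
  by_cases h : t = j
  · subst h; simp; rw [mul_add]; omega
  · simp [h]

lemma pt_mul {L k : ℕ} (hk : 0 < k) (P : Fin 3 → ℕ) :
    pt q (L * k) (fun t => k * P t) = pt q L P := by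
  unfold pt
  congr 1
  ext t
  push_cast
  have : (k : ℝ) ≠ 0 := by positivity
  rw [mul_comm (L : ℝ), mul_div_mul_left _ _ this]

lemma pt_cnr {n : ℕ} (H : Hyp q l) (w : ℕ → ℕ × ℕ) (j : Fin 3) :
    pt q (Ln l (n + 1)) (vt l (n + 1) (Function.update w n (cnr (l n) j)) j) =
      pt q (Ln l n) (vt l n w j) := by
  rw [vt_cnr H, Ln_succ, pt_mul (by have := H.hl n; omega)]

/-- a level `n+1` vertex on the level `n` lattice is a corner. -/
lemma corner_of_dvd {n : ℕ} (H : Hyp q l) {w : ℕ → ℕ × ℕ} (hw : Val l (n + 1) w) {j : Fin 3}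
    (h : ∀ t, l n ∣ vt l (n + 1) w j t) :
    w n = cnr (l n) j ∧ vt l (n + 1) w j = fun t => l n * vt l n w j t := by
  have hL := H.hl n
  have hwn := hw n (Nat.lt_succ_self n)
  have hs := co_sum hwn
  have h1 : ∀ t, l n ∣ lv (l n) (w n) j t := by
    intro t
    have := h t
    rw [vt_succ] at this
    exact (Nat.dvd_add_right (Dvd.intro _ rfl)).1 this
  have hj : l n ≤ co (l n) (w n) j + 1 := by
    have := h1 j
    apply Nat.le_of_dvd (by omega)
    simpa [lv] using this
  have e : w n = cnr (l n) j := by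
    apply co_ext (L := l n)
    ext t
    rw [co_cnr]
    fin_cases j <;> fin_cases t <;> simp at hj ⊢ <;> omega
  refine ⟨e, ?_⟩
  have := vt_cnr (n := n) H w j
  rw [← e, Function.update_eq_self] at this
  exact this

lemma inC_mono {n : ℕ} (H : Hyp q l) {w : ℕ → ℕ × ℕ} (hw : Val l (n + 1) w) {x : E2}
    (h : inC q l (n + 1) w x) : inC q l n w x := by
  obtain ⟨c, hc, hc1, rfl⟩ := h
  have hl0 : (0 : ℝ) < l n := by have := H.hl n; positivity
  have hL := Ln_posR H n
  have hs := co_sum (hw n (Nat.lt_succ_self n))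
  refine ⟨fun t => (co (l n) (w n) t + c t) / l n, ?_, ?_, ?_⟩
  · intro t; have := hc t; positivity
  · rw [Fin.sum_univ_three] at hc1 ⊢
    rw [← add_div, ← add_div, div_eq_one_iff_eq hl0.ne']
    have h5 := H.hl n
    have : ((co (l n) (w n) 0 + co (l n) (w n) 1 + co (l n) (w n) 2 + 1 : ℕ) : ℝ) = l n := by
      congr 1; omega
    push_cast at this
    linarith
  · congr 1
    ext t
    rw [Ln_succ]
    simp only [bs]
    push_cast
    field_simp
    ring

lemma inC_le {n m : ℕ} (H : Hyp q l) (hnm : n ≤ m) {w : ℕ → ℕ × ℕ} (hw : Val l m w) {x : E2}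
    (h : inC q l m w x) : inC q l n w x := by
  induction m, hnm using Nat.le_induction with
  | base => exact h
  | succ m hm ih => exact ih (hw.mono (Nat.le_succ m)) (inC_mono H hw h)

lemma mem_G (H : Hyp q l) {x : E2} : x ∈ Gasket q l ↔ ∀ n, ∃ w ∈ Wn l n, inC q l n w x := by
  simp only [Gasket, Set.mem_iInter, Set.mem_iUnion, exists_prop]
  constructor
  · intro h n
    obtain ⟨w, hw, hx⟩ := h n
    exact ⟨w, hw, (mem_image_iff H hw.1).1 hx⟩
  · intro h n
    obtain ⟨w, hw, hx⟩ := h n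
    exact ⟨w, hw, (mem_image_iff H hw.1).2 hx⟩

lemma mem_Cell (H : Hyp q l) {n : ℕ} {w : ℕ → ℕ × ℕ} (hw : Val l n w) {x : E2} :
    x ∈ Cell q l n w ↔ x ∈ Gasket q l ∧ inC q l n w x := by
  rw [Cell, Set.mem_inter_iff, mem_image_iff H hw]

lemma inC_of_bs {n : ℕ} {w v : ℕ → ℕ × ℕ} (h : bs l w n = bs l v n) {x : E2}
    (hx : inC q l n w x) : inC q l n v x := by
  simpa [inC, h] using hx

lemma child_exists {n : ℕ} (H : Hyp q l) {w : ℕ → ℕ × ℕ} (hw : Val l n w) {x : E2}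
    (hx : x ∈ Gasket q l) (hc : inC q l n w x) :
    ∃ i ∈ Sset (l n), inC q l (n + 1) (Function.update w n i) x := by
  obtain ⟨v, hv, hxv⟩ := (mem_G H).1 hx (n + 1)
  by_cases hb : bs l w n = bs l v n
  · refine ⟨v n, hv.1 n (by omega), inC_of_bs ?_ hxv⟩
    ext t
    simp only [bs, bs_upd, hb, Function.update_self]
  · obtain ⟨a, b, -, e⟩ := int_vertex H hw ((Wn_val hv).mono (Nat.le_succ n)) hb hc
      (inC_mono H hv.1 hxv)
    refine ⟨cnr (l n) a, cnr_mem _ _, ?_⟩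
    rw [e, ← pt_cnr H]
    exact inC_vt _ _ _ _ _

lemma vt_up {n : ℕ} (H : Hyp q l) {w : ℕ → ℕ × ℕ} (hw : Val l n w) (j : Fin 3) {m : ℕ}
    (hm : n ≤ m) : ∃ v, Val l m v ∧ (∀ k, k < n → v k = w k) ∧
      pt q (Ln l m) (vt l m v j) = pt q (Ln l n) (vt l n w j) := by
  induction m, hm using Nat.le_induction with
  | base => exact ⟨w, hw, fun _ _ => rfl, rfl⟩
  | succ m hm ih =>
    obtain ⟨v, hv, h1, h2⟩ := ih
    refine ⟨Function.update v m (cnr (l m) j), hv.upd (cnr_mem _ _), ?_, ?_⟩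
    · intro k hk
      rw [Function.update_of_ne (by omega)]; exact h1 k hk
    · rw [pt_cnr H, h2]

/-- point on the side `j k` of a cell -/
def onS (q : Fin 3 → E2) (l : ℕ → ℕ) (n : ℕ) (w : ℕ → ℕ × ℕ) (j k : Fin 3) (x : E2) : Prop :=
  ∃ a : ℝ, 0 ≤ a ∧ a ≤ 1 ∧
    x = comb q (fun t => ((bs l w n t : ℝ) + if t = j then 1 - a else if t = k then a else 0)
      / Ln l n)

lemma onS_inC {n : ℕ} {w : ℕ → ℕ × ℕ} {j k : Fin 3} (hjk : j ≠ k) {x : E2}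
    (h : onS q l n w j k x) : inC q l n w x := by
  obtain ⟨a, h0, h1, rfl⟩ := h
  refine ⟨fun t => if t = j then 1 - a else if t = k then a else 0, ?_, ?_, rfl⟩
  · intro t; dsimp only; split_ifs <;> linarith
  · rw [Fin.sum_univ_three]
    fin_cases j <;> fin_cases k <;> simp at hjk ⊢

lemma onS_child {n : ℕ} (H : Hyp q l) {w : ℕ → ℕ × ℕ} {j k : Fin 3} (hjk : j ≠ k)
    {x : E2} (h : onS q l n w j k x) : ∃ s, s ≤ l n - 1 ∧
      onS q l (n + 1) (Function.update w n (side (l n) j k s)) j k x := by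
  obtain ⟨a, h0, h1, rfl⟩ := h
  have h5 := H.hl n
  have hl0 : (0 : ℝ) < l n := by positivity
  have hL := Ln_posR H n
  have ex : ∃ s : ℕ, s ≤ l n - 1 ∧ (s : ℝ) ≤ l n * a ∧ l n * a ≤ s + 1 := by
    by_cases ha : a = 1
    · refine ⟨l n - 1, le_rfl, ?_, ?_⟩
      · rw [ha, Nat.cast_sub (by omega)]; simp
      · rw [ha, Nat.cast_sub (by omega)]; simp
    · refine ⟨⌊l n * a⌋₊, ?_, Nat.floor_le (by positivity), (Nat.lt_floor_add_one _).le⟩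
      have : ⌊l n * a⌋₊ < l n := by
        rw [Nat.floor_lt (by positivity)]
        have : a < 1 := lt_of_le_of_ne h1 ha
        nlinarith
      omega
  obtain ⟨s, hs, hs1, hs2⟩ := ex
  refine ⟨s, hs, l n * a - s, by linarith, by linarith, ?_⟩
  congr 1
  ext t
  simp only [bs, bs_upd, Function.update_self, co_side hjk hs, sco, Ln_succ]
  have e : ((l n - 1 - s : ℕ) : ℝ) = l n - 1 - s := by
    rw [Nat.cast_sub hs, Nat.cast_sub (by omega)]; simp
  split_ifs with h2 h3
  · push_cast [e]; field_simp; ring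
  · push_cast; field_simp; ring
  · push_cast; field_simp; ring

lemma onS_G {n : ℕ} (H : Hyp q l) {w : ℕ → ℕ × ℕ} (hw : Val l n w) {j k : Fin 3} (hjk : j ≠ k)
    {x : E2} (h : onS q l n w j k x) : x ∈ Gasket q l := by
  have up : ∀ m, n ≤ m → ∃ v, Val l m v ∧ onS q l m v j k x := by
    intro m hm
    induction m, hm using Nat.le_induction with
    | base => exact ⟨w, hw, h⟩
    | succ m hm ih =>
      obtain ⟨v, hv, h1⟩ := ih
      obtain ⟨s, hs, h2⟩ := onS_child H hjk h1
      exact ⟨_, hv.upd (side_mem hjk hs), h2⟩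
  rw [mem_G H]
  intro m
  obtain ⟨v, hv, h1⟩ := up (max n m) (le_max_left _ _)
  have h2 := inC_le H (le_max_right n m) hv (onS_inC hjk h1)
  refine ⟨tr m v, tr_mem (hv.mono (le_max_right _ _)), ?_⟩
  rwa [inC_tr le_rfl]

lemma pt_G {n : ℕ} (H : Hyp q l) {w : ℕ → ℕ × ℕ} (hw : Val l n w) (j : Fin 3) :
    pt q (Ln l n) (vt l n w j) ∈ Gasket q l := by
  refine onS_G H hw (ne_succ j) ⟨0, le_rfl, zero_le_one, ?_⟩
  unfold pt
  congr 1
  ext t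
  by_cases h : t = j
  · subst h; simp [vt]
  · simp [vt, h]

/-- a vertex belongs to at most two cells -/
lemma two_cells (H : Hyp q l) {n : ℕ} {w₁ w₂ w₃ : ℕ → ℕ × ℕ} (h₁ : Val l n w₁) (h₂ : Val l n w₂)
    (h₃ : Val l n w₃) {j₁ j₂ j₃ : Fin 3} (e : vt l n w₁ j₁ = vt l n w₂ j₂)
    (e' : vt l n w₁ j₁ = vt l n w₃ j₃) :
    bs l w₁ n = bs l w₂ n ∨ bs l w₁ n = bs l w₃ n ∨ bs l w₂ n = bs l w₃ n := by
  induction n generalizing j₁ j₂ j₃ with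
  | zero => left; rfl
  | succ n ih =>
    have h5 := H.hl n
    have v₁ := h₁.mono (Nat.le_succ n)
    have v₂ := h₂.mono (Nat.le_succ n)
    have v₃ := h₃.mono (Nat.le_succ n)
    -- case: on the coarse lattice
    by_cases hd : ∀ t, l n ∣ vt l (n + 1) w₁ j₁ t
    · obtain ⟨a₁, b₁⟩ := corner_of_dvd H h₁ hd
      obtain ⟨a₂, b₂⟩ := corner_of_dvd H h₂ (j := j₂) (by rw [← e]; exact hd)
      obtain ⟨a₃, b₃⟩ := corner_of_dvd H h₃ (j := j₃) (by rw [← e']; exact hd)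
      have c2 : vt l n w₁ j₁ = vt l n w₂ j₂ := by
        ext t
        have := congrFun e t
        rw [b₁, b₂] at this
        exact Nat.eq_of_mul_eq_mul_left (by omega) this
      have c3 : vt l n w₁ j₁ = vt l n w₃ j₃ := by
        ext t
        have := congrFun e' t
        rw [b₁, b₃] at this
        exact Nat.eq_of_mul_eq_mul_left (by omega) this
      have fin : ∀ {w v : ℕ → ℕ × ℕ} {j k : Fin 3}, bs l w n = bs l v n →
          vt l n w j = vt l n v k → w n = cnr (l n) j → v n = cnr (l n) k →
          bs l w (n + 1) = bs l v (n + 1) := by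
        intro w v j k hb hv hwn hvn
        have : j = k := by
          have h1 := congrFun hv j
          simp only [vt, Pi.add_apply, hb, Pi.single_eq_same] at h1
          by_contra hne
          rw [Pi.single_eq_of_ne hne] at h1
          omega
        subst this
        ext t
        simp only [bs, hb, hwn, hvn]
      rcases ih v₁ v₂ v₃ c2 c3 with h | h | h
      · left; exact fin h c2 a₁ a₂
      · right; left; exact fin h c3 a₁ a₃
      · right; right; exact fin h (c2.symm.trans c3) a₂ a₃
    · have par : ∀ {w : ℕ → ℕ × ℕ} {j : Fin 3}, Val l (n + 1) w →
          vt l (n + 1) w₁ j₁ = vt l (n + 1) w j → bs l w₁ n = bs l w n := by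
        intro w j hw ew
        by_contra hne
        obtain ⟨a, b, -, h⟩ := int_vertex H v₁ (hw.mono (Nat.le_succ n)) hne
          (inC_mono H h₁ (inC_vt q l (n + 1) w₁ j₁))
          (inC_mono H hw (by rw [ew]; exact inC_vt q l (n + 1) w j))
        apply hd
        rw [← pt_cnr (n := n) H w₁ a] at h
        have := pt_inj H (vt_sum H h₁ j₁) (vt_sum H (v₁.upd (cnr_mem _ a)) a) h
        rw [vt_cnr H] at this
        intro t
        rw [this]
        exact Dvd.intro _ rfl
      have p2 := par h₂ e
      have p3 := par h₃ e'
      have f2 : ∀ t, co (l n) (w₁ n) t + (Pi.single j₁ 1 : Fin 3 → ℕ) t =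
          co (l n) (w₂ n) t + (Pi.single j₂ 1 : Fin 3 → ℕ) t := by
        intro t
        have := congrFun e t
        rw [vt_succ, vt_succ, p2] at this
        simpa [lv] using this
      have f3 : ∀ t, co (l n) (w₁ n) t + (Pi.single j₁ 1 : Fin 3 → ℕ) t =
          co (l n) (w₃ n) t + (Pi.single j₃ 1 : Fin 3 → ℕ) t := by
        intro t
        have := congrFun e' t
        rw [vt_succ, vt_succ, p3] at this
        simpa [lv] using this
      have key : ∀ t, bs l w₁ n t = bs l w₂ n t := fun t => congrFun p2 t
      have key' : ∀ t, bs l w₁ n t = bs l w₃ n t := fun t => congrFun p3 t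
      by_cases j12 : j₁ = j₂
      · left; ext t
        have := f2 t
        rw [j12] at this
        simp only [bs, key t]; omega
      by_cases j13 : j₁ = j₃
      · right; left; ext t
        have := f3 t
        rw [j13] at this
        simp only [bs, key' t]; omega
      by_cases j23 : j₂ = j₃
      · right; right; ext t
        have a := f2 t
        have b := f3 t
        rw [j23] at a
        have := key t
        have := key' t
        simp only [bs, ← key t, ← key' t]; omega
      exfalso
      obtain ⟨z1, hz1⟩ := co_zero (h₁ n (by omega))
      obtain ⟨z2, hz2⟩ := co_zero (h₂ n (by omega))
      obtain ⟨z3, hz3⟩ := co_zero (h₃ n (by omega))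
      have hs := co_sum (h₁ n (by omega))
      have a0 := f2 0
      have a1 := f2 1
      have a2 := f2 2
      have b0 := f3 0
      have b1 := f3 1
      have b2 := f3 2
      fin_cases j₁ <;> fin_cases j₂ <;> fin_cases j₃ <;>
        simp at j12 j13 j23 a0 a1 a2 b0 b1 b2 <;>
        (fin_cases z1 <;> simp at hz1 <;> try omega) <;>
        (fin_cases z2 <;> simp at hz2 <;> try omega) <;>
        (fin_cases z3 <;> simp at hz3 <;> try omega)

/-! ### topology -/

lemma wordMap_cont (q : Fin 3 → E2) (l : ℕ → ℕ) (w : ℕ → ℕ × ℕ) (n : ℕ) :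
    Continuous (wordMap q l w n) := by
  induction n with
  | zero => exact continuous_id
  | succ n ih =>
    refine ih.comp ?_
    unfold fmap
    fun_prop

lemma Tri_compact (q : Fin 3 → E2) : IsCompact (Tri q) :=
  (Set.finite_range q).isCompact_convexHull ℝ

lemma img_compact (q : Fin 3 → E2) (l : ℕ → ℕ) (w : ℕ → ℕ × ℕ) (n : ℕ) :
    IsCompact (wordMap q l w n '' Tri q) := (Tri_compact q).image (wordMap_cont q l w n)

lemma G_compact (H : Hyp q l) : IsCompact (Gasket q l) := by
  have hc : IsClosed (Gasket q l) := isClosed_iInter fun n =>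
    (Wn_finite H n).isClosed_biUnion fun w _ => (img_compact q l w n).isClosed
  refine (Tri_compact q).of_isClosed_subset hc ?_
  intro x hx
  obtain ⟨w, hw, h⟩ := (mem_G H).1 hx 0
  have := (mem_image_iff H hw.1).2 h
  simpa [wordMap] using this

lemma Cell_closed (H : Hyp q l) (n : ℕ) (w : ℕ → ℕ × ℕ) : IsClosed (Cell q l n w) :=
  (G_compact H).isClosed.inter (img_compact q l w n).isClosed

/-- nearby points share a cell -/
lemma soft (H : Hyp q l) (n : ℕ) (x : E2) :
    ∀ᶠ y in nhds x, y ∈ Gasket q l → ∃ w ∈ Wn l n, inC q l n w x ∧ inC q l n w y := by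
  have hc : IsClosed (⋃ w ∈ {w ∈ Wn l n | ¬ inC q l n w x}, wordMap q l w n '' Tri q) :=
    ((Wn_finite H n).subset (Set.sep_subset _ _)).isClosed_biUnion
      fun w _ => (img_compact q l w n).isClosed
  have hx : x ∈ (⋃ w ∈ {w ∈ Wn l n | ¬ inC q l n w x}, wordMap q l w n '' Tri q)ᶜ := by
    simp only [Set.mem_compl_iff, Set.mem_iUnion, not_exists]
    rintro w hw hxw
    exact hw.2 ((mem_image_iff H hw.1.1).1 hxw)
  filter_upwards [hc.isOpen_compl.mem_nhds hx] with y hy hyG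
  obtain ⟨w, hw, hyw⟩ := (mem_G H).1 hyG n
  refine ⟨w, hw, ?_, hyw⟩
  by_contra hcon
  apply hy
  simp only [Set.mem_iUnion]
  exact ⟨w, ⟨hw, hcon⟩, (mem_image_iff H hw.1).2 hyw⟩

end TG


namespace TG
variable {q : Fin 3 → E2} {l : ℕ → ℕ}

/-! ### local energy and harmonic extension -/

def e0 (a b : Fin 3 → ℝ) : ℝ :=
  (a 0 - a 1) * (b 0 - b 1) + (a 1 - a 2) * (b 1 - b 2) + (a 2 - a 0) * (b 2 - b 0)

lemma E0_eq (q : Fin 3 → E2) (u v : E2 → ℝ) : E0 q u v = e0 (fun j => u (q j)) (fun j => v (q j)) := by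
  simp only [E0, e0, Fin.sum_univ_three]
  ring

lemma e0_nonneg (a : Fin 3 → ℝ) : 0 ≤ e0 a a := by
  simp only [e0]
  nlinarith [sq_nonneg (a 0 - a 1), sq_nonneg (a 1 - a 2), sq_nonneg (a 2 - a 0)]

/-- numerator of the harmonic basis function -/
def nN (L p y : ℕ) : ℝ :=
  if p = L then 6 * L + 1 else if 2 ≤ p then 6 * p - 2 + 3 * y else
  if p = 1 then (if y = 1 then 6 else 5) else if y = 0 then 0 else if y = 1 then 4 else 5

def h3 (L : ℕ) (a : Fin 3 → ℝ) (x y z : ℕ) : ℝ :=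
  rl L / 9 * (a 0 * nN L x (min y z) + a 1 * nN L y (min z x) + a 2 * nN L z (min x y))

def hL (L : ℕ) (a : Fin 3 → ℝ) (P : Fin 3 → ℕ) : ℝ := h3 L a (P 0) (P 1) (P 2)

lemma rl_pos (L : ℕ) : 0 < rl L := by unfold rl; positivity

lemma rl_mul (L : ℕ) : rl L / 9 * (6 * L + 1) = 1 := by
  unfold rl
  have : (0 : ℝ) < 2 * L / 3 + 1 / 9 := by positivity
  field_simp
  ring

/-- local vertices of the side letters as explicit triples -/
def eU (L : ℕ) (a : Fin 3 → ℝ) (U : ℕ → ℕ → ℕ → ℝ) (i : ℕ × ℕ) : ℝ :=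
  e0 (fun j => h3 L a (lv L i j 0) (lv L i j 1) (lv L i j 2))
    (fun j => U (lv L i j 0) (lv L i j 1) (lv L i j 2))

lemma eU_eq (L : ℕ) (a : Fin 3 → ℝ) (U : ℕ → ℕ → ℕ → ℝ) (i : ℕ × ℕ) {x y z : ℕ}
    (hx : co L i = ![x, y, z]) : eU L a U i =
      e0 ![h3 L a (x + 1) y z, h3 L a x (y + 1) z, h3 L a x y (z + 1)]
        ![U (x + 1) y z, U x (y + 1) z, U x y (z + 1)] := by
  simp [eU, lv, hx, e0]

lemma mid_cell (M : ℕ) (a : Fin 3 → ℝ) (U : ℕ → ℕ → ℕ → ℝ) (x y : ℕ) (hx : 2 ≤ x) (hy : 2 ≤ y)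
    (h : x + y = M + 4) :
    e0 ![h3 (M + 5) a (x + 1) y 0, h3 (M + 5) a x (y + 1) 0, h3 (M + 5) a x y 1]
        ![U (x + 1) y 0, U x (y + 1) 0, U x y 1] =
      rl (M + 5) * (a 0 - a 1) * (U (x + 1) y 0 - U x (y + 1) 0) ∧
    e0 ![h3 (M + 5) a 1 x y, h3 (M + 5) a 0 (x + 1) y, h3 (M + 5) a 0 x (y + 1)]
        ![U 1 x y, U 0 (x + 1) y, U 0 x (y + 1)] =
      rl (M + 5) * (a 1 - a 2) * (U 0 (x + 1) y - U 0 x (y + 1)) ∧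
    e0 ![h3 (M + 5) a (y + 1) 0 x, h3 (M + 5) a y 1 x, h3 (M + 5) a y 0 (x + 1)]
        ![U (y + 1) 0 x, U y 1 x, U y 0 (x + 1)] =
      rl (M + 5) * (a 2 - a 0) * (U y 0 (x + 1) - U (y + 1) 0 x) := by
  have hxy : (x : ℝ) + y = M + 4 := by exact_mod_cast h
  have c1 : ¬ (x = M + 5) := by omega
  have c2 : ¬ (y = M + 5) := by omega
  have c3 : ¬ (x + 1 = M + 5) := by omega
  have c4 : ¬ (y + 1 = M + 5) := by omega
  have c5 : ¬ (x = 0) := by omega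
  have c6 : ¬ (y = 0) := by omega
  have c7 : ¬ (x = 1) := by omega
  have c8 : ¬ (y = 1) := by omega
  have c9 : 2 ≤ x + 1 := by omega
  have c10 : 2 ≤ y + 1 := by omega
  have m1 : min x y = 0 ↔ False := by simp; omega
  have m2 : min y x = 0 ↔ False := by simp; omega
  have m3 : min (x + 1) y = 0 ↔ False := by simp; omega
  have m4 : min x (y + 1) = 0 ↔ False := by simp; omega
  have m1' : min x y = 1 ↔ False := by simp; omega
  have m3' : min (x + 1) y = 1 ↔ False := by simp; omega
  have m4' : min x (y + 1) = 1 ↔ False := by simp; omega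
  have m5 : min 1 x = 1 := by omega
  have m6 : min 1 y = 1 := by omega
  have m7 : min x 1 = 1 := by omega
  have m8 : min y 1 = 1 := by omega
  have d1 : ¬ (0 = M + 5) := by omega
  have d2 : ¬ (1 = M + 5) := by omega
  refine ⟨?_, ?_, ?_⟩ <;>
  · simp only [e0, h3, nN, Matrix.cons_val_zero, Matrix.cons_val_one, Matrix.cons_val,
      c1, c2, c3, c4, c5, c6, c7, c8, c9, c10, hx, hy, m1, m2, m3, m4, m1', m3', m4', min_comm y x,
      min_comm y (x + 1), min_comm (y + 1) x, d1, d2, m5, m6, m7, m8,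
      if_true, if_false, Nat.zero_min, Nat.min_zero, show ¬ (2 ≤ 0) by omega,
      show ¬ (2 ≤ 1) by omega, show ¬ (0 = 1) by omega, show ¬ (1 = 0) by omega]
    push_cast
    rw [show (y : ℝ) = M + 4 - x by linarith]
    ring

lemma min_1_add (M n : ℕ) : min 1 (M + n + 1) = 1 := by omega
lemma min_add_1 (M n : ℕ) : min (M + n + 1) 1 = 1 := by omega

lemma corner_cells (M : ℕ) (a : Fin 3 → ℝ) (U : ℕ → ℕ → ℕ → ℝ) :
    (e0 ![h3 (M + 5) a (M + 5) 0 0, h3 (M + 5) a (M + 4) 1 0, h3 (M + 5) a (M + 4) 0 1]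
        ![U (M + 5) 0 0, U (M + 4) 1 0, U (M + 4) 0 1] +
    e0 ![h3 (M + 5) a (M + 4) 1 0, h3 (M + 5) a (M + 3) 2 0, h3 (M + 5) a (M + 3) 1 1]
        ![U (M + 4) 1 0, U (M + 3) 2 0, U (M + 3) 1 1] +
    e0 ![h3 (M + 5) a (M + 4) 0 1, h3 (M + 5) a (M + 3) 1 1, h3 (M + 5) a (M + 3) 0 2]
        ![U (M + 4) 0 1, U (M + 3) 1 1, U (M + 3) 0 2] =
      rl (M + 5) * ((2 * a 0 - a 1 - a 2) * U (M + 5) 0 0 - (a 0 - a 1) * U (M + 3) 2 0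
        - (a 0 - a 2) * U (M + 3) 0 2)) ∧
    (e0 ![h3 (M + 5) a 1 (M + 4) 0, h3 (M + 5) a 0 (M + 5) 0, h3 (M + 5) a 0 (M + 4) 1]
        ![U 1 (M + 4) 0, U 0 (M + 5) 0, U 0 (M + 4) 1] +
    e0 ![h3 (M + 5) a 1 (M + 3) 1, h3 (M + 5) a 0 (M + 4) 1, h3 (M + 5) a 0 (M + 3) 2]
        ![U 1 (M + 3) 1, U 0 (M + 4) 1, U 0 (M + 3) 2] +
    e0 ![h3 (M + 5) a 2 (M + 3) 0, h3 (M + 5) a 1 (M + 4) 0, h3 (M + 5) a 1 (M + 3) 1]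
        ![U 2 (M + 3) 0, U 1 (M + 4) 0, U 1 (M + 3) 1] =
      rl (M + 5) * ((2 * a 1 - a 2 - a 0) * U 0 (M + 5) 0 - (a 1 - a 2) * U 0 (M + 3) 2
        - (a 1 - a 0) * U 2 (M + 3) 0)) ∧
    (e0 ![h3 (M + 5) a 1 0 (M + 4), h3 (M + 5) a 0 1 (M + 4), h3 (M + 5) a 0 0 (M + 5)]
        ![U 1 0 (M + 4), U 0 1 (M + 4), U 0 0 (M + 5)] +
    e0 ![h3 (M + 5) a 2 0 (M + 3), h3 (M + 5) a 1 1 (M + 3), h3 (M + 5) a 1 0 (M + 4)]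
        ![U 2 0 (M + 3), U 1 1 (M + 3), U 1 0 (M + 4)] +
    e0 ![h3 (M + 5) a 1 1 (M + 3), h3 (M + 5) a 0 2 (M + 3), h3 (M + 5) a 0 1 (M + 4)]
        ![U 1 1 (M + 3), U 0 2 (M + 3), U 0 1 (M + 4)] =
      rl (M + 5) * ((2 * a 2 - a 0 - a 1) * U 0 0 (M + 5) - (a 2 - a 0) * U 2 0 (M + 3)
        - (a 2 - a 1) * U 0 2 (M + 3))) := by
  have d0 : ¬ (0 = M + 5) := by omega
  have d1 : ¬ (1 = M + 5) := by omega
  have d2 : ¬ (2 = M + 5) := by omega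
  have d3 : ¬ (M + 3 = M + 5) := by omega
  have d4 : ¬ (M + 4 = M + 5) := by omega
  have g3 : 2 ≤ M + 3 := by omega
  have g4 : 2 ≤ M + 4 := by omega
  have k1 : min 1 (M + 3) = 1 := by omega
  have k2 : min (M + 3) 1 = 1 := by omega
  have k3 : min 1 (M + 4) = 1 := by omega
  have k4 : min (M + 4) 1 = 1 := by omega
  have k5 : min 2 (M + 3) = 2 := by omega
  have k6 : min (M + 3) 2 = 2 := by omega
  refine ⟨?_, ?_, ?_⟩ <;>
  · simp only [e0, h3, nN, Matrix.cons_val_zero, Matrix.cons_val_one, Matrix.cons_val,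
      d0, d1, d2, d3, d4, g3, g4, k1, k2, k3, k4, k5, k6,
      if_true, if_false, Nat.zero_min, Nat.min_zero, min_self, show ¬ (2 ≤ 0) by omega, le_refl,
      show ¬ (2 ≤ 1) by omega, show ¬ (0 = 1) by omega, show ¬ (1 = 0) by omega,
      show ¬ (2 = 1) by omega, show ¬ (2 = 0) by omega]
    push_cast
    ring

/-- the key flow identity -/
lemma star {L : ℕ} (h5 : 5 ≤ L) (a : Fin 3 → ℝ) (U : ℕ → ℕ → ℕ → ℝ) :
    ∑ i ∈ SF L, eU L a U i = rl L * e0 a ![U L 0 0, U 0 L 0, U 0 0 L] := by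
  obtain ⟨M, rfl⟩ := Nat.exists_eq_add_of_le' h5
  rw [sum_SF h5, show M + 5 - 1 = (M + 1) + 1 + 1 + 1 by omega, Finset.sum_range_succ,
    Finset.sum_range_succ', Finset.sum_range_succ']
  have co01 : ∀ s, s ≤ M + 4 → co (M + 5) (side (M + 5) 0 1 s) = ![M + 4 - s, s, 0] := by
    intro s hs
    rw [co_side (by decide) (by omega)]
    ext t; fin_cases t <;> simp [sco]
  have co12 : ∀ s, s ≤ M + 4 → co (M + 5) (side (M + 5) 1 2 s) = ![0, M + 4 - s, s] := by
    intro s hs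
    rw [co_side (by decide) (by omega)]
    ext t; fin_cases t <;> simp [sco]
  have co20 : ∀ s, s ≤ M + 4 → co (M + 5) (side (M + 5) 2 0 s) = ![s, 0, M + 4 - s] := by
    intro s hs
    rw [co_side (by decide) (by omega)]
    ext t; fin_cases t <;> simp [sco]
  have mid : ∑ t ∈ Finset.range (M + 1), (eU (M + 5) a U (side (M + 5) 0 1 (t + 1 + 1)) +
      eU (M + 5) a U (side (M + 5) 1 2 (t + 1 + 1)) + eU (M + 5) a U (side (M + 5) 2 0 (t + 1 + 1)))
      = rl (M + 5) * (a 0 - a 1) * (U (M + 3) 2 0 - U 2 (M + 3) 0) +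
        rl (M + 5) * (a 1 - a 2) * (U 0 (M + 3) 2 - U 0 2 (M + 3)) +
        rl (M + 5) * (a 2 - a 0) * (U 2 0 (M + 3) - U (M + 3) 0 2) := by
    have tel : ∀ t ∈ Finset.range (M + 1), (eU (M + 5) a U (side (M + 5) 0 1 (t + 1 + 1)) +
      eU (M + 5) a U (side (M + 5) 1 2 (t + 1 + 1)) + eU (M + 5) a U (side (M + 5) 2 0 (t + 1 + 1)))
      = (fun s => rl (M + 5) * (a 0 - a 1) * - U (M + 3 - s) (s + 2) 0 +
         rl (M + 5) * (a 1 - a 2) * - U 0 (M + 3 - s) (s + 2) +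
         rl (M + 5) * (a 2 - a 0) * - U (s + 2) 0 (M + 3 - s)) (t + 1) -
        (fun s => rl (M + 5) * (a 0 - a 1) * - U (M + 3 - s) (s + 2) 0 +
         rl (M + 5) * (a 1 - a 2) * - U 0 (M + 3 - s) (s + 2) +
         rl (M + 5) * (a 2 - a 0) * - U (s + 2) 0 (M + 3 - s)) t := by
      intro t ht
      rw [Finset.mem_range] at ht
      rw [eU_eq _ _ _ _ (co01 _ (by omega)), eU_eq _ _ _ _ (co12 _ (by omega)),
        eU_eq _ _ _ _ (co20 _ (by omega))]
      have := mid_cell M a U (M + 4 - (t + 1 + 1)) (t + 1 + 1) (by omega) (by omega) (by omega)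
      simp only [zero_add]
      rw [this.1, this.2.1, this.2.2]
      rw [show M + 4 - (t + 1 + 1) + 1 = M + 3 - t by omega,
        show M + 4 - (t + 1 + 1) = M + 3 - (t + 1) by omega]
      ring
    rw [Finset.sum_congr rfl tel, Finset.sum_range_sub (fun s =>
         rl (M + 5) * (a 0 - a 1) * - U (M + 3 - s) (s + 2) 0 +
         rl (M + 5) * (a 1 - a 2) * - U 0 (M + 3 - s) (s + 2) +
         rl (M + 5) * (a 2 - a 0) * - U (s + 2) 0 (M + 3 - s))]
    simp only [Nat.sub_zero, zero_add, show M + 3 - (M + 1) = 2 by omega,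
      show M + 1 + 2 = M + 3 by omega]
    ring
  rw [mid]
  rw [eU_eq _ _ _ _ (co01 _ (by omega)), eU_eq _ _ _ _ (co12 _ (by omega)),
    eU_eq _ _ _ _ (co20 _ (by omega)), eU_eq _ _ _ _ (co01 _ (by omega)),
    eU_eq _ _ _ _ (co12 _ (by omega)), eU_eq _ _ _ _ (co20 _ (by omega)),
    eU_eq _ _ _ _ (co01 _ (by omega)), eU_eq _ _ _ _ (co12 _ (by omega)),
    eU_eq _ _ _ _ (co20 _ (by omega))]
  obtain ⟨k0, k1, k2⟩ := corner_cells M a U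
  simp only [Nat.sub_zero, zero_add, show M + 4 - (M + 1 + 1 + 1) = 1 by omega,
    show M + 1 + 1 + 1 = M + 3 by omega, show M + 4 - 1 = M + 3 by omega,
    show M + 4 + 1 = M + 5 by omega, show M + 3 + 1 = M + 4 by omega, one_add_one_eq_two]
  have : e0 a ![U (M + 5) 0 0, U 0 (M + 5) 0, U 0 0 (M + 5)] =
    (2 * a 0 - a 1 - a 2) * U (M + 5) 0 0 + (2 * a 1 - a 2 - a 0) * U 0 (M + 5) 0 +
    (2 * a 2 - a 0 - a 1) * U 0 0 (M + 5) := by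
    simp [e0]; ring
  rw [this]
  linear_combination k0 + k1 + k2

lemma h3_corner (L : ℕ) (h5 : 5 ≤ L) (a : Fin 3 → ℝ) :
    h3 L a L 0 0 = a 0 ∧ h3 L a 0 L 0 = a 1 ∧ h3 L a 0 0 L = a 2 := by
  have := rl_mul L
  have h0 : ¬ (0 = L) := by omega
  simp only [h3, nN, if_true, h0, if_false, Nat.zero_min, Nat.min_zero, show ¬ (2 ≤ 0) by omega,
    show ¬ (0 = 1) by omega]
  exact ⟨by linear_combination (a 0) * this, by linear_combination (a 1) * this,
    by linear_combination (a 2) * this⟩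

/-- trace inequality -/
lemma trace_ineq {L : ℕ} (h5 : 5 ≤ L) (U : ℕ → ℕ → ℕ → ℝ) :
    rl L * e0 ![U L 0 0, U 0 L 0, U 0 0 L] ![U L 0 0, U 0 L 0, U 0 0 L] ≤
      ∑ i ∈ SF L, e0 (fun j => U (lv L i j 0) (lv L i j 1) (lv L i j 2))
        (fun j => U (lv L i j 0) (lv L i j 1) (lv L i j 2)) := by
  set a := ![U L 0 0, U 0 L 0, U 0 0 L] with ha
  have s1 := star h5 a U
  have s2 := star h5 a (h3 L a)
  obtain ⟨c0, c1, c2⟩ := h3_corner L h5 a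
  rw [c0, c1, c2] at s2
  have ea : ![a 0, a 1, a 2] = a := by ext t; fin_cases t <;> rfl
  rw [ea] at s2
  have : 0 ≤ ∑ i ∈ SF L, (e0 (fun j => U (lv L i j 0) (lv L i j 1) (lv L i j 2))
        (fun j => U (lv L i j 0) (lv L i j 1) (lv L i j 2)) - 2 * eU L a U i +
        eU L a (h3 L a) i) := by
    apply Finset.sum_nonneg
    intro i _
    have := e0_nonneg (fun j => U (lv L i j 0) (lv L i j 1) (lv L i j 2) -
      h3 L a (lv L i j 0) (lv L i j 1) (lv L i j 2))
    refine this.trans (le_of_eq ?_)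
    simp only [eU, e0]
    ring
  rw [Finset.sum_add_distrib, Finset.sum_sub_distrib, ← Finset.mul_sum, s1, s2] at this
  linarith

lemma harm_energy {L : ℕ} (h5 : 5 ≤ L) (a : Fin 3 → ℝ) :
    ∑ i ∈ SF L, e0 (fun j => hL L a (lv L i j)) (fun j => hL L a (lv L i j)) = rl L * e0 a a := by
  have s2 := star h5 a (h3 L a)
  obtain ⟨c0, c1, c2⟩ := h3_corner L h5 a
  rw [c0, c1, c2] at s2
  have ea : ![a 0, a 1, a 2] = a := by ext t; fin_cases t <;> rfl
  rw [ea] at s2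
  exact s2

lemma nN_nonneg (L p y : ℕ) : 0 ≤ nN L p y := by
  unfold nN
  split_ifs with h1 h2
  · positivity
  · have : (2 : ℝ) ≤ p := by exact_mod_cast h2
    have : (0 : ℝ) ≤ y := by positivity
    linarith
  all_goals norm_num

lemma nN_sum_aux {L x y z : ℕ} (h5 : 5 ≤ L) (hs : x + y + z = L) (hz : z ≤ 1) :
    nN L x (min y z) + nN L y (min z x) + nN L z (min x y) = 6 * L + 1 := by
  have hc : (x : ℝ) + y + z = L := by exact_mod_cast hs
  have hz' : z = 0 ∨ z = 1 := by omega
  have zL : ¬ (z = L) := by omega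
  by_cases hx : x ≤ 1
  · have hx' : x = 0 ∨ x = 1 := by omega
    have hy : 2 ≤ y := by omega
    have m1 : min y z = z := by omega
    have m2 : min x y = x := by omega
    rcases hx' with rfl | rfl <;> rcases hz' with rfl | rfl <;>
      simp [nN, m1, m2, hy, zL, show (y = L) ↔ _ from Iff.rfl, show ¬ (0 = L) by omega,
        show ¬ (1 = L) by omega] <;>
      first
      | (intro hh; exfalso; omega)
      | (rw [if_neg (by omega)]; push_cast at hc; linarith)
  · by_cases hy : y ≤ 1
    · have hy' : y = 0 ∨ y = 1 := by omega
      have hx2 : 2 ≤ x := by omega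
      have m1 : min z x = z := by omega
      have m2 : min x y = y := by omega
      rcases hy' with rfl | rfl <;> rcases hz' with rfl | rfl <;>
        simp [nN, m1, m2, hx2, show ¬ (0 = L) by omega,
          show ¬ (1 = L) by omega] <;>
        first
        | (intro hh; exfalso; omega)
        | (rw [if_neg (by omega)]; push_cast at hc; linarith)
    · have m0 : ¬ (min x y = 0) := by omega
      have m1 : ¬ (min x y = 1) := by omega
      have m2 : min y z = z := by omega
      have m3 : min z x = z := by omega
      have k1 : ¬ (x = L) := by omega
      have k2 : ¬ (y = L) := by omega
      have k3 : 2 ≤ x := by omega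
      have k4 : 2 ≤ y := by omega
      simp only [nN, m0, m1, m2, m3, k1, k2, k3, k4, zL, if_true, if_false]
      rcases hz' with rfl | rfl
      · norm_num; push_cast at hc; linarith
      · norm_num; push_cast at hc; linarith

lemma nN_sum {L : ℕ} (h5 : 5 ≤ L) {i : ℕ × ℕ} (hi : i ∈ Sset L) (j : Fin 3) :
    nN L (lv L i j 0) (min (lv L i j 1) (lv L i j 2)) +
    nN L (lv L i j 1) (min (lv L i j 2) (lv L i j 0)) +
    nN L (lv L i j 2) (min (lv L i j 0) (lv L i j 1)) = 6 * L + 1 := by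
  have hs := lv_sum h5 hi j
  have hz : lv L i j 0 ≤ 1 ∨ lv L i j 1 ≤ 1 ∨ lv L i j 2 ≤ 1 := by
    obtain ⟨t, ht⟩ := co_zero hi
    have : lv L i j t ≤ 1 := by
      simp only [lv, Pi.add_apply, ht, zero_add]
      by_cases h : t = j
      · subst h; simp
      · simp [h]
    fin_cases t
    · left; exact this
    · right; left; exact this
    · right; right; exact this
  rcases hz with h | h | h
  · have := nN_sum_aux h5 (x := lv L i j 1) (y := lv L i j 2) (z := lv L i j 0) (by omega) h
    linarith
  · have := nN_sum_aux h5 (x := lv L i j 2) (y := lv L i j 0) (z := lv L i j 1) (by omega) h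
    linarith
  · exact nN_sum_aux h5 hs h

lemma hL_bounds {L : ℕ} (h5 : 5 ≤ L) {i : ℕ × ℕ} (hi : i ∈ Sset L) (j : Fin 3) (a : Fin 3 → ℝ)
    {A B : ℝ} (hA : ∀ t, A ≤ a t) (hB : ∀ t, a t ≤ B) :
    A ≤ hL L a (lv L i j) ∧ hL L a (lv L i j) ≤ B := by
  have hs := nN_sum h5 hi j
  have hr := rl_mul L
  have hp := rl_pos L
  simp only [hL, h3]
  set x := nN L (lv L i j 0) (min (lv L i j 1) (lv L i j 2))
  set y := nN L (lv L i j 1) (min (lv L i j 2) (lv L i j 0))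
  set z := nN L (lv L i j 2) (min (lv L i j 0) (lv L i j 1))
  have hx : 0 ≤ x := nN_nonneg _ _ _
  have hy : 0 ≤ y := nN_nonneg _ _ _
  have hz : 0 ≤ z := nN_nonneg _ _ _
  rw [← hs] at hr
  constructor
  · calc A = rl L / 9 * (A * x + A * y + A * z) := by linear_combination (-A) * hr
      _ ≤ _ := by gcongr <;> exact hA _
  · calc _ ≤ rl L / 9 * (B * x + B * y + B * z) := by gcongr <;> exact hB _
      _ = B := by linear_combination B * hr

end TG


namespace TG
variable {q : Fin 3 → E2} {l : ℕ → ℕ}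

/-- vertex points -/
def vp (q : Fin 3 → E2) (l : ℕ → ℕ) (n : ℕ) (w : ℕ → ℕ × ℕ) (j : Fin 3) : E2 :=
  pt q (Ln l n) (vt l n w j)

lemma Rn_succ (l : ℕ → ℕ) (n : ℕ) : Rn l (n + 1) = Rn l n * rl (l n) := by
  simp [Rn, Finset.prod_range_succ]

lemma Rn_pos (l : ℕ → ℕ) (n : ℕ) : 0 < Rn l n := Finset.prod_pos fun _ _ => rl_pos _

lemma En_eq (H : Hyp q l) (n : ℕ) (u v : E2 → ℝ) :
    En q l n u v = (Rn l n)⁻¹ *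
      ∑ w ∈ WF l n, e0 (fun j => u (vp q l n w j)) (fun j => v (vp q l n w j)) := by
  rw [En, finsum_WF H]
  congr 1
  apply Finset.sum_congr rfl
  intro w hw
  rw [mem_WF H] at hw
  rw [E0_eq]
  simp only [Function.comp_apply, wordMap_q H hw.1, vp]

lemma En_nonneg (H : Hyp q l) (n : ℕ) (u : E2 → ℝ) : 0 ≤ En q l n u u := by
  rw [En_eq H]
  exact mul_nonneg (inv_nonneg.2 (Rn_pos l n).le) (Finset.sum_nonneg fun w _ => e0_nonneg _)

lemma En_succ (H : Hyp q l) (n : ℕ) (u : E2 → ℝ) : En q l n u u ≤ En q l (n + 1) u u := by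
  rw [En_eq H, En_eq H, sum_WF_succ n H, Rn_succ, mul_inv, mul_assoc]
  apply mul_le_mul_of_nonneg_left _ (inv_nonneg.2 (Rn_pos l n).le)
  rw [Finset.mul_sum]
  apply Finset.sum_le_sum
  intro w _
  rw [inv_mul_eq_div, le_div_iff₀ (rl_pos _), mul_comm]
  have h5 := H.hl n
  have tr := trace_ineq h5 (fun x y z => u (pt q (Ln l (n + 1))
    (fun t => l n * bs l w n t + (![x, y, z] : Fin 3 → ℕ) t)))
  have c : ∀ j : Fin 3, u (vp q l n w j) = (![
      u (pt q (Ln l (n + 1)) (fun t => l n * bs l w n t + (![l n, 0, 0] : Fin 3 → ℕ) t)),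
      u (pt q (Ln l (n + 1)) (fun t => l n * bs l w n t + (![0, l n, 0] : Fin 3 → ℕ) t)),
      u (pt q (Ln l (n + 1)) (fun t => l n * bs l w n t + (![0, 0, l n] : Fin 3 → ℕ) t))] :
        Fin 3 → ℝ) j := by
    intro j
    rw [vp, ← pt_mul (L := Ln l n) (show 0 < l n by omega), ← Ln_succ]
    fin_cases j <;> simp only [Fin.zero_eta, Fin.mk_one, Fin.reduceFinMk, Matrix.cons_val] <;>
    · congr 2
      ext t
      simp only [vt, Pi.add_apply, mul_add]
      fin_cases t <;> simp
  have c' : (fun j => u (vp q l n w j)) = _ := funext c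
  rw [c']
  refine tr.trans (le_of_eq ?_)
  apply Finset.sum_congr rfl
  intro i _
  have e : ∀ j : Fin 3, (fun t => l n * bs l w n t +
      (![lv (l n) i j 0, lv (l n) i j 1, lv (l n) i j 2] : Fin 3 → ℕ) t) =
      vt l (n + 1) (Function.update w n i) j := by
    intro j
    ext t
    rw [vt_upd_succ]
    fin_cases t <;> rfl
  simp only [e, vp]

lemma En_mono (H : Hyp q l) (u : E2 → ℝ) : Monotone fun n => En q l n u u :=
  monotone_nat_of_le_succ fun n => En_succ H n u

lemma FDom_tendsto (H : Hyp q l) {u : E2 → ℝ} (hu : u ∈ FDom q l) :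
    Tendsto (fun n => En q l n u u) atTop (nhds (EForm q l u u)) := by
  obtain ⟨C, hC⟩ := hu
  have : Tendsto (fun n => En q l n u u) atTop (nhds (⨆ n, En q l n u u)) :=
    tendsto_atTop_ciSup (En_mono H u) ⟨C, by rintro _ ⟨n, rfl⟩; exact hC n⟩
  exact tendsto_nhds_limUnder ⟨_, this⟩

lemma En_le (H : Hyp q l) {u : E2 → ℝ} (hu : u ∈ FDom q l) (n : ℕ) :
    En q l n u u ≤ EForm q l u u := (En_mono H u).ge_of_tendsto (FDom_tendsto H hu) n

lemma EForm_nonneg (H : Hyp q l) {u : E2 → ℝ} (hu : u ∈ FDom q l) : 0 ≤ EForm q l u u :=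
  (En_nonneg H 0 u).trans (En_le H hu 0)

lemma cell_energy (H : Hyp q l) {u : E2 → ℝ} (hu : u ∈ FDom q l) {n : ℕ} {w : ℕ → ℕ × ℕ}
    (hw : w ∈ Wn l n) : e0 (fun j => u (vp q l n w j)) (fun j => u (vp q l n w j)) ≤
      Rn l n * EForm q l u u := by
  have h1 := En_le H hu n
  rw [En_eq H, inv_mul_le_iff₀ (Rn_pos l n)] at h1
  refine le_trans ?_ h1
  exact Finset.single_le_sum (f := fun w => e0 (fun j => u (vp q l n w j))
    (fun j => u (vp q l n w j))) (fun w _ => e0_nonneg _) ((mem_WF H).2 hw)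

/-! ### resistance bounds -/

def RB (q : Fin 3 → E2) (l : ℕ → ℕ) (ρ : ℝ) (x y : E2) : Prop :=
  0 ≤ ρ ∧ ∀ u ∈ FDom q l, ContinuousOn u (Gasket q l) → (u x - u y) ^ 2 ≤ ρ * EForm q l u u

lemma RB_refl (H : Hyp q l) (x : E2) : RB q l 0 x x := ⟨le_rfl, fun u _ _ => by simp⟩

lemma RB_symm {ρ : ℝ} {x y : E2} (h : RB q l ρ x y) : RB q l ρ y x :=
  ⟨h.1, fun u hu hc => by have := h.2 u hu hc; nlinarith⟩

lemma RB_mono (H : Hyp q l) {ρ ρ' : ℝ} {x y : E2} (h : RB q l ρ x y) (hr : ρ ≤ ρ') :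
    RB q l ρ' x y :=
  ⟨h.1.trans hr, fun u hu hc => (h.2 u hu hc).trans
    (mul_le_mul_of_nonneg_right hr (EForm_nonneg H hu))⟩

lemma RB_edge (H : Hyp q l) {n : ℕ} {w : ℕ → ℕ × ℕ} (hw : w ∈ Wn l n) (i j : Fin 3) :
    RB q l (2 / 3 * Rn l n) (vp q l n w i) (vp q l n w j) := by
  refine ⟨by have := Rn_pos l n; positivity, fun u hu _ => ?_⟩
  have h := cell_energy H hu hw
  have h0 := EForm_nonneg H hu
  have hR := Rn_pos l n
  have hp : 0 ≤ Rn l n * EForm q l u u := by positivity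
  simp only [e0] at h
  have key : ∀ a b c : ℝ, (a - b) * (a - b) + (b - c) * (b - c) + (c - a) * (c - a) ≤
      Rn l n * EForm q l u u → (a - b) ^ 2 ≤ 2 / 3 * Rn l n * EForm q l u u := by
    intro a b c h
    nlinarith [sq_nonneg (a - b - 2 * (a - c))]
  fin_cases i <;> fin_cases j <;> simp only [Fin.zero_eta, Fin.mk_one, Fin.reduceFinMk]
  · simp; linarith
  · exact key _ _ (u (vp q l n w 2)) (by linarith)
  · exact key _ _ (u (vp q l n w 1)) (by linarith)
  · exact key _ _ (u (vp q l n w 2)) (by linarith)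
  · simp; linarith
  · exact key _ _ (u (vp q l n w 0)) (by linarith)
  · exact key _ _ (u (vp q l n w 1)) (by linarith)
  · exact key _ _ (u (vp q l n w 0)) (by linarith)
  · simp; linarith

lemma trunc_pair (a b t : ℝ) : (min a t - min b t) * (min a t - min b t) +
    (max a t - max b t) * (max a t - max b t) ≤ (a - b) * (a - b) := by
  rcases le_total a t with h1 | h1 <;> rcases le_total b t with h2 | h2 <;>
    simp only [min_eq_left, min_eq_right, max_eq_left, max_eq_right, h1, h2] <;> nlinarith

lemma trunc_En (H : Hyp q l) (u : E2 → ℝ) (t : ℝ) (n : ℕ) :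
    En q l n (fun x => min (u x) t) (fun x => min (u x) t) +
      En q l n (fun x => max (u x) t) (fun x => max (u x) t) ≤ En q l n u u := by
  rw [En_eq H, En_eq H, En_eq H, ← mul_add]
  apply mul_le_mul_of_nonneg_left _ (inv_nonneg.2 (Rn_pos l n).le)
  rw [← Finset.sum_add_distrib]
  apply Finset.sum_le_sum
  intro w _
  simp only [e0]
  have h0 := trunc_pair (u (vp q l n w 0)) (u (vp q l n w 1)) t
  have h1 := trunc_pair (u (vp q l n w 1)) (u (vp q l n w 2)) t
  have h2 := trunc_pair (u (vp q l n w 2)) (u (vp q l n w 0)) t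
  linarith

lemma trunc_E (H : Hyp q l) {u : E2 → ℝ} (hu : u ∈ FDom q l) (t : ℝ) :
    (fun x => min (u x) t) ∈ FDom q l ∧ (fun x => max (u x) t) ∈ FDom q l ∧
    EForm q l (fun x => min (u x) t) (fun x => min (u x) t) +
      EForm q l (fun x => max (u x) t) (fun x => max (u x) t) ≤ EForm q l u u := by
  have m1 : (fun x => min (u x) t) ∈ FDom q l := ⟨EForm q l u u, fun n => by
    have := trunc_En H u t n
    have := En_nonneg H n (fun x => max (u x) t)
    have := En_le H hu n
    linarith⟩
  have m2 : (fun x => max (u x) t) ∈ FDom q l := ⟨EForm q l u u, fun n => by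
    have := trunc_En H u t n
    have := En_nonneg H n (fun x => min (u x) t)
    have := En_le H hu n
    linarith⟩
  exact ⟨m1, m2, le_of_tendsto_of_tendsto ((FDom_tendsto H m1).add (FDom_tendsto H m2))
    (FDom_tendsto H hu) (Eventually.of_forall fun n => trunc_En H u t n)⟩

lemma amgm_aux {A B p r E F : ℝ} (hA : 0 ≤ A) (hB : 0 ≤ B) (hp : 0 ≤ p) (hr : 0 ≤ r)
    (hE : 0 ≤ E) (hF : 0 ≤ F)
    (h1 : A ^ 2 ≤ p * E) (h2 : B ^ 2 ≤ r * F) : (A + B) ^ 2 ≤ (p + r) * (E + F) := by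
  have h3 : (2 * (A * B)) ^ 2 ≤ (p * F + r * E) ^ 2 := by
    have : A ^ 2 * B ^ 2 ≤ (p * E) * (r * F) :=
      mul_le_mul h1 h2 (sq_nonneg _) (by positivity)
    nlinarith [sq_nonneg (p * F - r * E)]
  have h4 : 2 * (A * B) ≤ p * F + r * E :=
    (sq_le_sq₀ (by positivity) (by positivity)).1 h3
  nlinarith

lemma RB_trans (H : Hyp q l) {ρ ρ' : ℝ} {x y z : E2} (h : RB q l ρ x y) (h' : RB q l ρ' y z) :
    RB q l (ρ + ρ') x z := by
  refine ⟨add_nonneg h.1 h'.1, fun u hu hc => ?_⟩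
  have hE := EForm_nonneg H hu
  have g1 := h.2 u hu hc
  have g2 := h'.2 u hu hc
  obtain ⟨m1, m2, hle⟩ := trunc_E H hu (u y)
  have c1 : ContinuousOn (fun x => min (u x) (u y)) (Gasket q l) :=
    (continuous_id.min continuous_const).comp_continuousOn hc
  have c2 : ContinuousOn (fun x => max (u x) (u y)) (Gasket q l) :=
    (continuous_id.max continuous_const).comp_continuousOn hc
  have e1 := EForm_nonneg H m1
  have e2 := EForm_nonneg H m2
  have p1 := mul_nonneg h.1 hE
  have p2 := mul_nonneg h'.1 hE
  rcases le_total (u x) (u y) with hx | hx <;> rcases le_total (u z) (u y) with hz | hz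
  · -- both below
    rcases le_total (u x) (u z) with hxz | hxz
    · nlinarith
    · nlinarith
  · have a1 := h.2 _ m1 c1
    have a2 := h'.2 _ m2 c2
    simp only [min_eq_left hx, min_self, max_eq_left hz, max_self] at a1 a2
    have := amgm_aux (sub_nonneg.2 hx) (sub_nonneg.2 hz) h.1 h'.1 e1 e2 (by nlinarith)
      (by nlinarith)
    nlinarith [mul_le_mul_of_nonneg_left hle (add_nonneg h.1 h'.1)]
  · have a1 := h.2 _ m2 c2
    have a2 := h'.2 _ m1 c1
    simp only [min_eq_left hz, min_self, max_eq_left hx, max_self] at a1 a2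
    have := amgm_aux (sub_nonneg.2 hx) (sub_nonneg.2 hz) h.1 h'.1 e2 e1 (by nlinarith)
      (by nlinarith)
    nlinarith [mul_le_mul_of_nonneg_left hle (add_nonneg h.1 h'.1)]
  · rcases le_total (u x) (u z) with hxz | hxz
    · nlinarith
    · nlinarith

lemma RB_closed {ρ : ℝ} {p x : E2} {y : ℕ → E2} (hy : ∀ m, y m ∈ Gasket q l)
    (hx : x ∈ Gasket q l) (ht : Tendsto y atTop (nhds x)) (h : ∀ m, RB q l ρ p (y m)) :
    RB q l ρ p x := by
  refine ⟨(h 0).1, fun u hu hc => ?_⟩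
  have t1 : Tendsto (fun m => u (y m)) atTop (nhds (u x)) :=
    (hc x hx).tendsto.comp (tendsto_nhdsWithin_iff.2 ⟨ht, Eventually.of_forall hy⟩)
  exact le_of_tendsto ((tendsto_const_nhds.sub t1).pow 2)
    (Eventually.of_forall fun m => (h m).2 u hu hc)

/-- upper bound for `REc`. -/
lemma REc_le {ρ : ℝ} {x y : E2} (h : RB q l ρ x y) : REc q l x y ≤ ρ := by
  apply Real.sSup_le _ h.1
  rintro t ⟨u, hu, hc, hp, rfl⟩
  rw [div_le_iff₀ hp]
  exact h.2 u hu hc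

lemma le_REc (H : Hyp q l) {ρ : ℝ} {x y : E2} (h : RB q l ρ x y) {u : E2 → ℝ} (hu : u ∈ FDom q l)
    (hc : ContinuousOn u (Gasket q l)) (h1 : (u x - u y) ^ 2 = 1) {C : ℝ}
    (hC : EForm q l u u ≤ C) : 1 / C ≤ REc q l x y := by
  have h2 := h.2 u hu hc
  rw [h1] at h2
  have hp : 0 < EForm q l u u := by
    rcases (EForm_nonneg H hu).lt_or_eq with h3 | h3
    · exact h3
    · rw [← h3] at h2; norm_num at h2
  have : 1 / EForm q l u u ≤ REc q l x y := by
    apply le_csSup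
    · refine ⟨ρ, ?_⟩
      rintro t ⟨v, hv, hvc, hvp, rfl⟩
      rw [div_le_iff₀ hvp]
      exact h.2 v hv hvc
    · exact ⟨u, hu, hc, hp, by rw [h1]⟩
  exact (one_div_le_one_div_of_le hp hC).trans this

end TG


namespace TG
variable {q : Fin 3 → E2} {l : ℕ → ℕ}

/-! ### harmonic extension -/

/-- vertex values of the piecewise harmonic extension of lattice data `g` -/
def hv (l : ℕ → ℕ) (n : ℕ) (g : (Fin 3 → ℕ) → ℝ) : ℕ → (ℕ → ℕ × ℕ) → Fin 3 → ℝ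
  | 0, w => fun j => g (vt l n w j)
  | k + 1, w => fun j => hL (l (n + k)) (hv l n g k w) (lv (l (n + k)) (w (n + k)) j)

variable {n : ℕ} {g : (Fin 3 → ℕ) → ℝ}

lemma hv_congr {k : ℕ} {w v : ℕ → ℕ × ℕ} (h : ∀ m, m < n + k → w m = v m) :
    hv l n g k w = hv l n g k v := by
  induction k with
  | zero => ext j; simp only [hv, vt]; rw [show bs l w n = bs l v n from bs_congr h]
  | succ k ih =>
    ext j
    simp only [hv]
    rw [ih (fun m hm => h m (by omega)), h (n + k) (by omega)]

lemma hL_cnr {L : ℕ} (h5 : 5 ≤ L) (a : Fin 3 → ℝ) (j : Fin 3) : hL L a (lv L (cnr L j) j) = a j := by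
  obtain ⟨c0, c1, c2⟩ := h3_corner L h5 a
  have e : ∀ t, lv L (cnr L j) j t = if t = j then L else 0 := by
    intro t
    simp only [lv, Pi.add_apply, co_cnr]
    by_cases h : t = j
    · subst h; simp; omega
    · simp [h]
  simp only [hL, e]
  fin_cases j
  · simpa using c0
  · simpa using c1
  · simpa using c2

lemma hv_cons (H : Hyp q l) {k : ℕ} {w v : ℕ → ℕ × ℕ} (hw : Val l (n + k) w)
    (hv' : Val l (n + k) v) {i j : Fin 3} (e : vt l (n + k) w i = vt l (n + k) v j) :
    hv l n g k w i = hv l n g k v j := by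
  induction k generalizing i j with
  | zero => simp only [hv]; exact congrArg g e
  | succ k ih =>
    have h5 := H.hl (n + k)
    replace hw : Val l (n + k + 1) w := hw
    replace hv' : Val l (n + k + 1) v := hv'
    replace e : vt l (n + k + 1) w i = vt l (n + k + 1) v j := e
    have hw0 : Val l (n + k) w := hw.mono (by omega)
    have hv0 : Val l (n + k) v := hv'.mono (by omega)
    by_cases hb : bs l w (n + k) = bs l v (n + k)
    · have ag := bs_inj H hw0 hv0 hb
      have e1 : lv (l (n + k)) (w (n + k)) i = lv (l (n + k)) (v (n + k)) j := by
        ext t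
        have := congrFun e t
        rw [vt_succ, vt_succ, hb] at this
        omega
      simp only [hv]
      rw [hv_congr (w := w) (v := v) ag, e1]
    · obtain ⟨a, b, hab, h⟩ := int_vertex H hw0 hv0 hb
        (inC_mono H hw (inC_vt q l (n + k + 1) w i))
        (inC_mono H hv' (by
          have := inC_vt q l (n + k + 1) v j
          rwa [show vt l (n + k + 1) v j = vt l (n + k + 1) w i from e.symm] at this))
      rw [← pt_cnr (n := n + k) H w a] at h
      have h2 := pt_inj H (vt_sum H hw i) (vt_sum H (hw0.upd (cnr_mem _ a)) a) h
      rw [vt_cnr H] at h2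
      have d1 : ∀ t, l (n + k) ∣ vt l (n + k + 1) w i t := by
        intro t; rw [h2]; exact Dvd.intro _ rfl
      obtain ⟨a1, b1⟩ := corner_of_dvd H hw d1
      obtain ⟨a2, b2⟩ := corner_of_dvd H hv' (j := j) (by
        intro t; have := d1 t; rwa [e] at this)
      have c2 : vt l (n + k) w i = vt l (n + k) v j := by
        ext t
        have := congrFun e t
        rw [b1, b2] at this
        exact Nat.eq_of_mul_eq_mul_left (by omega) this
      have := ih hw0 hv0 c2
      simp only [hv, a1, a2, hL_cnr h5]
      exact this

def mn (a : Fin 3 → ℝ) : ℝ := min (min (a 0) (a 1)) (a 2)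
def mx (a : Fin 3 → ℝ) : ℝ := max (max (a 0) (a 1)) (a 2)

lemma mn_le (a : Fin 3 → ℝ) (j : Fin 3) : mn a ≤ a j := by
  unfold mn; fin_cases j <;> simp

lemma le_mx (a : Fin 3 → ℝ) (j : Fin 3) : a j ≤ mx a := by
  unfold mx; fin_cases j <;> simp

lemma mx_le {a : Fin 3 → ℝ} {B : ℝ} (h : ∀ j, a j ≤ B) : mx a ≤ B := by
  simp [mx, h]

lemma le_mn {a : Fin 3 → ℝ} {B : ℝ} (h : ∀ j, B ≤ a j) : B ≤ mn a := by
  simp [mn, h]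

lemma osc_sq (a : Fin 3 → ℝ) {x y : ℝ} (h1 : mn a ≤ x) (h2 : x ≤ mx a) (h3 : mn a ≤ y)
    (h4 : y ≤ mx a) : (x - y) ^ 2 ≤ e0 a a := by
  have h5 : (x - y) ^ 2 ≤ (mx a - mn a) ^ 2 := by
    apply sq_le_sq'
    · linarith
    · linarith
  refine h5.trans ?_
  simp only [mx, mn, e0]
  rcases le_total (a 0) (a 1) with g1 | g1 <;> rcases le_total (a 1) (a 2) with g2 | g2 <;>
    rcases le_total (a 0) (a 2) with g3 | g3 <;>
    simp only [min_eq_left, min_eq_right, max_eq_left, max_eq_right, g1, g2, g3] <;>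
    nlinarith [sq_nonneg (a 0 - a 1), sq_nonneg (a 1 - a 2), sq_nonneg (a 2 - a 0)]

lemma rl_le (L : ℕ) (h : 5 ≤ L) : rl L ≤ 1 / 3 := by
  unfold rl
  rw [inv_le_comm₀ (by positivity) (by norm_num)]
  have : (5 : ℝ) ≤ L := by exact_mod_cast h
  norm_num
  linarith

lemma hv_succ_upd (k : ℕ) (w : ℕ → ℕ × ℕ) (i : ℕ × ℕ) :
    hv l n g (k + 1) (Function.update w (n + k) i) =
      fun j => hL (l (n + k)) (hv l n g k w) (lv (l (n + k)) i j) := by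
  ext j
  simp only [hv, Function.update_self]
  rw [hv_congr (w := Function.update w (n + k) i) (v := w)]
  intro m hm
  rw [Function.update_of_ne (by omega)]

lemma hv_sum (H : Hyp q l) (k : ℕ) :
    ∑ w ∈ WF l (n + k), e0 (hv l n g k w) (hv l n g k w) =
      Rn l (n + k) / Rn l n * ∑ w ∈ WF l n, e0 (hv l n g 0 w) (hv l n g 0 w) := by
  induction k with
  | zero => rw [add_zero, div_self (Rn_pos l n).ne', one_mul]
  | succ k ih =>
    rw [show n + (k + 1) = n + k + 1 from rfl, sum_WF_succ (n + k) H, Rn_succ]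
    have : ∀ w ∈ WF l (n + k), ∑ i ∈ SF (l (n + k)),
        e0 (hv l n g (k + 1) (Function.update w (n + k) i))
          (hv l n g (k + 1) (Function.update w (n + k) i)) =
        rl (l (n + k)) * e0 (hv l n g k w) (hv l n g k w) := by
      intro w _
      simp only [hv_succ_upd]
      exact harm_energy (H.hl (n + k)) _
    rw [Finset.sum_congr rfl this, ← Finset.mul_sum, ih]
    ring

lemma Rn_le (H : Hyp q l) (k : ℕ) : Rn l (n + k) ≤ Rn l n * (1 / 3) ^ k := by
  induction k with
  | zero => simp
  | succ k ih =>
    rw [show n + (k + 1) = n + k + 1 from rfl, Rn_succ, pow_succ, ← mul_assoc]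
    exact mul_le_mul ih (rl_le _ (H.hl _)) (rl_pos _).le
      (mul_nonneg (Rn_pos l n).le (by positivity))

/-- energy constant -/
def eC (l : ℕ → ℕ) (n : ℕ) (g : (Fin 3 → ℕ) → ℝ) : ℝ :=
  ∑ w ∈ WF l n, e0 (hv l n g 0 w) (hv l n g 0 w)

lemma eC_nonneg : 0 ≤ eC l n g := Finset.sum_nonneg fun _ _ => e0_nonneg _

lemma hv_small (H : Hyp q l) (k : ℕ) {w : ℕ → ℕ × ℕ} (hw : w ∈ Wn l (n + k)) :
    e0 (hv l n g k w) (hv l n g k w) ≤ (1 / 3) ^ k * eC l n g := by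
  have h1 := hv_sum (n := n) (g := g) H k
  have h2 : e0 (hv l n g k w) (hv l n g k w) ≤ _ :=
    Finset.single_le_sum (f := fun w => e0 (hv l n g k w) (hv l n g k w))
      (fun w _ => e0_nonneg _) ((mem_WF H).2 hw)
  refine h2.trans ?_
  rw [h1]
  apply mul_le_mul_of_nonneg_right _ eC_nonneg
  rw [div_le_iff₀ (Rn_pos l n), mul_comm]
  exact Rn_le H k

lemma nested (H : Hyp q l) {k : ℕ} {w : ℕ → ℕ × ℕ} (hw : Val l (n + k) w) {x : E2}
    (hx : x ∈ Gasket q l) (hc : inC q l (n + k) w x) {k' : ℕ} (hk : k ≤ k') :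
    ∃ v, Val l (n + k') v ∧ inC q l (n + k') v x ∧ mn (hv l n g k w) ≤ mn (hv l n g k' v) ∧
      mx (hv l n g k' v) ≤ mx (hv l n g k w) := by
  induction k', hk using Nat.le_induction with
  | base => exact ⟨w, hw, hc, le_rfl, le_rfl⟩
  | succ k' hk' ih =>
    obtain ⟨v, h1, h2, h3, h4⟩ := ih
    obtain ⟨i, hi, h5⟩ := child_exists H h1 hx h2
    refine ⟨Function.update v (n + k') i, h1.upd hi, h5, ?_, ?_⟩
    · rw [hv_succ_upd]
      apply le_mn
      intro j
      exact h3.trans (hL_bounds (H.hl _) hi j _ (mn_le _) (le_mx _)).1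
    · rw [hv_succ_upd]
      apply mx_le
      intro j
      exact (hL_bounds (H.hl _) hi j _ (mn_le _) (le_mx _)).2.trans h4

lemma cross_same (H : Hyp q l) {k : ℕ} {w v : ℕ → ℕ × ℕ} (hw : Val l (n + k) w)
    (hv' : Val l (n + k) v) {x : E2} (h1 : inC q l (n + k) w x) (h2 : inC q l (n + k) v x) :
    mn (hv l n g k w) ≤ mx (hv l n g k v) := by
  by_cases hb : bs l w (n + k) = bs l v (n + k)
  · rw [hv_congr (bs_inj H hw hv' hb)]
    exact (mn_le _ 0).trans (le_mx _ 0)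
  · obtain ⟨a, b, hab, -⟩ := int_vertex H hw hv' hb h1 h2
    have := hv_cons (g := g) H hw hv' hab
    exact (mn_le _ a).trans (this.le.trans (le_mx _ b))

lemma cross (H : Hyp q l) {k k' : ℕ} {w v : ℕ → ℕ × ℕ} (hw : Val l (n + k) w)
    (hv' : Val l (n + k') v) {x : E2} (hx : x ∈ Gasket q l) (h1 : inC q l (n + k) w x)
    (h2 : inC q l (n + k') v x) : mn (hv l n g k w) ≤ mx (hv l n g k' v) := by
  rcases le_total k k' with h | h
  · obtain ⟨w', a1, a2, a3, a4⟩ := nested (g := g) H hw hx h1 h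
    exact a3.trans (cross_same H a1 hv' a2 h2)
  · obtain ⟨w', a1, a2, a3, a4⟩ := nested (g := g) H hv' hx h2 h
    exact (cross_same H hw a1 h1 a2).trans a4

/-- the extension -/
def hu (q : Fin 3 → E2) (l : ℕ → ℕ) (n : ℕ) (g : (Fin 3 → ℕ) → ℝ) (x : E2) : ℝ :=
  sSup {t | ∃ k w, Val l (n + k) w ∧ inC q l (n + k) w x ∧ t = mn (hv l n g k w)}

lemma hu_bounds (H : Hyp q l) {k : ℕ} {w : ℕ → ℕ × ℕ} (hw : Val l (n + k) w) {x : E2}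
    (hx : x ∈ Gasket q l) (h1 : inC q l (n + k) w x) :
    mn (hv l n g k w) ≤ hu q l n g x ∧ hu q l n g x ≤ mx (hv l n g k w) := by
  constructor
  · apply le_csSup
    · refine ⟨mx (hv l n g k w), ?_⟩
      rintro t ⟨k', w', a1, a2, rfl⟩
      exact cross H a1 hw hx a2 h1
    · exact ⟨k, w, hw, h1, rfl⟩
  · unfold hu
    refine csSup_le (show Set.Nonempty _ from ⟨mn (hv l n g k w), k, w, hw, h1, rfl⟩) ?_
    rintro t ⟨k', w', a1, a2, rfl⟩
    exact cross H a1 hw hx a2 h1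

lemma hv_tr {k : ℕ} (w : ℕ → ℕ × ℕ) : hv l n g k (tr (n + k) w) = hv l n g k w :=
  hv_congr fun m hm => by simp [tr, hm]

lemma hv_small' (H : Hyp q l) (k : ℕ) {w : ℕ → ℕ × ℕ} (hw : Val l (n + k) w) :
    e0 (hv l n g k w) (hv l n g k w) ≤ (1 / 3) ^ k * eC l n g := by
  have := hv_small (g := g) H k (tr_mem hw)
  rwa [hv_tr] at this

lemma pow_small (C : ℝ) {ε : ℝ} (hε : 0 < ε) : ∃ k : ℕ, ∀ m, k ≤ m → (1 / 3 : ℝ) ^ m * C < ε := by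
  have : Tendsto (fun m : ℕ => (1 / 3 : ℝ) ^ m * C) atTop (nhds (0 * C)) :=
    (tendsto_pow_atTop_nhds_zero_of_lt_one (by norm_num) (by norm_num)).mul_const C
  rw [zero_mul] at this
  exact eventually_atTop.1 (this.eventually_lt_const hε)

lemma hu_vertex (H : Hyp q l) {k : ℕ} {w : ℕ → ℕ × ℕ} (hw : Val l (n + k) w) (j : Fin 3) :
    hu q l n g (vp q l (n + k) w j) = hv l n g k w j := by
  have hG := pt_G H hw j
  have up : ∀ m, k ≤ m → ∃ v, Val l (n + m) v ∧ vp q l (n + m) v j = vp q l (n + k) w j ∧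
      hv l n g m v j = hv l n g k w j := by
    intro m hm
    induction m, hm using Nat.le_induction with
    | base => exact ⟨w, hw, rfl, rfl⟩
    | succ m hm ih =>
      obtain ⟨v, h1, h2, h3⟩ := ih
      refine ⟨Function.update v (n + m) (cnr (l (n + m)) j), h1.upd (cnr_mem _ _), ?_, ?_⟩
      · rw [← h2]; exact pt_cnr H v j
      · rw [hv_succ_upd, ← h3]; exact hL_cnr (H.hl _) _ _
  by_contra hne
  have hpos : 0 < (hu q l n g (vp q l (n + k) w j) - hv l n g k w j) ^ 2 := by
    have := sub_ne_zero.2 hne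
    positivity
  obtain ⟨m, hm⟩ := pow_small (eC l n g) hpos
  obtain ⟨v, h1, h2, h3⟩ := up (max k m) (le_max_left _ _)
  have hin : inC q l (n + max k m) v (vp q l (n + k) w j) := by rw [← h2]; exact inC_vt _ _ _ _ _
  have b := hu_bounds (g := g) H h1 hG hin
  have := osc_sq _ b.1 b.2 (mn_le (hv l n g (max k m) v) j) (le_mx _ j)
  rw [h3] at this
  have h4 := hv_small' (g := g) H (max k m) h1
  have h5 := hm (max k m) (le_max_right _ _)
  unfold vp at h5
  linarith

lemma hu_cont (H : Hyp q l) : ContinuousOn (hu q l n g) (Gasket q l) := by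
  intro x hx
  rw [ContinuousWithinAt, Metric.tendsto_nhds]
  intro ε hε
  obtain ⟨k, hk⟩ := pow_small (eC l n g) (show 0 < ε ^ 2 by positivity)
  rw [eventually_nhdsWithin_iff]
  filter_upwards [soft H (n + k) x] with y hy hyG
  obtain ⟨w, hw, h1, h2⟩ := hy hyG
  have b1 := hu_bounds (g := g) H hw.1 hx h1
  have b2 := hu_bounds (g := g) H hw.1 hyG h2
  have := osc_sq _ b2.1 b2.2 b1.1 b1.2
  have h3 := hv_small (g := g) H k hw
  have h4 := hk k le_rfl
  rw [Real.dist_eq]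
  exact abs_lt_of_sq_lt_sq (by linarith) hε.le

lemma hu_En (H : Hyp q l) (k : ℕ) : En q l (n + k) (hu q l n g) (hu q l n g) =
    (Rn l n)⁻¹ * eC l n g := by
  rw [En_eq H]
  have : ∀ w ∈ WF l (n + k), e0 (fun j => hu q l n g (vp q l (n + k) w j))
      (fun j => hu q l n g (vp q l (n + k) w j)) = e0 (hv l n g k w) (hv l n g k w) := by
    intro w hw
    rw [mem_WF H] at hw
    simp only [hu_vertex H hw.1]
  rw [Finset.sum_congr rfl this, hv_sum H]
  have h1 := (Rn_pos l (n + k)).ne'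
  have h2 := (Rn_pos l n).ne'
  unfold eC
  field_simp

/-- Main extension lemma. -/
lemma ext_harm (H : Hyp q l) (n : ℕ) (g : (Fin 3 → ℕ) → ℝ) :
    ∃ u ∈ FDom q l, ContinuousOn u (Gasket q l) ∧
      EForm q l u u = (Rn l n)⁻¹ * ∑ w ∈ WF l n,
        e0 (fun j => g (vt l n w j)) (fun j => g (vt l n w j)) ∧
      ∀ w ∈ Wn l n, ∀ x ∈ Gasket q l, inC q l n w x → ∀ c, (∀ j, g (vt l n w j) = c) → u x = c := by
  have hF : hu q l n g ∈ FDom q l := by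
    refine ⟨(Rn l n)⁻¹ * eC l n g, fun m => ?_⟩
    rw [← hu_En H m]
    exact En_mono H _ (by omega)
  refine ⟨hu q l n g, hF, hu_cont H, ?_, ?_⟩
  · refine tendsto_nhds_unique (FDom_tendsto H hF) ?_
    refine tendsto_const_nhds.congr' ?_
    filter_upwards [eventually_ge_atTop n] with m hm
    obtain ⟨k, rfl⟩ := Nat.exists_eq_add_of_le hm
    rw [hu_En H k]
    rfl
  · intro w hw x hx hc c h
    have b := hu_bounds (g := g) (k := 0) H hw.1 hx hc
    apply le_antisymm
    · exact b.2.trans (mx_le fun j => (h j).le)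
    · exact (le_mn fun j => (h j).ge).trans b.1

end TG


namespace TG
variable {q : Fin 3 → E2} {l : ℕ → ℕ}

/-! ### paths in `K` -/

lemma abs_min_le (a b c : ℝ) : |min a c - min b c| ≤ |a - b| := by
  simpa using abs_min_sub_min_le_max a c b c

/-- there is a 1-Lipschitz path of length at most `a` in `K` from `x` to `y` -/
def LP (q : Fin 3 → E2) (l : ℕ → ℕ) (a : ℝ) (x y : E2) : Prop :=
  0 ≤ a ∧ ∃ γ : ℝ → E2, (∀ s t, dist (γ s) (γ t) ≤ |s - t|) ∧ (∀ t, γ t ∈ Gasket q l) ∧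
    γ 0 = x ∧ γ a = y

lemma LP_refl {x : E2} (hx : x ∈ Gasket q l) : LP q l 0 x x :=
  ⟨le_rfl, fun _ => x, fun s t => by simp, fun _ => hx, rfl, rfl⟩

lemma LP_symm {a : ℝ} {x y : E2} (h : LP q l a x y) : LP q l a y x := by
  obtain ⟨h0, γ, h1, h2, h3, h4⟩ := h
  refine ⟨h0, fun t => γ (a - t), fun s t => (h1 _ _).trans ?_, fun _ => h2 _, by simpa using h4,
    by simpa using h3⟩
  rw [abs_sub_comm s t]
  apply le_of_eq
  congr 1
  ring

lemma LP_mono {a b : ℝ} {x y : E2} (h : LP q l a x y) (hb : a ≤ b) : LP q l b x y := by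
  obtain ⟨h0, γ, h1, h2, h3, h4⟩ := h
  refine ⟨h0.trans hb, fun t => γ (min t a), fun s t => (h1 _ _).trans ?_, fun _ => h2 _, ?_, ?_⟩
  · exact abs_min_le _ _ _
  · simpa [h0] using h3
  · simpa [hb] using h4

lemma LP_trans {a b : ℝ} {x y z : E2} (h : LP q l a x y) (h' : LP q l b y z) :
    LP q l (a + b) x z := by
  obtain ⟨h0, γ, h1, h2, h3, h4⟩ := h
  obtain ⟨g0, δ, g1, g2, g3, g4⟩ := h'
  have key : ∀ s t : ℝ, s ≤ a → a ≤ t → dist (γ s) (δ (t - a)) ≤ t - s := by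
    intro s t hs ht
    have e1 := h1 s a
    have e2 := g1 0 (t - a)
    rw [h4] at e1
    rw [g3] at e2
    rw [abs_of_nonpos (by linarith)] at e1 e2
    have := dist_triangle (γ s) y (δ (t - a))
    linarith
  refine ⟨by linarith, fun t => if t ≤ a then γ t else δ (t - a), ?_, ?_, ?_, ?_⟩
  · intro s t
    dsimp only
    split_ifs with c1 c2 c2
    · exact h1 s t
    · refine (key s t c1 (by linarith)).trans ?_
      rw [abs_sub_comm]; exact le_abs_self _
    · rw [dist_comm]
      exact (key t s c2 (by linarith)).trans (le_abs_self _)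
    · refine (g1 _ _).trans (le_of_eq ?_)
      congr 1; ring
  · intro t
    dsimp only
    split_ifs
    · exact h2 _
    · exact g2 _
  · simp [h0, h3]
  · by_cases hb : a + b ≤ a
    · have : b = 0 := by linarith
      subst this
      simp only [add_zero, le_refl, if_true]
      rw [h4, ← g3, g4]
    · simp only [hb, if_false]
      rw [show a + b - a = b by ring, g4]

lemma LP_closed (H : Hyp q l) {a : ℝ} {p x : E2} {y : ℕ → E2} (hy : ∀ m, y m ∈ Gasket q l)
    (hx : x ∈ Gasket q l) (ht : Tendsto y atTop (nhds x)) (h : ∀ m, LP q l a p (y m)) :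
    LP q l a p x := by
  refine ⟨(h 0).1, ?_⟩
  choose γ h1 h2 h3 h4 using fun m => (h m).2
  have lim : ∀ t : ℝ, ∃ z ∈ Gasket q l,
      Tendsto (fun m => γ m t) (hyperfilter ℕ : Filter ℕ) (nhds z) := by
    intro t
    have := isCompact_iff_ultrafilter_le_nhds.1 (G_compact H)
      ((hyperfilter ℕ).map fun m => γ m t) (by
        rw [le_principal_iff, Ultrafilter.mem_coe, Ultrafilter.mem_map]
        exact Filter.univ_mem' fun m => h2 m t)
    obtain ⟨z, hz, hl⟩ := this
    exact ⟨z, hz, hl⟩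
  choose g hg1 hg2 using lim
  refine ⟨g, ?_, hg1, ?_, ?_⟩
  · intro s t
    exact le_of_tendsto ((hg2 s).dist (hg2 t)) (Eventually.of_forall fun m => h1 m s t)
  · refine tendsto_nhds_unique (hg2 0) ?_
    simp only [h3]
    exact tendsto_const_nhds
  · refine tendsto_nhds_unique (hg2 a) ?_
    simp only [h4]
    exact ht.mono_left Nat.hyperfilter_le_atTop

lemma LP_edge (H : Hyp q l) {n : ℕ} {w : ℕ → ℕ × ℕ} (hw : w ∈ Wn l n) (i j : Fin 3) :
    LP q l (1 / Ln l n) (vp q l n w i) (vp q l n w j) := by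
  have hL := Ln_posR H n
  by_cases hij : i = j
  · subst hij
    exact LP_mono (LP_refl (pt_G H hw.1 i)) (by positivity)
  let c : ℝ → ℝ := fun t => max (min (t * Ln l n) 1) 0
  have c0 : ∀ t, 0 ≤ c t := fun t => le_max_right _ _
  have c1 : ∀ t, c t ≤ 1 := fun t => max_le (min_le_right _ _) zero_le_one
  have cl : ∀ s t, |c s - c t| ≤ |s - t| * Ln l n := by
    intro s t
    refine (abs_max_sub_max_le_abs _ _ _).trans ((abs_min_le _ _ _).trans ?_)
    rw [← sub_mul, abs_mul, abs_of_pos hL]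
  let γ : ℝ → E2 := fun s => comb q (fun t => ((bs l w n t : ℝ) +
      if t = i then 1 - c s else if t = j then c s else 0) / Ln l n)
  refine ⟨by positivity, γ, ?_, ?_, ?_, ?_⟩
  · intro s t
    have e : γ s - γ t = ((c s - c t) / Ln l n) • (q j - q i) := by
      simp only [γ]
      rw [← comb_sub, ← comb_single q j, ← comb_single q i, ← comb_sub, ← comb_smul]
      congr 1
      ext m
      simp only [Pi.sub_apply, Pi.smul_apply, smul_eq_mul, Pi.single_apply]
      by_cases h1 : m = i
      · have h2 : ¬ (m = j) := fun h => hij (h1 ▸ h)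
        rw [if_pos h1, if_pos h1, if_neg h2, if_pos h1]
        ring
      · by_cases h2 : m = j
        · rw [if_neg h1, if_neg h1, if_pos h2, if_pos h2, if_pos h2, if_neg h1]
          ring
        · rw [if_neg h1, if_neg h1, if_neg h2, if_neg h2, if_neg h2, if_neg h1]
          ring
    rw [dist_eq_norm, e, norm_smul, ← dist_eq_norm, H.hq j i (Ne.symm hij), mul_one, Real.norm_eq_abs,
      abs_div, abs_of_pos hL, div_le_iff₀ hL]
    exact cl s t
  · intro t
    exact onS_G H hw.1 hij ⟨c t, c0 t, c1 t, rfl⟩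
  · simp only [γ, vp, pt]
    congr 1
    ext m
    simp [c, vt, Pi.single_apply]
  · simp only [γ, vp, pt]
    congr 1
    ext m
    have : c (1 / Ln l n) = 1 := by simp [c, hL.ne']
    rw [this]
    simp only [vt, Pi.add_apply, Pi.single_apply]
    by_cases h1 : m = i
    · have h2 : ¬ (m = j) := fun h => hij (h1 ▸ h)
      simp [h1, hij]
    · by_cases h2 : m = j <;> simp [h1, h2]
      simp [h2] at h1
      simp [h1]

lemma LP_pdist {a : ℝ} {x y : E2} (h : LP q l a x y) : pdist q l x y ≤ ENNReal.ofReal a := by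
  obtain ⟨h0, γ, h1, h2, h3, h4⟩ := h
  have hlip : LipschitzWith (Real.toNNReal a) (fun t : ℝ => γ (t * a)) := by
    apply LipschitzWith.of_dist_le_mul
    intro s t
    refine (h1 _ _).trans ?_
    rw [Real.coe_toNNReal a h0, ← sub_mul, abs_mul, abs_of_nonneg h0, Real.dist_eq, mul_comm]
  refine (iInf_le _ (fun t => γ (t * a))).trans ?_
  refine (iInf_le _ hlip.continuous.continuousOn).trans ?_
  refine (iInf_le _ (fun t _ => h2 _)).trans ?_
  refine (iInf_le _ (by simpa using h3)).trans ?_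
  refine (iInf_le _ (by simpa using h4)).trans ?_
  have := (hlip.lipschitzOnWith (s := univ)).comp_eVariationOn_le (g := fun t : ℝ => t) (s := Icc 0 1)
    (fun _ _ => mem_univ _)
  have h5 : eVariationOn (fun t : ℝ => t) (Icc 0 1) ≤ ENNReal.ofReal (1 - 0) :=  by
    have := (monotone_id (α := ℝ)).monotoneOn (Icc 0 1)
    have := this.eVariationOn_le (a := 0) (b := 1) (by simp) (by simp)
    rw [inter_self] at this
    exact this
  refine this.trans ((mul_le_mul_right h5 _).trans ?_)
  simp [ENNReal.ofReal]

lemma LP_gdist {a : ℝ} {x y : E2} (h : LP q l a x y) : pdist q l x y ≠ ⊤ ∧ gdist q l x y ≤ a := by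
  have := LP_pdist h
  refine ⟨ne_top_of_le_ne_top ENNReal.ofReal_ne_top this, ?_⟩
  exact ENNReal.toReal_le_of_le_ofReal h.1 this

/-! ### lower bounds for the path metric -/

lemma path_lower (H : Hyp q l) (n : ℕ) {φ : E2 → ℝ}
    (hφ : ∀ w ∈ Wn l n, ∀ x ∈ Gasket q l, ∀ y ∈ Gasket q l, inC q l n w x → inC q l n w y →
      |φ x - φ y| ≤ dist x y) {γ : ℝ → E2} (hc : ContinuousOn γ (Icc 0 1))
    (hm : MapsTo γ (Icc 0 1) (Gasket q l)) :
    edist (φ (γ 0)) (φ (γ 1)) ≤ eVariationOn γ (Icc 0 1) := by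
  have loc : ∀ t ∈ Icc (0:ℝ) 1, ∃ ε > 0, ∀ u ∈ Icc (0:ℝ) 1, |u - t| < ε →
      edist (φ (γ t)) (φ (γ u)) ≤ edist (γ t) (γ u) := by
    intro t ht
    have := (hc t ht).tendsto.eventually (soft H n (γ t))
    rw [eventually_nhdsWithin_iff, Metric.eventually_nhds_iff] at this
    obtain ⟨ε, hε, h⟩ := this
    refine ⟨ε, hε, fun u hu hut => ?_⟩
    obtain ⟨w, hw, h1, h2⟩ := h (by rwa [Real.dist_eq]) hu (hm hu)
    have := hφ w hw _ (hm ht) _ (hm hu) h1 h2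
    rw [edist_dist, edist_dist, Real.dist_eq]
    exact ENNReal.ofReal_le_ofReal this
  have step : ∀ s t u : ℝ, 0 ≤ s → s ≤ t → t ≤ u →
      edist (φ (γ 0)) (φ (γ s)) ≤ eVariationOn γ (Icc 0 s) →
      edist (φ (γ s)) (φ (γ t)) ≤ edist (γ s) (γ t) →
      edist (φ (γ 0)) (φ (γ t)) ≤ eVariationOn γ (Icc 0 t) := by
    intro s t u h0 hst htu h1 h2
    have h3 := eVariationOn.Icc_add_Icc γ (s := univ) h0 hst (mem_univ s)
    simp only [univ_inter] at h3
    have h4 : edist (γ s) (γ t) ≤ eVariationOn γ (Icc s t) :=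
      eVariationOn.edist_le γ ⟨le_rfl, hst⟩ ⟨hst, le_rfl⟩
    calc _ ≤ _ := edist_triangle _ (φ (γ s)) _
      _ ≤ _ := add_le_add h1 (h2.trans h4)
      _ = _ := h3
  let S : Set ℝ := {t | t ∈ Icc (0:ℝ) 1 ∧ edist (φ (γ 0)) (φ (γ t)) ≤ eVariationOn γ (Icc 0 t)}
  have h0S : (0:ℝ) ∈ S := ⟨⟨le_rfl, zero_le_one⟩, by simp⟩
  have hbd : BddAbove S := ⟨1, fun t ht => ht.1.2⟩
  have hT : sSup S ∈ Icc (0:ℝ) 1 := ⟨le_csSup hbd h0S, csSup_le ⟨0, h0S⟩ fun t ht => ht.1.2⟩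
  obtain ⟨ε, hε, hl⟩ := loc _ hT
  have hTS : sSup S ∈ S := by
    obtain ⟨t, htS, ht⟩ := exists_lt_of_lt_csSup ⟨0, h0S⟩ (show sSup S - ε < sSup S by linarith)
    have htT := le_csSup hbd htS
    refine ⟨hT, step t _ 1 htS.1.1 htT hT.2 htS.2 ?_⟩
    have := hl t htS.1 (by rw [abs_lt]; constructor <;> linarith)
    rwa [edist_comm, edist_comm (γ t)]
  have h1 : sSup S = 1 := by
    by_contra hne
    have hlt : sSup S < 1 := lt_of_le_of_ne hT.2 hne
    let u := min 1 (sSup S + ε / 2)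
    have hu1 : u ≤ 1 := min_le_left _ _
    have hu2 : sSup S < u := lt_min hlt (by linarith)
    have hu3 : u ≤ sSup S + ε / 2 := min_le_right _ _
    have huI : u ∈ Icc (0:ℝ) 1 := ⟨hT.1.trans hu2.le, hu1⟩
    have : u ∈ S := ⟨huI, step _ u 1 hT.1 hu2.le hu1 hTS.2
      (hl u huI (by rw [abs_lt]; constructor <;> linarith))⟩
    have := le_csSup hbd this
    linarith
  rw [h1] at hTS
  exact hTS.2

lemma gdist_lower (H : Hyp q l) (n : ℕ) {φ : E2 → ℝ}
    (hφ : ∀ w ∈ Wn l n, ∀ x ∈ Gasket q l, ∀ y ∈ Gasket q l, inC q l n w x → inC q l n w y →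
      |φ x - φ y| ≤ dist x y) {x y : E2} (hfin : pdist q l x y ≠ ⊤) :
    |φ x - φ y| ≤ gdist q l x y := by
  have : edist (φ x) (φ y) ≤ pdist q l x y := by
    refine le_iInf fun γ => le_iInf fun h1 => le_iInf fun h2 => le_iInf fun h3 => le_iInf fun h4 => ?_
    rw [← h3, ← h4]
    exact path_lower H n hφ h1 h2
  have h2 := ENNReal.toReal_mono hfin this
  rwa [edist_dist, ENNReal.toReal_ofReal dist_nonneg, Real.dist_eq] at h2

lemma dist_le_gdist (H : Hyp q l) {x y : E2} (hfin : pdist q l x y ≠ ⊤) :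
    dist x y ≤ gdist q l x y := by
  have := gdist_lower H 0 (φ := fun z => dist z y) (fun w _ a _ b _ _ _ => abs_dist_sub_le a b y) hfin
  simpa using this

end TG


namespace TG
variable {q : Fin 3 → E2} {l : ℕ → ℕ}

/-! ### graph walks on level `n` vertices -/

inductive Reach (l : ℕ → ℕ) (n : ℕ) : ℕ → (Fin 3 → ℕ) → (Fin 3 → ℕ) → Prop
  | refl (P : Fin 3 → ℕ) : Reach l n 0 P P
  | step {t : ℕ} {P X Y : Fin 3 → ℕ} {w : ℕ → ℕ × ℕ} {i j : Fin 3} (hw : w ∈ Wn l n)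
      (hX : X = vt l n w i) (hY : Y = vt l n w j) (h : Reach l n t P X) : Reach l n (t + 1) P Y

lemma Reach.trans {n t s : ℕ} {P X Y : Fin 3 → ℕ} (h : Reach l n t P X) (h' : Reach l n s X Y) :
    Reach l n (t + s) P Y := by
  induction h' with
  | refl => exact h
  | step hw hX hY _ ih => exact Reach.step hw hX hY (ih h)

lemma Reach.one {n : ℕ} {w : ℕ → ℕ × ℕ} (hw : w ∈ Wn l n) (i j : Fin 3) :
    Reach l n 1 (vt l n w i) (vt l n w j) := Reach.step hw rfl rfl (Reach.refl _)

lemma Reach.symm {n t : ℕ} {P X : Fin 3 → ℕ} (h : Reach l n t P X) : Reach l n t X P := by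
  induction h with
  | refl => exact Reach.refl _
  | @step t P X Y w i j hw hX hY _ ih =>
    subst hX hY
    have := (Reach.one hw j i).trans ih
    rwa [add_comm] at this

/-- capped graph distance from the vertices of `w` -/
def Gcap (l : ℕ → ℕ) (n : ℕ) (w : ℕ → ℕ × ℕ) (g : ℕ) (b : Fin 3 → ℕ) : ℕ :=
  sInf ({t | ∃ i, Reach l n t (vt l n w i) b} ∪ {g})

lemma Gcap_le {n : ℕ} {w : ℕ → ℕ × ℕ} {g : ℕ} (b : Fin 3 → ℕ) : Gcap l n w g b ≤ g :=
  Nat.sInf_le (Or.inr rfl)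

lemma Gcap_le' {n : ℕ} {w : ℕ → ℕ × ℕ} {g t : ℕ} {b : Fin 3 → ℕ} {i : Fin 3}
    (h : Reach l n t (vt l n w i) b) : Gcap l n w g b ≤ t :=
  Nat.sInf_le (Or.inl ⟨i, h⟩)

lemma Gcap_or {n : ℕ} {w : ℕ → ℕ × ℕ} {g : ℕ} (b : Fin 3 → ℕ) :
    (∃ i, Reach l n (Gcap l n w g b) (vt l n w i) b) ∨ Gcap l n w g b = g :=
  Nat.sInf_mem (s := {t | ∃ i, Reach l n t (vt l n w i) b} ∪ {g}) ⟨g, Or.inr rfl⟩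

lemma Gcap_self {n : ℕ} {w : ℕ → ℕ × ℕ} {g : ℕ} (i : Fin 3) : Gcap l n w g (vt l n w i) = 0 :=
  Nat.le_zero.1 (Gcap_le' (Reach.refl (vt l n w i)))

lemma Gcap_step {n : ℕ} {w v : ℕ → ℕ × ℕ} {g : ℕ} (hv : v ∈ Wn l n) (i j : Fin 3) :
    Gcap l n w g (vt l n v j) ≤ Gcap l n w g (vt l n v i) + 1 := by
  rcases Gcap_or (l := l) (n := n) (w := w) (g := g) (vt l n v i) with ⟨a, h⟩ | h
  · exact Gcap_le' (Reach.step hv rfl rfl h)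
  · rw [h]; exact (Gcap_le _).trans (Nat.le_succ g)

/-! ### McShane gluing -/

lemma vp_dist (H : Hyp q l) {n : ℕ} (w : ℕ → ℕ × ℕ) {i j : Fin 3} (hij : i ≠ j) :
    dist (vp q l n w i) (vp q l n w j) = 1 / Ln l n := by
  have hL := Ln_posR H n
  have e : vp q l n w i - vp q l n w j = (1 / (Ln l n : ℝ)) • (q i - q j) := by
    simp only [vp, pt]
    rw [← comb_sub, ← comb_single q j, ← comb_single q i, ← comb_sub, ← comb_smul]
    congr 1
    ext m
    simp only [vt, Pi.sub_apply, Pi.smul_apply, smul_eq_mul, Pi.single_apply, Pi.add_apply]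
    push_cast
    split_ifs <;> ring
  rw [dist_eq_norm, e, norm_smul, ← dist_eq_norm, H.hq i j hij, mul_one, Real.norm_eq_abs,
    abs_of_pos (by positivity)]

lemma mn_lip {a b : Fin 3 → ℝ} {D : ℝ} (h : ∀ j, |a j - b j| ≤ D) : |mn a - mn b| ≤ D := by
  unfold mn
  refine (abs_min_sub_min_le_max _ _ _ _).trans (max_le ?_ (h 2))
  exact (abs_min_sub_min_le_max _ _ _ _).trans (max_le (h 0) (h 1))

def mcs (q : Fin 3 → E2) (l : ℕ → ℕ) (n : ℕ) (G : (Fin 3 → ℕ) → ℝ) (w : ℕ → ℕ × ℕ) (z : E2) : ℝ :=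
  min (mn fun j => G (vt l n w j) + dist z (vp q l n w j)) (mx fun j => G (vt l n w j))

lemma mcs_lip (n : ℕ) (G : (Fin 3 → ℕ) → ℝ) (w : ℕ → ℕ × ℕ) (x y : E2) :
    |mcs q l n G w x - mcs q l n G w y| ≤ dist x y := by
  refine (abs_min_le _ _ _).trans (mn_lip fun j => ?_)
  rw [add_sub_add_left_eq_sub]
  exact abs_dist_sub_le x y _

lemma mcs_vertex (H : Hyp q l) (n : ℕ) {G : (Fin 3 → ℕ) → ℝ} {w : ℕ → ℕ × ℕ}
    (hG : ∀ i j, |G (vt l n w i) - G (vt l n w j)| ≤ 1 / Ln l n) (i : Fin 3) :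
    mcs q l n G w (vp q l n w i) = G (vt l n w i) := by
  unfold mcs
  have h1 : (mn fun j => G (vt l n w j) + dist (vp q l n w i) (vp q l n w j)) = G (vt l n w i) := by
    apply le_antisymm
    · have := mn_le (fun j => G (vt l n w j) + dist (vp q l n w i) (vp q l n w j)) i
      simpa using this
    · apply le_mn
      intro j
      by_cases h : i = j
      · subst h; simp
      · rw [vp_dist H w h]
        have := (abs_le.1 (hG i j)).2
        linarith
  rw [h1]
  exact min_eq_left (le_mx (fun j => G (vt l n w j)) i)

lemma mcs_bounds (n : ℕ) (G : (Fin 3 → ℕ) → ℝ) (w : ℕ → ℕ × ℕ) (z : E2) :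
    (mn fun j => G (vt l n w j)) ≤ mcs q l n G w z ∧
      mcs q l n G w z ≤ mx fun j => G (vt l n w j) := by
  refine ⟨le_min (le_mn fun j => ?_) ?_, min_le_right _ _⟩
  · have := mn_le (fun j => G (vt l n w j)) j
    have := dist_nonneg (x := z) (y := vp q l n w j)
    linarith
  · exact (mn_le _ 0).trans (le_mx (fun j => G (vt l n w j)) 0)

lemma mcshane (H : Hyp q l) (n : ℕ) {G : (Fin 3 → ℕ) → ℝ}
    (hG : ∀ w ∈ Wn l n, ∀ i j, |G (vt l n w i) - G (vt l n w j)| ≤ 1 / Ln l n) :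
    ∃ φ : E2 → ℝ, (∀ w ∈ Wn l n, ∀ x ∈ Gasket q l, ∀ y ∈ Gasket q l, inC q l n w x → inC q l n w y →
      |φ x - φ y| ≤ dist x y) ∧ ∀ w ∈ Wn l n, ∀ x ∈ Gasket q l, inC q l n w x →
      (mn fun j => G (vt l n w j)) ≤ φ x ∧ φ x ≤ mx fun j => G (vt l n w j) := by
  classical
  have cons : ∀ w ∈ Wn l n, ∀ v ∈ Wn l n, ∀ x, inC q l n w x → inC q l n v x →
      mcs q l n G w x = mcs q l n G v x := by
    intro w hw v hv x h1 h2
    by_cases hb : bs l w n = bs l v n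
    · rw [Wn_ext hw hv (bs_inj H hw.1 hv.1 hb)]
    · obtain ⟨i, j, hij, hx⟩ := int_vertex H hw.1 hv.1 hb h1 h2
      have e1 := mcs_vertex H n (hG w hw) i
      have e2 := mcs_vertex H n (hG v hv) j
      rw [show vp q l n w i = x from hx.symm] at e1
      rw [show vp q l n v j = x by rw [hx, hij]; rfl] at e2
      rw [e1, e2, hij]
  let φ : E2 → ℝ := fun z => if h : ∃ w, w ∈ Wn l n ∧ inC q l n w z then mcs q l n G h.choose z else 0
  have eq : ∀ w ∈ Wn l n, ∀ x, inC q l n w x → φ x = mcs q l n G w x := by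
    intro w hw x hx
    have h : ∃ w, w ∈ Wn l n ∧ inC q l n w x := ⟨w, hw, hx⟩
    simp only [φ, dif_pos h]
    exact cons _ h.choose_spec.1 _ hw _ h.choose_spec.2 hx
  refine ⟨φ, ?_, ?_⟩
  · intro w hw x _ y _ h1 h2
    rw [eq w hw x h1, eq w hw y h2]
    exact mcs_lip _ _ _ _ _
  · intro w hw x _ h1
    rw [eq w hw x h1]
    exact mcs_bounds _ _ _ _

/-- points at small path distance lie in cells at small graph distance -/
lemma reach_of_gdist (H : Hyp q l) {n k : ℕ} {x y : E2} (hx : x ∈ Gasket q l) (hy : y ∈ Gasket q l)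
    {w v : ℕ → ℕ × ℕ} (hw : w ∈ Wn l n) (hv : v ∈ Wn l n) (hxw : inC q l n w x)
    (hyv : inC q l n v y) (hfin : pdist q l x y ≠ ⊤) (hd : gdist q l x y < k / Ln l n) :
    ∃ t, t < k ∧ ∃ i j, Reach l n t (vt l n w i) (vt l n v j) := by
  have hL := Ln_posR H n
  by_contra hcon
  push Not at hcon
  have hk : ∀ j, Gcap l n w k (vt l n v j) = k := by
    intro j
    rcases Gcap_or (l := l) (n := n) (w := w) (g := k) (vt l n v j) with ⟨a, h⟩ | h
    · by_contra hne
      exact hcon _ (lt_of_le_of_ne (Gcap_le _) hne) a j h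
    · exact h
  obtain ⟨φ, h1, h2⟩ := mcshane (G := fun b => (Gcap l n w k b : ℝ) / Ln l n) H n (by
    intro u hu i j
    rw [← sub_div, abs_div, abs_of_pos hL, div_le_div_iff_of_pos_right hL, abs_le]
    have a1 : ((Gcap l n w k (vt l n u j) : ℕ) : ℝ) ≤ Gcap l n w k (vt l n u i) + 1 := by
      exact_mod_cast Gcap_step hu i j
    have a2 : ((Gcap l n w k (vt l n u i) : ℕ) : ℝ) ≤ Gcap l n w k (vt l n u j) + 1 := by
      exact_mod_cast Gcap_step hu j i
    constructor <;> linarith)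
  have b1 := (h2 w hw x hx hxw).2
  have b2 := (h2 v hv y hy hyv).1
  have c1 := mx_le (a := fun j => (Gcap l n w k (vt l n w j) : ℝ) / Ln l n) (B := 0)
    (fun j => by simp [Gcap_self])
  have c2 := le_mn (a := fun j => (Gcap l n w k (vt l n v j) : ℝ) / Ln l n) (B := k / Ln l n)
    (fun j => by simp [hk])
  have := gdist_lower H n h1 hfin
  have := neg_le_abs (φ x - φ y)
  linarith

/-! ### chains along sides -/

lemma side_step (H : Hyp q l) {n : ℕ} (v : ℕ → ℕ × ℕ) {j k : Fin 3} (hjk : j ≠ k) {s : ℕ}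
    (hs : s + 1 ≤ l n - 1) :
    vt l (n + 1) (Function.update v n (side (l n) j k s)) k =
      vt l (n + 1) (Function.update v n (side (l n) j k (s + 1))) j := by
  ext t
  rw [vt_upd_succ, vt_upd_succ]
  congr 1
  simp only [lv, co_side hjk (show s ≤ l n - 1 by omega), co_side hjk hs, sco, Pi.add_apply,
    Pi.single_apply]
  by_cases h1 : t = j
  · have h2 : ¬ t = k := fun h => hjk (h1 ▸ h)
    simp only [h1, if_true, hjk, if_false]
    omega
  · by_cases h2 : t = k
    · simp only [h1, h2, if_true, if_false]
      have : ¬ k = j := Ne.symm hjk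
      simp [this]
    · simp [h1, h2]

lemma side_reach (H : Hyp q l) {n : ℕ} {v : ℕ → ℕ × ℕ} (hv : v ∈ Wn l n) {j k : Fin 3} (hjk : j ≠ k)
    {s : ℕ} (d : ℕ) (hs : s + d ≤ l n - 1) :
    Reach l (n + 1) d (vt l (n + 1) (Function.update v n (side (l n) j k s)) j)
      (vt l (n + 1) (Function.update v n (side (l n) j k (s + d))) j) := by
  induction d with
  | zero => exact Reach.refl _
  | succ d ih =>
    refine Reach.step (j := k) (upd_mem H hv (side_mem hjk (s := s + d) (by omega))) rfl ?_ (ih (by omega))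
    exact (side_step H v hjk (by omega)).symm

lemma side_zero {L : ℕ} {j k : Fin 3} (hjk : j ≠ k) : side L j k 0 = cnr L j := by
  apply co_ext (L := L)
  ext t
  rw [co_side hjk (Nat.zero_le _), co_cnr]
  simp [sco]

lemma side_rev {L : ℕ} {j k : Fin 3} (hjk : j ≠ k) {s : ℕ} (hs : s ≤ L - 1) :
    side L j k s = side L k j (L - 1 - s) := by
  apply co_ext (L := L)
  ext t
  rw [co_side hjk hs, co_side (Ne.symm hjk) (by omega)]
  simp only [sco]
  by_cases h1 : t = j
  · have h2 : ¬ t = k := fun h => hjk (h1 ▸ h)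
    simp [h1, hjk]
  · simp only [h1, if_false]
    split_ifs <;> omega

lemma third (j k : Fin 3) (h : j ≠ k) : ∃ m, j ≠ m ∧ k ≠ m := by
  revert h; revert j k; decide

/-- every letter lies on a side through any given... two given options -/
lemma letter_side {L : ℕ} {i : ℕ × ℕ} (h : i ∈ Sset L) :
    ∃ j k s, j ≠ k ∧ s ≤ L - 1 ∧ i = side L j k s := by
  obtain ⟨m, hm⟩ := co_zero h
  have h1 : ∃ j k : Fin 3, j ≠ k ∧ j ≠ m ∧ k ≠ m := by clear hm; revert m; decide
  obtain ⟨j, k, a, b, c⟩ := h1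
  obtain ⟨e1, _, e2⟩ := eq_side h a b c hm
  exact ⟨j, k, _, a, e1, e2⟩

/-- every letter is within half a side of some corner -/
lemma letter_half {L : ℕ} {i : ℕ × ℕ} (h : i ∈ Sset L) :
    ∃ j k s, j ≠ k ∧ s ≤ L - 1 ∧ 2 * s ≤ L - 1 ∧ i = side L j k s := by
  obtain ⟨j, k, s, h1, h2, h3⟩ := letter_side h
  by_cases hs : 2 * s ≤ L - 1
  · exact ⟨j, k, s, h1, h2, hs, h3⟩
  · exact ⟨k, j, L - 1 - s, Ne.symm h1, by omega, by omega, by rw [h3, side_rev h1 h2]⟩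

lemma child_near (H : Hyp q l) {n : ℕ} {v : ℕ → ℕ × ℕ} (hv : v ∈ Wn l n) {i : ℕ × ℕ}
    (hi : i ∈ Sset (l n)) : ∃ c t j, 2 * t ≤ l n - 1 ∧
      Reach l (n + 1) t (vt l (n + 1) (Function.update v n (cnr (l n) c)) c)
        (vt l (n + 1) (Function.update v n i) j) := by
  obtain ⟨j, k, s, h1, h2, h3, rfl⟩ := letter_half hi
  refine ⟨j, s, j, h3, ?_⟩
  have := side_reach H hv h1 (s := 0) s (by omega)
  rwa [zero_add, side_zero h1] at this

lemma child_reach (H : Hyp q l) {n : ℕ} {v : ℕ → ℕ × ℕ} (hv : v ∈ Wn l n) {i : ℕ × ℕ}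
    (hi : i ∈ Sset (l n)) (c : Fin 3) : ∃ t j, 2 * t ≤ 3 * (l n - 1) ∧
      Reach l (n + 1) t (vt l (n + 1) (Function.update v n (cnr (l n) c)) c)
        (vt l (n + 1) (Function.update v n i) j) := by
  have h5 := H.hl n
  obtain ⟨j, k, s, h1, h2, h3, rfl⟩ := letter_half hi
  have base : ∀ k', c ≠ k' → ∀ s', s' ≤ l n - 1 →
      Reach l (n + 1) s' (vt l (n + 1) (Function.update v n (cnr (l n) c)) c)
        (vt l (n + 1) (Function.update v n (side (l n) c k' s')) c) := by
    intro k' hk s' hs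
    have := side_reach H hv hk (s := 0) s' (by omega)
    rwa [zero_add, side_zero hk] at this
  by_cases hc : c = j
  · subst hc
    exact ⟨s, c, by omega, base k h1 s h2⟩
  by_cases hc2 : c = k
  · subst hc2
    refine ⟨l n - 1 - s, c, by omega, ?_⟩
    rw [side_rev h1 h2]
    exact base j hc _ (by omega)
  -- opposite side
  have e := base j hc (l n - 1) le_rfl
  rw [side_rev hc le_rfl, Nat.sub_self, side_zero (Ne.symm hc)] at e
  rcases Nat.eq_zero_or_pos s with rfl | hs
  · refine ⟨l n - 1, c, by omega, ?_⟩
    rw [side_zero h1]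
    exact e
  · refine ⟨l n - 1 + s, j, by omega, ?_⟩
    have e2 := Reach.step (upd_mem H hv (cnr_mem (l n) j)) rfl (j := k) rfl e
    rw [← side_zero h1, side_step H v h1 (by omega)] at e2
    have e3 := side_reach H hv h1 (s := 0 + 1) (s - 1) (by omega)
    have e4 := e2.trans e3
    rwa [show l n - 1 + 1 + (s - 1) = l n - 1 + s by omega, show 0 + 1 + (s - 1) = s by omega] at e4

/-! ### abstract chain bounds -/

structure QH (q : Fin 3 → E2) (l : ℕ → ℕ) (Q : ℝ → E2 → E2 → Prop) (e D : ℕ → ℝ) : Prop where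
  refl : ∀ x ∈ Gasket q l, Q 0 x x
  symm : ∀ a x y, Q a x y → Q a y x
  trans : ∀ a b x y z, Q a x y → Q b y z → Q (a + b) x z
  mono : ∀ a b x y, Q a x y → a ≤ b → Q b x y
  edge : ∀ n, ∀ w ∈ Wn l n, ∀ i j, Q (e n) (vp q l n w i) (vp q l n w j)
  closed : ∀ a p x, ∀ y : ℕ → E2, (∀ m, y m ∈ Gasket q l) → x ∈ Gasket q l →
    Tendsto y atTop (nhds x) → (∀ m, Q a p (y m)) → Q a p x
  e0 : ∀ n, 0 ≤ e n
  D0 : ∀ n, 0 ≤ D n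
  De : ∀ n, 3 / 2 * ((l n : ℝ) - 1) * e (n + 1) + D (n + 1) ≤ D n

variable {Q : ℝ → E2 → E2 → Prop} {e D : ℕ → ℝ}

lemma QH.reach (h : QH q l Q e D) {n t : ℕ} {P X : Fin 3 → ℕ} (hr : Reach l n t P X)
    (hP : pt q (Ln l n) P ∈ Gasket q l) : Q (t * e n) (pt q (Ln l n) P) (pt q (Ln l n) X) := by
  induction hr with
  | refl => simpa using h.refl _ hP
  | @step t P X Y w i j hw hX hY _ ih =>
    subst hX hY
    have := h.trans _ _ _ _ _ (ih hP) (h.edge n w hw i j)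
    refine h.mono _ _ _ _ this ?_
    push_cast
    linarith

lemma inC_dist (H : Hyp q l) {n : ℕ} {w : ℕ → ℕ × ℕ} {x y : E2} (hx : inC q l n w x)
    (hy : inC q l n w y) : dist x y ≤ 2 / Ln l n := by
  have hL := Ln_posR H n
  obtain ⟨c, c0, c1, rfl⟩ := hx
  obtain ⟨d, d0, d1, rfl⟩ := hy
  rw [Fin.sum_univ_three] at c1 d1
  have e1 : comb q (fun t => ((bs l w n t : ℝ) + c t) / Ln l n) -
      comb q (fun t => ((bs l w n t : ℝ) + d t) / Ln l n) = (1 / (Ln l n : ℝ)) • comb q (c - d) := by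
    rw [← comb_sub, ← comb_smul]
    congr 1
    ext t
    simp only [Pi.sub_apply, Pi.smul_apply, smul_eq_mul]
    ring
  have h2 := normsq_comb H (c - d) (by rw [Fin.sum_univ_three]; simp only [Pi.sub_apply]; linarith)
  have h3 : ‖comb q (c - d)‖ ≤ 2 := by
    apply le_of_sq_le_sq _ (by norm_num)
    rw [h2]
    simp only [Pi.sub_apply]
    have := c0 0; have := c0 1; have := c0 2; have := d0 0; have := d0 1; have := d0 2
    nlinarith [mul_nonneg (c0 1) (d0 1), mul_nonneg (c0 2) (d0 2), mul_nonneg (c0 1) (d0 2),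
      mul_nonneg (c0 2) (d0 1), mul_nonneg (c0 1) (c0 2), mul_nonneg (d0 1) (d0 2)]
  rw [dist_eq_norm, e1, norm_smul, Real.norm_eq_abs, abs_of_pos (by positivity), one_div,
    inv_mul_le_iff₀ hL]
  rw [mul_div_cancel₀ _ hL.ne']
  exact h3

lemma QH.corner (h : QH q l Q e D) (H : Hyp q l) {n : ℕ} {v : ℕ → ℕ × ℕ} (hv : v ∈ Wn l n)
    (c : Fin 3) {x : E2} (hx : x ∈ Gasket q l) (hxv : inC q l n v x) : Q (D n) (vp q l n v c) x := by
  have claim : ∀ m, ∃ w ∈ Wn l (n + m), inC q l (n + m) w x ∧ ∃ j,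
      Q (D n - D (n + m)) (vp q l n v c) (vp q l (n + m) w j) := by
    intro m
    induction m with
    | zero =>
      refine ⟨v, hv, hxv, c, ?_⟩
      simpa using h.refl (vp q l n v c) (pt_G H hv.1 c)
    | succ m ih =>
      obtain ⟨w, hw, hxw, j, hQ⟩ := ih
      obtain ⟨i, hi, hxi⟩ := child_exists H hw.1 hx hxw
      obtain ⟨t, j', ht, hr⟩ := child_reach H hw hi j
      refine ⟨Function.update w (n + m) i, upd_mem H hw hi, hxi, j', ?_⟩
      have h1 := h.reach hr (pt_G H (Val.upd hw.1 (cnr_mem _ _)) j)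
      rw [pt_cnr H w j] at h1
      refine h.mono _ _ _ _ (h.trans _ _ _ _ _ hQ h1) ?_
      have h2 := h.De (n + m)
      have h3 : (t : ℝ) ≤ 3 / 2 * ((l (n + m) : ℝ) - 1) := by
        have h5 := H.hl (n + m)
        have : 2 * t + 3 ≤ 3 * l (n + m) := by omega
        have : (2 * t + 3 : ℝ) ≤ 3 * l (n + m) := by exact_mod_cast this
        linarith
      have h4 := mul_le_mul_of_nonneg_right h3 (h.e0 (n + m + 1))
      change _ ≤ D n - D (n + m + 1)
      linarith
  choose w hw hxw j hQ using claim
  refine h.closed _ _ _ (fun m => vp q l (n + m) (w m) (j m)) (fun m => pt_G H (hw m).1 _) hx ?_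
    (fun m => h.mono _ _ _ _ (hQ m) (by linarith [h.D0 (n + m)]))
  rw [tendsto_iff_dist_tendsto_zero]
  have h0 : Tendsto (fun m : ℕ => 2 * (1 / 5 : ℝ) ^ m) atTop (nhds (2 * 0)) :=
    (tendsto_pow_atTop_nhds_zero_of_lt_one (by norm_num) (by norm_num)).const_mul 2
  rw [mul_zero] at h0
  refine squeeze_zero (fun _ => dist_nonneg) (fun m => ?_) h0
  refine (inC_dist H (inC_vt q l (n + m) (w m) (j m)) (hxw m)).trans ?_
  have h1 : 5 ^ m ≤ Ln l (n + m) := (Nat.pow_le_pow_right (by norm_num) (by omega)).trans (Ln_ge H _)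
  have h2 : (5 : ℝ) ^ m ≤ Ln l (n + m) := by exact_mod_cast h1
  rw [div_eq_mul_inv, one_div, inv_pow]
  exact mul_le_mul_of_nonneg_left (inv_anti₀ (by positivity) h2) (by norm_num)

lemma QH.cells (h : QH q l Q e D) (H : Hyp q l) {n t : ℕ} {w v : ℕ → ℕ × ℕ} (hw : w ∈ Wn l n)
    (hv : v ∈ Wn l n) {i j : Fin 3} (hr : Reach l n t (vt l n w i) (vt l n v j)) {x y : E2}
    (hx : x ∈ Gasket q l) (hy : y ∈ Gasket q l) (hxw : inC q l n w x) (hyv : inC q l n v y) :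
    Q (D n + t * e n + D n) x y :=
  h.trans _ _ _ _ _ (h.trans _ _ _ _ _ (h.symm _ _ _ (h.corner H hw i hx hxw))
    (h.reach hr (pt_G H hw.1 i))) (h.corner H hv j hy hyv)

lemma QH_LP (H : Hyp q l) : QH q l (LP q l) (fun n => 1 / Ln l n) (fun n => 3 / 2 / Ln l n) where
  refl x hx := LP_refl hx
  symm a x y h := LP_symm h
  trans a b x y z h h' := LP_trans h h'
  mono a b x y h h' := LP_mono h h'
  edge n w hw i j := LP_edge H hw i j
  closed a p x y h1 h2 h3 h4 := LP_closed H h1 h2 h3 h4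
  e0 n := by have := Ln_posR H n; positivity
  D0 n := by have := Ln_posR H n; positivity
  De n := by
    have hL := Ln_posR H n
    have h5 := H.hl n
    have hl : (0 : ℝ) < l n := by positivity
    rw [Ln_succ]
    push_cast
    apply le_of_eq
    field_simp
    ring

lemma QH_RB (H : Hyp q l) : QH q l (RB q l) (fun n => 2 / 3 * Rn l n) (fun n => 19 / 10 * Rn l n) where
  refl x hx := RB_refl H x
  symm a x y h := RB_symm h
  trans a b x y z h h' := RB_trans H h h'
  mono a b x y h h' := RB_mono H h h'
  edge n w hw i j := RB_edge H hw i j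
  closed a p x y h1 h2 h3 h4 := RB_closed h1 h2 h3 h4
  e0 n := by have := Rn_pos l n; positivity
  D0 n := by have := Rn_pos l n; positivity
  De n := by
    have hR := Rn_pos l n
    have h5 : (5 : ℝ) ≤ l n := by exact_mod_cast H.hl n
    have hr := rl_pos (l n)
    have h1 : (2 * (l n : ℝ) / 3 + 1 / 9) * rl (l n) = 1 := by
      unfold rl; exact mul_inv_cancel₀ (by positivity)
    rw [Rn_succ]
    have : ((l n : ℝ) - 1 + 19 / 10) * rl (l n) ≤ 19 / 10 := by nlinarith
    have := mul_le_mul_of_nonneg_left this hR.le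
    linarith

/-- everything has finite path distance -/
lemma pdist_fin (H : Hyp q l) {x y : E2} (hx : x ∈ Gasket q l) (hy : y ∈ Gasket q l) :
    pdist q l x y ≠ ⊤ := by
  obtain ⟨w, hw, hxw⟩ := (mem_G H).1 hx 0
  obtain ⟨v, hv, hyv⟩ := (mem_G H).1 hy 0
  exact (LP_gdist ((QH_LP H).cells H hw hv (i := 0) (j := 0) (Reach.refl _) hx hy hxw hyv)).1

lemma gdist_cells (H : Hyp q l) {n t : ℕ} {w v : ℕ → ℕ × ℕ} (hw : w ∈ Wn l n)
    (hv : v ∈ Wn l n) {i j : Fin 3} (hr : Reach l n t (vt l n w i) (vt l n v j)) {x y : E2}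
    (hx : x ∈ Gasket q l) (hy : y ∈ Gasket q l) (hxw : inC q l n w x) (hyv : inC q l n v y) :
    gdist q l x y ≤ (t + 3) / Ln l n := by
  refine (LP_gdist ((QH_LP H).cells H hw hv hr hx hy hxw hyv)).2.trans (le_of_eq ?_)
  ring

lemma RB_cells (H : Hyp q l) {n t : ℕ} {w v : ℕ → ℕ × ℕ} (hw : w ∈ Wn l n)
    (hv : v ∈ Wn l n) {i j : Fin 3} (hr : Reach l n t (vt l n w i) (vt l n v j)) {x y : E2}
    (hx : x ∈ Gasket q l) (hy : y ∈ Gasket q l) (hxw : inC q l n w x) (hyv : inC q l n v y) :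
    RB q l ((2 / 3 * t + 38 / 10) * Rn l n) x y := by
  refine RB_mono H ((QH_RB H).cells H hw hv hr hx hy hxw hyv) (le_of_eq ?_)
  ring

lemma vt_zero (w v : ℕ → ℕ × ℕ) (j : Fin 3) : vt l 0 w j = vt l 0 v j := rfl

lemma gdist_lt_three (H : Hyp q l) {x y : E2} (hx : x ∈ Gasket q l) (hy : y ∈ Gasket q l) :
    gdist q l x y < 3 := by
  obtain ⟨w, hw, hxw⟩ := (mem_G H).1 hx 0
  obtain ⟨v, hv, hyv⟩ := (mem_G H).1 hy 0
  obtain ⟨i, hi, hxi⟩ := child_exists H hw.1 hx hxw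
  obtain ⟨c, t, j, ht, hr⟩ := child_near H hw hi
  have Q1 := (QH_LP H).reach hr (pt_G H (Val.upd hw.1 (cnr_mem _ _)) c)
  rw [pt_cnr H w c] at Q1
  have Q2 := LP_trans Q1 ((QH_LP H).corner H (upd_mem H hw hi) j hx hxi)
  have Q3 := (QH_LP H).corner H hv c hy hyv
  have Q4 := LP_trans (LP_symm Q2) Q3
  refine (LP_gdist Q4).2.trans_lt ?_
  have h5 := H.hl 0
  have h6 : (2 * t + 1 : ℝ) ≤ l 0 := by exact_mod_cast (show 2 * t + 1 ≤ l 0 by omega)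
  have h7 : (5 : ℝ) ≤ l 0 := by exact_mod_cast h5
  have e1 : Ln l (0 + 1) = l 0 := by simp [Ln]
  simp only [e1, Ln_zero]
  have : (t : ℝ) * (1 / l 0) + 3 / 2 / l 0 ≤ 1 := by
    rw [mul_one_div, ← add_div, div_le_one (by linarith)]
    linarith
  norm_num at this ⊢
  linarith

lemma REc_lt_four (H : Hyp q l) {x y : E2} (hx : x ∈ Gasket q l) (hy : y ∈ Gasket q l) :
    REc q l x y < 4 ∧ RB q l 4 x y := by
  obtain ⟨w, hw, hxw⟩ := (mem_G H).1 hx 0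
  obtain ⟨v, hv, hyv⟩ := (mem_G H).1 hy 0
  have h := RB_cells H hw hv (i := 0) (j := 0) (Reach.refl _) hx hy hxw hyv
  have e : Rn l 0 = 1 := by simp [Rn]
  rw [e] at h
  constructor
  · refine (REc_le h).trans_lt ?_
    norm_num
  · exact RB_mono H h (by norm_num)

end TG


namespace TG
variable {q : Fin 3 → E2} {l : ℕ → ℕ}

/-! ### counting nearby cells -/

lemma lv_cnr {L : ℕ} (h5 : 5 ≤ L) (j t : Fin 3) : lv L (cnr L j) j t = if t = j then L else 0 := by
  simp only [lv, Pi.add_apply, co_cnr]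
  by_cases h : t = j
  · subst h; simp; omega
  · simp [h]

lemma corner_share (H : Hyp q l) {n : ℕ} {w v : ℕ → ℕ × ℕ} (hw : Val l (n + 1) w)
    (hv' : Val l (n + 1) v) {i j : Fin 3} (e : vt l (n + 1) w i = vt l (n + 1) v j)
    (hb : bs l w n ≠ bs l v n) :
    w n = cnr (l n) i ∧ v n = cnr (l n) j ∧ vt l n w i = vt l n v j := by
  have h5 := H.hl n
  have hw0 : Val l n w := hw.mono (by omega)
  have hv0 : Val l n v := hv'.mono (by omega)
  obtain ⟨a, b, hab, h⟩ := int_vertex H hw0 hv0 hb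
    (inC_mono H hw (inC_vt q l (n + 1) w i))
    (inC_mono H hv' (by
      have := inC_vt q l (n + 1) v j
      rwa [e.symm] at this))
  rw [← pt_cnr (n := n) H w a] at h
  have h2 := pt_inj H (vt_sum H hw i) (vt_sum H (hw0.upd (cnr_mem _ a)) a) h
  rw [vt_cnr H] at h2
  have d1 : ∀ t, l n ∣ vt l (n + 1) w i t := by
    intro t; rw [h2]; exact Dvd.intro _ rfl
  obtain ⟨a1, b1⟩ := corner_of_dvd H hw d1
  obtain ⟨a2, b2⟩ := corner_of_dvd H hv' (j := j) (by
    intro t; have := d1 t; rwa [e] at this)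
  refine ⟨a1, a2, ?_⟩
  ext t
  have := congrFun e t
  rw [b1, b2] at this
  exact Nat.eq_of_mul_eq_mul_left (by omega) this

lemma lv_step (L : ℕ) (i : ℕ × ℕ) (a b m : Fin 3) : lv L i a m ≤ lv L i b m + 1 := by
  simp only [lv, Pi.add_apply, Pi.single_apply]
  split_ifs <;> omega

lemma lv_pair {L : ℕ} (h5 : 5 ≤ L) {i : ℕ × ℕ} (h : i ∈ Sset L) (a : Fin 3) {j m : Fin 3} (hjm : m ≠ j) :
    lv L i a m + lv L i a j ≤ L := by
  have := lv_sum h5 h a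
  fin_cases j <;> fin_cases m <;> simp at hjm ⊢ <;> omega

lemma vt_bs_inj {n : ℕ} {w v : ℕ → ℕ × ℕ} {i j : Fin 3} (e : vt l n w i = vt l n v j)
    (hb : bs l w n = bs l v n) : i = j := by
  have := congrFun e i
  simp only [vt, hb, Pi.add_apply, Pi.single_apply] at this
  by_contra h
  simp [h] at this

lemma lv_of_bs {n : ℕ} {w v : ℕ → ℕ × ℕ} {i j : Fin 3} (e : vt l (n + 1) w i = vt l (n + 1) v j)
    (hb : bs l w n = bs l v n) (t : Fin 3) : lv (l n) (w n) i t = lv (l n) (v n) j t := by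
  have := congrFun e t
  rw [vt_succ, vt_succ, hb] at this
  omega

lemma walk_inv (H : Hyp q l) {N t : ℕ} {P X : Fin 3 → ℕ} (hr : Reach l (N + 1) t P X)
    {w : ℕ → ℕ × ℕ} (hw : w ∈ Wn l (N + 1)) {a : Fin 3} (hP : P = vt l (N + 1) w a) (ht : t < l N) :
    ∀ z ∈ Wn l (N + 1), ∀ b, X = vt l (N + 1) z b →
      (bs l z N = bs l w N → ∀ m, lv (l N) (z N) b m ≤ lv (l N) (w N) a m + t ∧
        lv (l N) (w N) a m ≤ lv (l N) (z N) b m + t) ∧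
      (bs l z N ≠ bs l w N → ∃ j j', vt l N w j = vt l N z j' ∧
        2 * l N ≤ lv (l N) (w N) a j + lv (l N) (z N) b j' + t) := by
  have h5 := H.hl N
  induction hr with
  | refl P =>
    intro z hz b hX
    have e := hP.symm.trans hX
    constructor
    · intro hb m
      rw [lv_of_bs e hb.symm m]
      omega
    · intro hb
      obtain ⟨c1, c2, c3⟩ := corner_share H hw.1 hz.1 e (Ne.symm hb)
      refine ⟨a, b, c3, ?_⟩
      rw [c1, c2, lv_cnr h5, lv_cnr h5]
      simp
      omega
  | @step t P X Y v i j hv hX hY _ ih =>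
    intro z hz b hY'
    obtain ⟨A, B⟩ := ih hP (by omega) v hv i hX
    have e : vt l (N + 1) v j = vt l (N + 1) z b := hY.symm.trans hY'
    have A' : bs l v N = bs l w N → ∀ m, lv (l N) (v N) j m ≤ lv (l N) (w N) a m + (t + 1) ∧
        lv (l N) (w N) a m ≤ lv (l N) (v N) j m + (t + 1) := by
      intro hb m
      have h1 := A hb m
      have h2 := lv_step (l N) (v N) i j m
      have h3 := lv_step (l N) (v N) j i m
      omega
    have B' : bs l v N ≠ bs l w N → ∃ c c', vt l N w c = vt l N v c' ∧
        2 * l N ≤ lv (l N) (w N) a c + lv (l N) (v N) j c' + (t + 1) := by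
      intro hb
      obtain ⟨c, c', h1, h2⟩ := B hb
      refine ⟨c, c', h1, ?_⟩
      have h2 := lv_step (l N) (v N) i j c'
      omega
    by_cases hvz : bs l v N = bs l z N
    · constructor
      · intro hb m
        rw [← lv_of_bs e hvz m]
        exact A' (hvz.trans hb) m
      · intro hb
        obtain ⟨c, c', h1, h2⟩ := B' (by rw [hvz]; exact hb)
        refine ⟨c, c', ?_, ?_⟩
        · rw [h1]; simp only [vt, hvz]
        · rw [← lv_of_bs e hvz c']; exact h2
    · obtain ⟨c1, c2, c3⟩ := corner_share H hv.1 hz.1 e hvz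
      by_cases hvw : bs l v N = bs l w N
      · constructor
        · intro hb; exact absurd (hvw.trans hb.symm) hvz
        · intro _
          refine ⟨j, b, ?_, ?_⟩
          · rw [← c3]; simp only [vt, hvw]
          · have := (A' hvw j).1
            rw [c1, lv_cnr h5] at this
            rw [c2, lv_cnr h5]
            simp at this ⊢
            omega
      · obtain ⟨c, c', h1, h2⟩ := B' hvw
        rw [c1, lv_cnr h5] at h2
        have hlw : lv (l N) (w N) a c ≤ l N := by
          have := lv_sum h5 (hw.1 N (by omega)) a
          fin_cases c <;> simp <;> omega
        by_cases hc : c' = j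
        · subst hc
          simp at h2
          have hzw : bs l z N = bs l w N := by
            rcases two_cells H (Val.mono hv.1 (by omega)) (Val.mono hw.1 (by omega))
              (Val.mono hz.1 (by omega)) h1.symm c3 with g | g | g
            · exact absurd g hvw
            · exact absurd g hvz
            · exact g.symm
          refine ⟨fun _ m => ?_, fun g => absurd hzw g⟩
          have hcb : c = b := vt_bs_inj (h1.trans c3) hzw.symm
          subst hcb
          rw [c2, lv_cnr h5]
          by_cases hm : m = c
          · subst hm
            simp
            omega
          · have := lv_pair h5 (hw.1 N (by omega)) a hm
            simp [hm]
            omega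
        · simp [hc] at h2
          omega

lemma upd_tr {N : ℕ} {w : ℕ → ℕ × ℕ} (hw : w ∈ Wn l (N + 1)) :
    Function.update (tr N w) N (w N) = w := by
  ext1 k
  by_cases h : k = N
  · subst h; simp
  · rw [Function.update_of_ne h]
    by_cases h2 : k < N
    · simp [tr, h2]
    · simp only [tr, h2, if_false]
      rw [hw.2 k (by omega)]

lemma tr_eq (H : Hyp q l) {N : ℕ} {w v : ℕ → ℕ × ℕ} (hw : Val l N w) (hv : Val l N v)
    (hb : bs l w N = bs l v N) : tr N w = tr N v := by
  have := bs_inj H hw hv hb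
  ext1 k
  by_cases h : k < N
  · simp [tr, h, this k h]
  · simp [tr, h]

open Classical in
lemma neighbor_count (H : Hyp q l) {N : ℕ} {w : ℕ → ℕ × ℕ} (hw : w ∈ Wn l N) (c : Fin 3) (d : ℕ)
    (hd1 : d + 1 ≤ l N - 1) :
    ∃ F : Finset (ℕ → ℕ × ℕ), F.card ≤ 2 * d + 1 ∧ (N = 0 → F.card = 0) ∧
      ∀ v ∈ Wn l (N + 1), ∀ c', bs l v N ≠ bs l w N → vt l N w c = vt l N v c' →
        l N - 1 - co (l N) (v N) c' ≤ d → v ∈ F := by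
  have h5 := H.hl N
  by_cases hex : ∃ z ∈ Wn l (N + 1), ∃ c', bs l z N ≠ bs l w N ∧ vt l N w c = vt l N z c'
  · obtain ⟨z, hz, c', hzb, hzv⟩ := hex
    have hc3 : ∃ o m : Fin 3, c' ≠ o ∧ c' ≠ m ∧ o ≠ m := by clear hzv; revert c'; decide
    obtain ⟨o, m, ho, hm, hom⟩ := hc3
    refine ⟨(Finset.range (d + 1)).image (fun r => Function.update (tr N z) N (side (l N) c' o r)) ∪
      (Finset.range d).image (fun r => Function.update (tr N z) N (side (l N) c' m (r + 1))), ?_, ?_, ?_⟩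
    · refine (Finset.card_union_le _ _).trans ?_
      have h1 := Finset.card_image_le (s := Finset.range (d + 1))
        (f := fun r => Function.update (tr N z) N (side (l N) c' o r))
      have h2 := Finset.card_image_le (s := Finset.range d)
        (f := fun r => Function.update (tr N z) N (side (l N) c' m (r + 1)))
      rw [Finset.card_range] at h1 h2
      omega
    · rintro rfl; exact absurd rfl hzb
    · intro v hv c'' hvb hvv hd
      have hvz : bs l v N = bs l z N := by
        rcases two_cells H hw.1 (Val.mono hv.1 (by omega)) (Val.mono hz.1 (by omega)) hvv hzv with g | g | g
        · exact absurd g.symm hvb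
        · exact absurd g.symm hzb
        · exact g
      have : c'' = c' := vt_bs_inj (hvv.symm.trans hzv) hvz
      subst this
      have ev : v = Function.update (tr N z) N (v N) := by
        rw [← tr_eq H (Val.mono hv.1 (by omega)) (Val.mono hz.1 (by omega)) hvz, upd_tr hv]
      have hi := hv.1 N (by omega)
      rw [Finset.mem_union, Finset.mem_image, Finset.mem_image]
      obtain ⟨t, htz⟩ := co_zero hi
      have key : co (l N) (v N) o = 0 ∨ co (l N) (v N) m = 0 ∨ co (l N) (v N) c'' = 0 := by
        have : t = o ∨ t = m ∨ t = c'' := by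
          clear hvv hzv hd htz; revert t o m c''; decide
        rcases this with h | h | h <;> rw [h] at htz <;> tauto
      have s1 : co (l N) (v N) m = 0 → co (l N) (v N) o ≤ d → ∃ a ∈ Finset.range (d + 1),
          Function.update (tr N z) N (side (l N) c'' o a) = v := by
        intro hmz hle
        obtain ⟨_, _, e2⟩ := eq_side hi ho hm hom hmz
        exact ⟨co (l N) (v N) o, Finset.mem_range.2 (by omega), by rw [← e2]; exact ev.symm⟩
      have s2 : co (l N) (v N) o = 0 → 1 ≤ co (l N) (v N) m → co (l N) (v N) m ≤ d →
          ∃ a ∈ Finset.range d, Function.update (tr N z) N (side (l N) c'' m (a + 1)) = v := by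
        intro hmz hle1 hle
        obtain ⟨_, _, e2⟩ := eq_side hi hm ho (Ne.symm hom) hmz
        refine ⟨co (l N) (v N) m - 1, Finset.mem_range.2 (by omega), ?_⟩
        rw [Nat.sub_add_cancel hle1, ← e2]; exact ev.symm
      by_cases hmz : co (l N) (v N) m = 0
      · obtain ⟨_, e1, _⟩ := eq_side hi ho hm hom hmz
        exact Or.inl (s1 hmz (by omega))
      · rcases key with h | h | h
        · obtain ⟨_, e1, _⟩ := eq_side hi hm ho (Ne.symm hom) h
          exact Or.inr (s2 h (by omega) (by omega))
        · exact absurd h hmz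
        · omega
  · refine ⟨∅, by simp, by simp, ?_⟩
    intro v hv c' h1 h2 _
    exact absurd ⟨v, hv, c', h1, h2⟩ hex


open Classical in
lemma corner_count (H : Hyp q l) {N : ℕ} {w : ℕ → ℕ × ℕ} (hw : w ∈ Wn l N) {c o m : Fin 3}
    {s g : ℕ} (hg : 1 ≤ g) (hgl : g ≤ l N - 1) :
    ∃ F : Finset (ℕ → ℕ × ℕ), F.card ≤ 3 * g - 1 ∧ (N = 0 → F.card ≤ 2 * g) ∧
      (∀ s', s' < s → s ≤ s' + g → Function.update w N (side (l N) c o s') ∈ F) ∧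
      (s ≤ g → ∀ r, 1 ≤ r → r ≤ g → Function.update w N (side (l N) c m r) ∈ F) ∧
      (∀ v ∈ Wn l (N + 1), ∀ c', bs l v N ≠ bs l w N → vt l N w c = vt l N v c' →
        s + (l N - 1 - co (l N) (v N) c') ≤ g - 1 → v ∈ F) := by
  have h5 := H.hl N
  have c1 := Finset.card_image_le (s := Finset.Ico (s - g) s)
        (f := fun r => Function.update w N (side (l N) c o r))
  rw [Nat.card_Ico] at c1
  have c2 := Finset.card_image_le (s := Finset.Icc 1 g)
        (f := fun r => Function.update w N (side (l N) c m r))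
  rw [Nat.card_Icc] at c2
  have i1 : ∀ s', s' < s → s ≤ s' + g → Function.update w N (side (l N) c o s') ∈
      (Finset.Ico (s - g) s).image (fun r => Function.update w N (side (l N) c o r)) := by
    intro s' h1 h2
    exact Finset.mem_image.2 ⟨s', Finset.mem_Ico.2 (by omega), rfl⟩
  have i2 : ∀ r, 1 ≤ r → r ≤ g → Function.update w N (side (l N) c m r) ∈
      (Finset.Icc 1 g).image (fun r => Function.update w N (side (l N) c m r)) := by
    intro s' h1 h2
    exact Finset.mem_image.2 ⟨s', Finset.mem_Icc.2 (by omega), rfl⟩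
  generalize (Finset.Ico (s - g) s).image (fun r => Function.update w N (side (l N) c o r)) = F1 at c1 i1
  generalize (Finset.Icc 1 g).image (fun r => Function.update w N (side (l N) c m r)) = F2 at c2 i2
  by_cases hs : s < g
  · obtain ⟨F3, d1, d2, d3⟩ := neighbor_count H hw c (g - 1 - s) (by omega)
    have := Finset.card_union_le (F1 ∪ F2) F3
    have := Finset.card_union_le F1 F2
    refine ⟨F1 ∪ F2 ∪ F3, by omega, fun h => ?_, ?_, ?_, ?_⟩
    · have := d2 h; omega
    · intro s' a b
      exact Finset.mem_union_left _ (Finset.mem_union_left _ (i1 s' a b))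
    · intro _ r a b
      exact Finset.mem_union_left _ (Finset.mem_union_right _ (i2 r a b))
    · intro v hv c' a b e
      exact Finset.mem_union_right _ (d3 v hv c' a b (by omega))
  · by_cases hs2 : s ≤ g
    · have := Finset.card_union_le F1 F2
      refine ⟨F1 ∪ F2, by omega, fun h => by omega, ?_, ?_, ?_⟩
      · intro s' a b
        exact Finset.mem_union_left _ (i1 s' a b)
      · intro _ r a b
        exact Finset.mem_union_right _ (i2 r a b)
      · intro v hv c' a b e
        omega
    · refine ⟨F1, by omega, fun h => by omega, i1, fun h => absurd h hs2, ?_⟩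
      intro v hv c' a b e
      omega

open Classical in
lemma near_count (H : Hyp q l) {N : ℕ} {w : ℕ → ℕ × ℕ} (hw : w ∈ Wn l (N + 1))
    {g : ℕ} (hg : 1 ≤ g) (hgl : g ≤ l N - 1) :
    ∃ F : Finset (ℕ → ℕ × ℕ), F.card ≤ 6 * g - 2 ∧ (N = 0 → F.card ≤ 4 * g) ∧
      ∀ v ∈ Wn l (N + 1), v ≠ w → ∀ t < g, ∀ a b, Reach l (N + 1) t (vt l (N + 1) w a)
        (vt l (N + 1) v b) → v ∈ F := by
  have h5 := H.hl N
  have hi := hw.1 N (by omega)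
  have hw0 : Val l N w := Val.mono hw.1 (by omega)
  obtain ⟨m, hm0⟩ := co_zero hi
  obtain ⟨c, o, hco, hcm, hom⟩ : ∃ c o : Fin 3, c ≠ o ∧ c ≠ m ∧ o ≠ m := by
    clear hm0; revert m; decide
  obtain ⟨hs, hsum, e⟩ := eq_side hi hco hcm hom hm0
  obtain ⟨Fc, a1, a2, a3, a4, a5⟩ := corner_count H (tr_mem hw0) (c := c) (o := o) (m := m)
    (s := co (l N) (w N) o) hg hgl
  obtain ⟨Fo, b1, b2, b3, b4, b5⟩ := corner_count H (tr_mem hw0) (c := o) (o := c) (m := m)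
    (s := co (l N) (w N) c) hg hgl
  have := Finset.card_union_le Fc Fo
  refine ⟨Fc ∪ Fo, by omega, fun h => ?_, ?_⟩
  · have := a2 h; have := b2 h; omega
  intro v hv hne t ht a b hr
  obtain ⟨A, B⟩ := walk_inv H hr hw rfl (by omega) v hv b rfl
  have hj := hv.1 N (by omega)
  have lb : ∀ (i : ℕ × ℕ) (a m : Fin 3), co (l N) i m ≤ lv (l N) i a m ∧ lv (l N) i a m ≤ co (l N) i m + 1 := by
    intro i a m
    simp only [lv, Pi.add_apply, Pi.single_apply]
    split_ifs <;> omega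
  by_cases hb : bs l v N = bs l w N
  · have D : ∀ p, co (l N) (v N) p ≤ co (l N) (w N) p + g ∧ co (l N) (w N) p ≤ co (l N) (v N) p + g := by
      intro p
      have h1 := lb (v N) b p
      have h2 := lb (w N) a p
      have h3 := A hb p
      omega
    have ev : v = Function.update (tr N w) N (v N) := by
      rw [← tr_eq H (Val.mono hv.1 (by omega)) hw0 hb, upd_tr hv]
    have ew : w = Function.update (tr N w) N (w N) := by rw [upd_tr hw]
    have K1 : co (l N) (v N) m = 0 → v ∈ Fc ∪ Fo := by
      intro hz
      obtain ⟨g1, g2, g3⟩ := eq_side hj hco hcm hom hz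
      obtain ⟨f1, f2, f3⟩ := eq_side hj (Ne.symm hco) hom hcm hz
      have := D c
      have := D o
      rcases lt_trichotomy (co (l N) (v N) o) (co (l N) (w N) o) with h | h | h
      · apply Finset.mem_union_left
        rw [ev, g3]
        exact a3 _ h (by omega)
      · exfalso
        apply hne
        have hvw : v N = w N := g3.trans (by rw [h]; exact e.symm)
        exact ev.trans (by rw [hvw]; exact ew.symm)
      · apply Finset.mem_union_right
        rw [ev, f3]
        exact b3 _ (by omega) (by omega)
    by_cases hz : co (l N) (v N) m = 0
    · exact K1 hz
    obtain ⟨p, hp⟩ := co_zero hj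
    have key : p = o ∨ p = m ∨ p = c := by
      clear * - hco hcm hom; revert p o m c; decide
    have := D c
    have := D o
    have := D m
    rcases key with h | h | h
    · rw [h] at hp
      obtain ⟨g1, g2, g3⟩ := eq_side hj hcm hco (Ne.symm hom) hp
      apply Finset.mem_union_left
      rw [ev, g3]
      exact a4 (by omega) _ (by omega) (by omega)
    · rw [h] at hp; exact absurd hp hz
    · rw [h] at hp
      obtain ⟨g1, g2, g3⟩ := eq_side hj hom (Ne.symm hco) (Ne.symm hcm) hp
      apply Finset.mem_union_right
      rw [ev, g3]
      exact b4 (by omega) _ (by omega) (by omega)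
  · obtain ⟨j, j', h1, h2⟩ := B hb
    have h3 := lb (w N) a j
    have h4 := lb (v N) b j'
    have h6 := co_lt h5 hj j'
    have key : j = o ∨ j = m ∨ j = c := by
      clear * - hco hcm hom; revert j o m c; decide
    rw [← bs_tr le_rfl w] at hb
    rw [← vt_tr le_rfl w] at h1
    rcases key with h | h | h
    · subst h
      exact Finset.mem_union_right _ (b5 v hv j' hb h1 (by omega))
    · subst h
      omega
    · subst h
      exact Finset.mem_union_left _ (a5 v hv j' hb h1 (by omega))

end TG


namespace TG
variable {q : Fin 3 → E2} {l : ℕ → ℕ}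

/-! ### lower resistance bounds -/

lemma e0_nat {a : Fin 3 → ℕ} (h : ∀ i j, a j ≤ a i + 1) {g : ℝ} (hg : 0 < g) :
    e0 (fun j => (a j : ℝ) / g) (fun j => (a j : ℝ) / g) ≤ 2 / g ^ 2 := by
  have key : ((a 0 : ℤ) - a 1) ^ 2 + ((a 1 : ℤ) - a 2) ^ 2 + ((a 2 : ℤ) - a 0) ^ 2 ≤ 2 := by
    have h01 := h 0 1
    have h10 := h 1 0
    have h12 := h 1 2
    have h21 := h 2 1
    have h02 := h 0 2
    have h20 := h 2 0
    obtain ⟨x, hx⟩ : ∃ x : ℤ, x = (a 0 : ℤ) - a 1 := ⟨_, rfl⟩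
    obtain ⟨y, hy⟩ : ∃ y : ℤ, y = (a 1 : ℤ) - a 2 := ⟨_, rfl⟩
    have hz : (a 2 : ℤ) - a 0 = -(x + y) := by omega
    rw [hz, ← hx, ← hy]
    have x1 : -1 ≤ x := by omega
    have x2 : x ≤ 1 := by omega
    have y1 : -1 ≤ y := by omega
    have y2 : y ≤ 1 := by omega
    have z1 : -1 ≤ x + y := by omega
    have z2 : x + y ≤ 1 := by omega
    clear hx hy hz
    interval_cases x <;> interval_cases y <;> simp at z1 z2 ⊢
  have key' : ((a 0 : ℝ) - a 1) ^ 2 + ((a 1 : ℝ) - a 2) ^ 2 + ((a 2 : ℝ) - a 0) ^ 2 ≤ 2 := by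
    exact_mod_cast key
  have e : e0 (fun j => (a j : ℝ) / g) (fun j => (a j : ℝ) / g) =
      (((a 0 : ℝ) - a 1) ^ 2 + ((a 1 : ℝ) - a 2) ^ 2 + ((a 2 : ℝ) - a 0) ^ 2) / g ^ 2 := by
    simp only [e0]; field_simp
  rw [e]
  gcongr

lemma e0_const {a : Fin 3 → ℝ} {c : ℝ} (h : ∀ j, a j = c) : e0 a a = 0 := by
  simp [e0, h]

open Classical in
lemma lower_gen (H : Hyp q l) {x y : E2} (hx : x ∈ Gasket q l) (hy : y ∈ Gasket q l) {N g : ℕ}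
    (hg : 1 ≤ g) {w : ℕ → ℕ × ℕ} (hw : w ∈ Wn l (N + 1)) (hxw : inC q l (N + 1) w x)
    (hd : ((g : ℝ) + 2) / Ln l (N + 1) < gdist q l x y) {F : Finset (ℕ → ℕ × ℕ)} {C : ℝ}
    (hC : (F.card : ℝ) ≤ C)
    (hF : ∀ v ∈ Wn l (N + 1), v ≠ w → ∀ t < g, ∀ a b, Reach l (N + 1) t (vt l (N + 1) w a)
        (vt l (N + 1) v b) → v ∈ F) :
    (g : ℝ) ^ 2 * Rn l (N + 1) / (2 * C) ≤ REc q l x y := by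
  obtain ⟨v, hv, hyv⟩ := (mem_G H).1 hy (N + 1)
  have hL := Ln_posR H (N + 1)
  have hR := Rn_pos l (N + 1)
  have hgR : (0 : ℝ) < g := by exact_mod_cast hg
  have hcon : ∀ t, t < g → ∀ a b, ¬ Reach l (N + 1) t (vt l (N + 1) w a) (vt l (N + 1) v b) := by
    intro t ht a b hr
    have h1 := gdist_cells H hw hv hr hx hy hxw hyv
    have h2 : ((t : ℝ) + 3) / Ln l (N + 1) ≤ ((g : ℝ) + 2) / Ln l (N + 1) := by
      have : (t : ℝ) + 1 ≤ g := by exact_mod_cast ht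
      exact div_le_div_of_nonneg_right (by linarith) hL.le
    linarith
  have hk : ∀ j, Gcap l (N + 1) w g (vt l (N + 1) v j) = g := by
    intro j
    rcases Gcap_or (l := l) (n := N + 1) (w := w) (g := g) (vt l (N + 1) v j) with ⟨a, h⟩ | h
    · by_contra hne
      exact hcon _ (lt_of_le_of_ne (Gcap_le _) hne) a j h
    · exact h
  obtain ⟨u, hu, hc, hE, hu2⟩ := ext_harm H (N + 1) (fun b => (Gcap l (N + 1) w g b : ℝ) / g)
  have u1 : u x = 0 := hu2 w hw x hx hxw 0 (fun j => by simp [Gcap_self])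
  have u2 : u y = 1 := hu2 v hv y hy hyv 1 (fun j => by
    simp only [hk]; exact div_self hgR.ne')
  have hsum : EForm q l u u ≤ (Rn l (N + 1))⁻¹ * (C * (2 / (g : ℝ) ^ 2)) := by
    rw [hE]
    refine mul_le_mul_of_nonneg_left ?_ (by positivity)
    have h1 : ∑ z ∈ WF l (N + 1), e0 (fun j => (Gcap l (N + 1) w g (vt l (N + 1) z j) : ℝ) / g)
        (fun j => (Gcap l (N + 1) w g (vt l (N + 1) z j) : ℝ) / g) ≤
        ∑ z ∈ (WF l (N + 1)).filter (· ∈ F), 2 / (g : ℝ) ^ 2 := by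
      rw [Finset.sum_filter]
      refine Finset.sum_le_sum fun z hz => ?_
      have hz' := (mem_WF H).1 hz
      split_ifs with hzF
      · exact e0_nat (a := fun j => Gcap l (N + 1) w g (vt l (N + 1) z j))
          (fun i j => Gcap_step hz' i j) hgR
      · refine le_of_eq (e0_const (c := (Gcap l (N + 1) w g (vt l (N + 1) z 0) : ℝ) / g) ?_)
        have hall : ∀ i j, Gcap l (N + 1) w g (vt l (N + 1) z j) ≤ Gcap l (N + 1) w g (vt l (N + 1) z i) := by
          intro i j
          by_contra hlt
          push Not at hlt
          have hle := Gcap_le (l := l) (n := N + 1) (w := w) (g := g) (vt l (N + 1) z j)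
          rcases Gcap_or (l := l) (n := N + 1) (w := w) (g := g) (vt l (N + 1) z i) with ⟨a, h⟩ | h
          · refine hzF (hF z hz' ?_ _ (by omega) a i h)
            rintro rfl
            rw [Gcap_self, Gcap_self] at hlt
            omega
          · omega
        intro j
        rw [le_antisymm (hall 0 j) (hall j 0)]
    refine h1.trans ?_
    rw [Finset.sum_const, nsmul_eq_mul]
    refine mul_le_mul_of_nonneg_right (le_trans ?_ hC) (by positivity)
    have : ((WF l (N + 1)).filter (· ∈ F)).card ≤ F.card :=
      Finset.card_le_card fun z hz => (Finset.mem_filter.1 hz).2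
    exact_mod_cast this
  have := le_REc H (REc_lt_four H hx hy).2 hu hc (by rw [u1, u2]; norm_num) hsum
  refine le_trans (le_of_eq ?_) this
  rw [one_div, mul_inv, inv_inv, mul_inv, inv_div]
  rw [div_eq_mul_inv, mul_inv]
  ring

lemma lower_R (H : Hyp q l) {x y : E2} (hx : x ∈ Gasket q l) (hy : y ∈ Gasket q l) {N g : ℕ}
    (hg : 1 ≤ g) (hgl : g ≤ l N - 1) (hd : ((g : ℝ) + 2) / Ln l (N + 1) < gdist q l x y) :
    (g : ℝ) ^ 2 * Rn l (N + 1) / (2 * (6 * g - 2)) ≤ REc q l x y ∧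
    (N = 0 → (g : ℝ) ^ 2 * Rn l (N + 1) / (2 * (4 * g)) ≤ REc q l x y) := by
  obtain ⟨w, hw, hxw⟩ := (mem_G H).1 hx (N + 1)
  obtain ⟨F, h1, h2, h3⟩ := near_count H hw hg hgl
  refine ⟨lower_gen H hx hy hg hw hxw hd ?_ h3, fun h => lower_gen H hx hy hg hw hxw hd ?_ h3⟩
  · have : F.card + 2 ≤ 6 * g := by omega
    have : (F.card : ℝ) + 2 ≤ 6 * g := by exact_mod_cast this
    linarith
  · exact_mod_cast h2 h

/-! ### part (a) -/

lemma part_a_lower (H : Hyp q l) {x y : E2} (hx : x ∈ Gasket q l) (hy : y ∈ Gasket q l) {N k : ℕ}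
    (hk : 2 ≤ k) (hkl : k ≤ l N) (hd : ((k : ℝ) - 1) / Ln l (N + 1) ≤ gdist q l x y) :
    1 / 48 * (k : ℝ) * Rn l (N + 1) ≤ REc q l x y := by
  have hL := Ln_posR H (N + 1)
  have hL2 := Ln_posR H (N + 2)
  have hR := Rn_pos l (N + 1)
  have h5 := H.hl (N + 1)
  have hLs : (Ln l (N + 2) : ℝ) = Ln l (N + 1) * l (N + 1) := by
    rw [Ln_succ]; push_cast; ring
  have hl5 : (5 : ℝ) ≤ l (N + 1) := by exact_mod_cast h5
  have hRs : Rn l (N + 1 + 1) = Rn l (N + 1) * (2 * (l (N + 1) : ℝ) / 3 + 1 / 9)⁻¹ := by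
    rw [Rn_succ]; rfl
  have hkk : (2 : ℝ) ≤ k := by exact_mod_cast hk
  rw [div_le_iff₀ hL] at hd
  by_cases h5k : 5 ≤ k
  · obtain ⟨g, rfl⟩ : ∃ g, k = g + 4 := ⟨k - 4, by omega⟩
    have hg : (1 : ℝ) ≤ g := by exact_mod_cast (by omega : 1 ≤ g)
    push_cast at hd ⊢
    have := (lower_R H hx hy (N := N) (g := g) (by omega) (by omega) (by
      rw [div_lt_iff₀ hL]; linarith)).1
    refine le_trans ?_ this
    rw [le_div_iff₀ (by linarith)]
    have : 1 / 48 * ((g : ℝ) + 4) * (2 * (6 * g - 2)) ≤ (g : ℝ) ^ 2 := by nlinarith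
    calc _ = 1 / 48 * ((g : ℝ) + 4) * (2 * (6 * g - 2)) * Rn l (N + 1) := by ring
      _ ≤ _ := by gcongr
  · by_cases h3 : 3 ≤ k
    · obtain ⟨g, hg⟩ : ∃ g, l (N + 1) = g + 1 := ⟨l (N + 1) - 1, by omega⟩
      have hgR : (l (N + 1) : ℝ) = g + 1 := by rw [hg]; push_cast; ring
      have hk3 : (3 : ℝ) ≤ k := by exact_mod_cast h3
      have hk4 : (k : ℝ) ≤ 4 := by exact_mod_cast (by omega : k ≤ 4)
      have := (lower_R H hx hy (N := N + 1) (g := g) (by omega) (by omega) (by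
        rw [div_lt_iff₀ hL2, hLs, ← mul_assoc]
        have h6 := mul_le_mul_of_nonneg_right hd (by positivity : (0 : ℝ) ≤ l (N + 1))
        nlinarith)).1
      refine le_trans ?_ this
      rw [hRs, hgR]
      rw [hgR] at hl5
      rw [le_div_iff₀ (by linarith)]
      have e : (g : ℝ) ^ 2 * (Rn l (N + 1) * (2 * ((g : ℝ) + 1) / 3 + 1 / 9)⁻¹) =
        ((g : ℝ) ^ 2 * (2 * ((g : ℝ) + 1) / 3 + 1 / 9)⁻¹) * Rn l (N + 1) := by ring
      rw [e]
      have : 1 / 48 * (k : ℝ) * (2 * (6 * g - 2)) ≤ ((g : ℝ) ^ 2 * (2 * ((g : ℝ) + 1) / 3 + 1 / 9)⁻¹) := by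
        rw [← div_eq_mul_inv, le_div_iff₀ (by linarith)]
        calc _ ≤ 1 / 48 * (4 : ℝ) * (2 * (6 * g - 2)) * (2 * ((g : ℝ) + 1) / 3 + 1 / 9) := by
              gcongr
              linarith
          _ ≤ _ := by nlinarith [sq_nonneg ((g : ℝ) - 1)]
      calc _ = 1 / 48 * (k : ℝ) * (2 * (6 * g - 2)) * Rn l (N + 1) := by ring
        _ ≤ _ := by gcongr
    · have hk2 : k = 2 := by omega
      subst hk2
      obtain ⟨g, hg⟩ : ∃ g, l (N + 1) = g + 3 := ⟨l (N + 1) - 3, by omega⟩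
      have hgR : (l (N + 1) : ℝ) = g + 3 := by rw [hg]; push_cast; ring
      push_cast at *
      have := (lower_R H hx hy (N := N + 1) (g := g) (by omega) (by omega) (by
        rw [div_lt_iff₀ hL2, hLs, ← mul_assoc]
        have h6 := mul_le_mul_of_nonneg_right hd (by positivity : (0 : ℝ) ≤ l (N + 1))
        nlinarith)).1
      refine le_trans ?_ this
      rw [hRs, hgR]
      rw [hgR] at hl5
      rw [le_div_iff₀ (by linarith)]
      have e : (g : ℝ) ^ 2 * (Rn l (N + 1) * (2 * ((g : ℝ) + 3) / 3 + 1 / 9)⁻¹) =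
        ((g : ℝ) ^ 2 * (2 * ((g : ℝ) + 3) / 3 + 1 / 9)⁻¹) * Rn l (N + 1) := by ring
      rw [e]
      have : 1 / 48 * (2 : ℝ) * (2 * (6 * g - 2)) ≤ ((g : ℝ) ^ 2 * (2 * ((g : ℝ) + 3) / 3 + 1 / 9)⁻¹) := by
        rw [← div_eq_mul_inv, le_div_iff₀ (by linarith)]
        nlinarith [sq_nonneg ((g : ℝ) - 2 / 3)]
      calc _ = 1 / 48 * (2 : ℝ) * (2 * (6 * g - 2)) * Rn l (N + 1) := by ring
        _ ≤ _ := by gcongr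

lemma part_a_upper (H : Hyp q l) {x y : E2} (hx : x ∈ Gasket q l) (hy : y ∈ Gasket q l) {N k : ℕ}
    (hk : 2 ≤ k) (hd : gdist q l x y < (k : ℝ) / Ln l N) :
    REc q l x y ≤ 7 / 3 * (k : ℝ) * Rn l N := by
  obtain ⟨w, hw, hxw⟩ := (mem_G H).1 hx N
  obtain ⟨v, hv, hyv⟩ := (mem_G H).1 hy N
  obtain ⟨t, ht, i, j, hr⟩ := reach_of_gdist H hx hy hw hv hxw hyv (pdist_fin H hx hy) hd
  refine (REc_le (RB_cells H hw hv hr hx hy hxw hyv)).trans ?_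
  have hR := Rn_pos l N
  have hkk : (2 : ℝ) ≤ k := by exact_mod_cast hk
  have : (t : ℝ) + 1 ≤ k := by exact_mod_cast ht
  gcongr
  linarith

lemma part_a_one (H : Hyp q l) {x y : E2} (hx : x ∈ Gasket q l) (hy : y ∈ Gasket q l)
    (hd : 1 ≤ gdist q l x y) : (1 : ℝ) / 14 ≤ REc q l x y := by
  have hL := Ln_posR H 1
  have h5 := H.hl 0
  have hLs : (Ln l 1 : ℝ) = l 0 := by
    rw [Ln_succ, Ln_zero]; push_cast; ring
  have hl5 : (5 : ℝ) ≤ l 0 := by exact_mod_cast h5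
  have hRs : Rn l (0 + 1) = (2 * (l 0 : ℝ) / 3 + 1 / 9)⁻¹ := by
    rw [Rn_succ]; simp [Rn, rl]
  obtain ⟨g, hg⟩ : ∃ g, l 0 = g + 3 := ⟨l 0 - 3, by omega⟩
  have hgR : (l 0 : ℝ) = g + 3 := by rw [hg]; push_cast; ring
  have := (lower_R H hx hy (N := 0) (g := g) (by omega) (by omega) (by
    rw [zero_add, div_lt_iff₀ hL, hLs]
    rw [hgR] at *
    nlinarith)).2 rfl
  refine le_trans ?_ this
  rw [hRs, hgR]
  rw [hgR] at hl5
  have hg2 : (2 : ℝ) ≤ g := by linarith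
  rw [le_div_iff₀ (by linarith), ← div_eq_mul_inv, le_div_iff₀ (by linarith)]
  nlinarith

end TG


namespace TG
variable {q : Fin 3 → E2} {l : ℕ → ℕ}

/-! ### measure estimates -/

lemma Mn_succ (l : ℕ → ℕ) (n : ℕ) : Mn l (n + 1) = Mn l n * (3 * l n - 3) := by
  simp [Mn, Finset.prod_range_succ]

lemma Mn_ge (H : Hyp q l) (n : ℕ) : n + 1 ≤ Mn l n := by
  induction n with
  | zero => simp [Mn]
  | succ n ih =>
    rw [Mn_succ]
    have := H.hl n
    nlinarith [Nat.mul_le_mul_left (Mn l n) (show 12 ≤ 3 * l n - 3 by omega)]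

lemma Mn_posR (H : Hyp q l) (n : ℕ) : (0 : ℝ) < Mn l n := by
  have := Mn_ge H n
  exact_mod_cast (by omega : 0 < Mn l n)

lemma null_vertex (H : Hyp q l) {μ : Measure E2} (hμ : IsUnif q l μ) {n : ℕ} {w : ℕ → ℕ × ℕ}
    (hw : Val l n w) (j : Fin 3) : μ {pt q (Ln l n) (vt l n w j)} = 0 := by
  have h1 : ∀ m, n ≤ m → μ {pt q (Ln l n) (vt l n w j)} ≤ ((m : ℝ≥0∞))⁻¹ := by
    intro m hm
    obtain ⟨v, hv, _, he⟩ := vt_up H hw j hm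
    have hsub : {pt q (Ln l n) (vt l n w j)} ⊆ Cell q l m (tr m v) := by
      rw [Set.singleton_subset_iff, mem_Cell H (tr_mem hv).1]
      refine ⟨pt_G H hw j, ?_⟩
      rw [inC_tr le_rfl, ← he]
      exact inC_vt q l m v j
    refine (measure_mono hsub).trans ?_
    rw [hμ.2 m _ (tr_mem hv)]
    have := Mn_ge H m
    exact ENNReal.inv_le_inv.2 (by exact_mod_cast (by omega : m ≤ Mn l m))
  refine le_antisymm ?_ (zero_le)
  exact ge_of_tendsto ENNReal.tendsto_inv_nat_nhds_zero (eventually_atTop.2 ⟨n, h1⟩)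

lemma cells_disj (H : Hyp q l) {μ : Measure E2} (hμ : IsUnif q l μ) {n : ℕ} {w v : ℕ → ℕ × ℕ}
    (hw : w ∈ Wn l n) (hv : v ∈ Wn l n) (hne : w ≠ v) :
    AEDisjoint μ (Cell q l n w) (Cell q l n v) := by
  have hb : bs l w n ≠ bs l v n := fun h => hne (Wn_ext hw hv (bs_inj H hw.1 hv.1 h))
  have hsub : Cell q l n w ∩ Cell q l n v ⊆ ⋃ j : Fin 3, {pt q (Ln l n) (vt l n w j)} := by
    rintro x ⟨h1, h2⟩
    rw [mem_Cell H hw.1] at h1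
    rw [mem_Cell H hv.1] at h2
    obtain ⟨i, j, _, e⟩ := int_vertex H hw.1 hv.1 hb h1.2 h2.2
    exact Set.mem_iUnion.2 ⟨i, e⟩
  refine measure_mono_null hsub ?_
  exact measure_iUnion_null fun j => null_vertex H hμ hw.1 j

lemma meas_lower (H : Hyp q l) {μ : Measure E2} (hμ : IsUnif q l μ) {n : ℕ}
    {S : Finset (ℕ → ℕ × ℕ)} (hS : ∀ w ∈ S, w ∈ Wn l n) {B : Set E2}
    (hB : ∀ w ∈ S, Cell q l n w ⊆ B) : (S.card : ℝ≥0∞) * (Mn l n : ℝ≥0∞)⁻¹ ≤ μ B := by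
  have h1 := measure_biUnion_finset₀ (μ := μ) (s := S) (f := fun w => Cell q l n w)
    (fun a ha b hb hne => cells_disj H hμ (hS a ha) (hS b hb) hne)
    (fun b _ => (Cell_closed H n b).measurableSet.nullMeasurableSet)
  rw [Finset.sum_congr rfl (fun w hw => hμ.2 n w (hS w hw)), Finset.sum_const, nsmul_eq_mul] at h1
  rw [← h1]
  exact measure_mono (Set.iUnion₂_subset hB)

lemma meas_upper {μ : Measure E2} (hμ : IsUnif q l μ) {n : ℕ}
    {S : Finset (ℕ → ℕ × ℕ)} (hS : ∀ w ∈ S, w ∈ Wn l n) {B : Set E2}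
    (hB : B ⊆ ⋃ w ∈ S, Cell q l n w) : μ B ≤ (S.card : ℝ≥0∞) * (Mn l n : ℝ≥0∞)⁻¹ := by
  refine (measure_mono hB).trans ((measure_biUnion_finset_le S _).trans ?_)
  rw [Finset.sum_congr rfl (fun w hw => hμ.2 n w (hS w hw)), Finset.sum_const, nsmul_eq_mul]

lemma meas_le_one (H : Hyp q l) {μ : Measure E2} (hμ : IsUnif q l μ) (x : E2) (s : ℝ) :
    μ (Bd q l x s) ≤ 1 := by
  have h := meas_upper (B := Bd q l x s) hμ (n := 0) (S := WF l 0) (fun w hw => (mem_WF H).1 hw) (by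
    rintro y ⟨hy, _⟩
    obtain ⟨w, hw, hyw⟩ := (mem_G H).1 hy 0
    exact Set.mem_biUnion ((mem_WF H).2 hw) ((mem_Cell H hw.1).2 ⟨hy, hyw⟩))
  simpa [WF, Mn] using h

lemma meas_toReal_le_one (H : Hyp q l) {μ : Measure E2} (hμ : IsUnif q l μ) (x : E2) (s : ℝ) :
    (μ (Bd q l x s)).toReal ≤ 1 := by
  have := ENNReal.toReal_mono (by simp) (meas_le_one H hμ x s)
  simpa using this

open Classical in
lemma ball_upper (H : Hyp q l) {μ : Measure E2} (hμ : IsUnif q l μ) {x : E2}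
    (hx : x ∈ Gasket q l) {N g : ℕ} (hg : 1 ≤ g) (hgl : g ≤ l N - 1) {s : ℝ}
    (hs : s ≤ (g : ℝ) / Ln l (N + 1)) :
    (μ (Bd q l x s)).toReal ≤ (6 * g - 1) / Mn l (N + 1) := by
  obtain ⟨w, hw, hxw⟩ := (mem_G H).1 hx (N + 1)
  obtain ⟨F, h1, -, h3⟩ := near_count H hw hg hgl
  have hM := Mn_posR H (N + 1)
  have hup := meas_upper (B := Bd q l x s) hμ (n := N + 1)
    (S := (WF l (N + 1)).filter (· ∈ insert w F))
    (fun v hv => (mem_WF H).1 (Finset.mem_filter.1 hv).1) (by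
    rintro y ⟨hy, hd⟩
    obtain ⟨v, hv, hyv⟩ := (mem_G H).1 hy (N + 1)
    obtain ⟨t, ht, i, j, hr⟩ := reach_of_gdist H hx hy hw hv hxw hyv (pdist_fin H hx hy)
      (lt_of_lt_of_le hd hs)
    refine Set.mem_biUnion (x := v) ?_ ((mem_Cell H hv.1).2 ⟨hy, hyv⟩)
    rw [Finset.mem_coe, Finset.mem_filter]
    refine ⟨(mem_WF H).2 hv, ?_⟩
    by_cases hvw : v = w
    · rw [hvw]; exact Finset.mem_insert_self _ _
    · exact Finset.mem_insert_of_mem (h3 v hv hvw t ht i j hr))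
  have hc : ((WF l (N + 1)).filter (· ∈ insert w F)).card ≤ 6 * g - 1 := by
    refine (Finset.card_le_card (t := insert w F) fun z hz => (Finset.mem_filter.1 hz).2).trans ?_
    refine (Finset.card_insert_le _ _).trans ?_
    omega
  generalize ((WF l (N + 1)).filter (· ∈ insert w F)).card = c at hup hc
  have hMne : (Mn l (N + 1) : ℝ≥0∞) ≠ 0 := by
    have := Mn_ge H (N + 1)
    exact_mod_cast (by omega : Mn l (N + 1) ≠ 0)
  have := ENNReal.toReal_mono (ENNReal.mul_ne_top (ENNReal.natCast_ne_top c)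
    (ENNReal.inv_ne_top.2 hMne)) hup
  rw [ENNReal.toReal_mul, ENNReal.toReal_inv, ENNReal.toReal_natCast, ENNReal.toReal_natCast] at this
  refine this.trans ?_
  rw [← div_eq_mul_inv]
  have hcR : (c : ℝ) + 1 ≤ 6 * g := by exact_mod_cast (by omega : c + 1 ≤ 6 * g)
  exact div_le_div_of_nonneg_right (by linarith) hM.le

lemma side_near (H : Hyp q l) {n : ℕ} {v : ℕ → ℕ × ℕ} (hv : v ∈ Wn l n) {j k : Fin 3} (hjk : j ≠ k)
    {s s' : ℕ} (hlt : s < s') (hs : s' ≤ l n - 1) :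
    Reach l (n + 1) (s' - s - 1) (vt l (n + 1) (Function.update v n (side (l n) j k s)) k)
      (vt l (n + 1) (Function.update v n (side (l n) j k s')) j) := by
  rw [side_step H v hjk (by omega)]
  have := side_reach H hv hjk (s := s + 1) (s' - s - 1) (by omega)
  rwa [show s + 1 + (s' - s - 1) = s' by omega] at this

lemma side_inj {L : ℕ} {j k : Fin 3} (hjk : j ≠ k) {s s' : ℕ} (hs : s ≤ L - 1) (hs' : s' ≤ L - 1)
    (h : side L j k s = side L j k s') : s = s' := by
  have := congrFun (congrArg (co L) h) k
  rw [co_side hjk hs, co_side hjk hs'] at this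
  simpa [sco, Ne.symm hjk] using this

open Classical in
lemma ball_lower (H : Hyp q l) {μ : Measure E2} (hμ : IsUnif q l μ) {x : E2}
    (hx : x ∈ Gasket q l) {N p : ℕ} (hp : 1 ≤ p) (hpl : p ≤ l N - 1) {s : ℝ}
    (hs : ((p : ℝ) + 2) / Ln l (N + 1) < s) :
    (p + 1) / Mn l (N + 1) ≤ (μ (Bd q l x s)).toReal := by
  obtain ⟨w, hw, hxw⟩ := (mem_G H).1 hx (N + 1)
  have hL := Ln_posR H (N + 1)
  have hw0 := tr_mem (Val.mono hw.1 (by omega : N ≤ N + 1))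
  obtain ⟨j, k, σ, hjk, hσ, e⟩ := letter_side (hw.1 N (by omega))
  obtain ⟨a, ha1, ha2, ha3⟩ : ∃ a, a ≤ σ ∧ σ ≤ a + p ∧ a + p ≤ l N - 1 :=
    ⟨min σ (l N - 1 - p), by omega, by omega, by omega⟩
  have hmem : ∀ r, r ≤ l N - 1 → Function.update (tr N w) N (side (l N) j k r) ∈ Wn l (N + 1) :=
    fun r hr => upd_mem H hw0 (side_mem hjk hr)
  have ew : w = Function.update (tr N w) N (side (l N) j k σ) := by
    rw [← e, upd_tr hw]
  have hinj : Set.InjOn (fun r => Function.update (tr N w) N (side (l N) j k r))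
      (Finset.Icc a (a + p) : Finset ℕ) := by
    intro r hr r' hr' h
    simp only [Finset.coe_Icc, Set.mem_Icc] at hr hr'
    have := congrFun h N
    simp only [Function.update_self] at this
    exact side_inj hjk (by omega) (by omega) this
  have hlow := meas_lower (B := Bd q l x s) H hμ (n := N + 1)
    (S := (Finset.Icc a (a + p)).image fun r => Function.update (tr N w) N (side (l N) j k r)) (by
      intro v hv
      obtain ⟨r, hr, rfl⟩ := Finset.mem_image.1 hv
      rw [Finset.mem_Icc] at hr
      exact hmem r (by omega)) (by
      intro v hv y hy
      obtain ⟨r, hr, rfl⟩ := Finset.mem_image.1 hv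
      rw [Finset.mem_Icc] at hr
      have hr2 := hmem r (by omega)
      rw [mem_Cell H hr2.1] at hy
      refine ⟨hy.1, ?_⟩
      have : ∃ t, t + 1 ≤ p ∧ ∃ i j', Reach l (N + 1) t (vt l (N + 1) w i)
          (vt l (N + 1) (Function.update (tr N w) N (side (l N) j k r)) j') := by
        rcases lt_trichotomy r σ with h | h | h
        · refine ⟨σ - r - 1, by omega, j, k, ?_⟩
          have := (side_near H hw0 hjk h hσ).symm
          rwa [← ew] at this
        · refine ⟨0, by omega, j, j, ?_⟩
          rw [h, ← ew]
          exact Reach.refl _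
        · refine ⟨r - σ - 1, by omega, k, j, ?_⟩
          have := (side_near H hw0 hjk h (by omega))
          rwa [← ew] at this
      obtain ⟨t, ht, i, j', hr'⟩ := this
      have h1 := gdist_cells H hw hr2 hr' hx hy.1 hxw hy.2
      refine lt_of_le_of_lt (h1.trans ?_) hs
      have : (t : ℝ) + 1 ≤ p := by exact_mod_cast ht
      exact div_le_div_of_nonneg_right (by linarith) hL.le)
  rw [Finset.card_image_of_injOn hinj, Nat.card_Icc] at hlow
  have := ENNReal.toReal_mono (ne_top_of_le_ne_top (by simp) (meas_le_one H hμ x s)) hlow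
  rw [ENNReal.toReal_mul, ENNReal.toReal_inv, ENNReal.toReal_natCast, ENNReal.toReal_natCast] at this
  refine le_trans (le_of_eq ?_) this
  rw [← div_eq_mul_inv, show a + p + 1 - a = p + 1 by omega]
  push_cast
  rfl

end TG


namespace TG
variable {q : Fin 3 → E2} {l : ℕ → ℕ}

/-! ### assembly of part (b) -/

lemma Mn_succR (H : Hyp q l) (n : ℕ) : (Mn l (n + 1) : ℝ) = Mn l n * (3 * l n - 3) := by
  have := H.hl n
  rw [Mn_succ, Nat.cast_mul, Nat.cast_sub (by omega)]
  push_cast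
  ring

lemma ballK_upper (H : Hyp q l) {μ : Measure E2} (hμ : IsUnif q l μ) {x : E2}
    (hx : x ∈ Gasket q l) {N k : ℕ} (hk : 2 ≤ k) (hkl : k ≤ l N) {s : ℝ}
    (hs : s < (k : ℝ) / Ln l (N + 1)) :
    (μ (Bd q l x s)).toReal ≤ 15 * k / Mn l (N + 1) := by
  have hM := Mn_posR H (N + 1)
  have hkk : (2 : ℝ) ≤ k := by exact_mod_cast hk
  have h5 := H.hl N
  by_cases h : k ≤ l N - 1
  · refine (ball_upper H hμ hx (by omega) h hs.le).trans ?_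
    exact div_le_div_of_nonneg_right (by linarith) hM.le
  · have hk' : k = l N := by omega
    have hl0 : (0 : ℝ) < l N := by exact_mod_cast (by omega : 0 < l N)
    rcases N with _ | N
    · refine (meas_toReal_le_one H hμ x s).trans ?_
      rw [le_div_iff₀ hM, Mn_succR H, hk']
      simp only [Mn, Finset.range_zero, Finset.prod_empty, Nat.cast_one]
      linarith
    · have hs' : s ≤ ((1 : ℕ) : ℝ) / Ln l (N + 1) := by
        refine hs.le.trans (le_of_eq ?_)
        have := Ln_posR H (N + 1)
        rw [Ln_succ l (N + 1), hk']
        push_cast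
        field_simp
      have h5' := H.hl N
      refine (ball_upper H hμ hx (g := 1) le_rfl (by omega) hs').trans ?_
      have hM' := Mn_posR H (N + 1)
      rw [div_le_div_iff₀ hM' hM, Mn_succR H (N + 1), hk']
      push_cast
      nlinarith

lemma ballK_lower (H : Hyp q l) {μ : Measure E2} (hμ : IsUnif q l μ) {x : E2}
    (hx : x ∈ Gasket q l) {N k : ℕ} (hk : 2 ≤ k) (hkl : k ≤ l N) {s : ℝ}
    (hs : ((k : ℝ) - 1) / Ln l (N + 1) ≤ s) :
    (3 * k - 2) * (2 * k + 1) / (81 * k) / Mn l (N + 1) ≤ (μ (Bd q l x s)).toReal := by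
  have hM := Mn_posR H (N + 1)
  have hL := Ln_posR H (N + 1)
  have hL2 := Ln_posR H (N + 2)
  have hM2 := Mn_posR H (N + 2)
  have hkk : (2 : ℝ) ≤ k := by exact_mod_cast hk
  have h5 := H.hl (N + 1)
  have hLs : (Ln l (N + 2) : ℝ) = Ln l (N + 1) * l (N + 1) := by
    rw [Ln_succ]; push_cast; ring
  have hl5 : (5 : ℝ) ≤ l (N + 1) := by exact_mod_cast h5
  rw [div_le_iff₀ hL] at hs
  have h6 := mul_le_mul_of_nonneg_right hs (by positivity : (0 : ℝ) ≤ l (N + 1))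
  by_cases h5k : 5 ≤ k
  · obtain ⟨g, rfl⟩ : ∃ g, k = g + 4 := ⟨k - 4, by omega⟩
    have hg : (1 : ℝ) ≤ g := by exact_mod_cast (by omega : 1 ≤ g)
    push_cast at hs ⊢
    have := ball_lower H hμ hx (N := N) (p := g) (s := s) (by omega) (by omega) (by
      rw [div_lt_iff₀ hL]; linarith)
    refine le_trans ?_ this
    refine div_le_div_of_nonneg_right ?_ hM.le
    rw [div_le_iff₀ (by linarith)]
    nlinarith
  · have h4k : (k : ℝ) ≤ 4 := by exact_mod_cast (by omega : k ≤ 4)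
    by_cases h3 : 3 ≤ k
    · obtain ⟨g, hg⟩ : ∃ g, l (N + 1) = g + 1 := ⟨l (N + 1) - 1, by omega⟩
      have hgR : (l (N + 1) : ℝ) = g + 1 := by rw [hg]; push_cast; ring
      have hk3 : (3 : ℝ) ≤ k := by exact_mod_cast h3
      have := ball_lower H hμ hx (N := N + 1) (p := g) (s := s) (by omega) (by omega) (by
        rw [div_lt_iff₀ hL2, hLs, ← mul_assoc]
        nlinarith)
      refine le_trans ?_ this
      rw [Mn_succR H (N + 1), hgR, div_le_div_iff₀ hM (by nlinarith)]
      have h7 : (3 * (k : ℝ) - 2) * (2 * k + 1) / (81 * k) ≤ 1 / 3 := by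
        rw [div_le_iff₀ (by linarith)]
        nlinarith
      have h8 : (0 : ℝ) ≤ Mn l (N + 1) * (3 * (g + 1) - 3) := by nlinarith
      have := mul_le_mul_of_nonneg_right h7 h8
      nlinarith
    · have hk2 : k = 2 := by omega
      subst hk2
      obtain ⟨g, hg⟩ : ∃ g, l (N + 1) = g + 3 := ⟨l (N + 1) - 3, by omega⟩
      have hgR : (l (N + 1) : ℝ) = g + 3 := by rw [hg]; push_cast; ring
      push_cast at *
      have := ball_lower H hμ hx (N := N + 1) (p := g) (s := s) (by omega) (by omega) (by
        rw [div_lt_iff₀ hL2, hLs, ← mul_assoc]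
        nlinarith)
      refine le_trans ?_ this
      rw [Mn_succR H (N + 1), hgR, div_le_div_iff₀ hM (by nlinarith)]
      have hg2 : (2 : ℝ) ≤ g := by linarith
      nlinarith

lemma exists_level (H : Hyp q l) {d : ℝ} (h0 : 0 < d) (h1 : d < 1) :
    ∃ N k : ℕ, 2 ≤ k ∧ k ≤ l N ∧ ((k : ℝ) - 1) / Ln l (N + 1) ≤ d ∧ d < (k : ℝ) / Ln l (N + 1) := by
  have hex : ∃ n : ℕ, 1 ≤ Ln l n * d := by
    obtain ⟨n, hn⟩ := exists_nat_gt (1 / d)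
    refine ⟨n, ?_⟩
    rw [div_lt_iff₀ h0] at hn
    have h2 : (n : ℝ) ≤ Ln l n := by
      have a1 := Ln_ge H n
      have a2 : n < 5 ^ n := Nat.lt_pow_self (by norm_num)
      exact_mod_cast (by omega : n ≤ Ln l n)
    nlinarith
  classical
  obtain ⟨N, hN⟩ : ∃ N, Nat.find hex = N + 1 := by
    refine Nat.exists_eq_succ_of_ne_zero fun h => ?_
    have := Nat.find_spec hex
    rw [h, Ln_zero] at this
    simp at this
    linarith
  have s1 := Nat.find_spec hex
  have s2 := Nat.find_min hex (m := N) (by omega)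
  rw [hN] at s1
  have hL := Ln_posR H (N + 1)
  have hpos : 0 ≤ Ln l (N + 1) * d := by linarith
  have f1 := Nat.floor_le hpos
  have f2 := Nat.lt_floor_add_one (Ln l (N + 1) * d)
  refine ⟨N, ⌊Ln l (N + 1) * d⌋₊ + 1, ?_, ?_, ?_, ?_⟩
  · have := (Nat.one_le_floor_iff (Ln l (N + 1) * d)).2 s1
    omega
  · have : ⌊Ln l (N + 1) * d⌋₊ < l N := by
      rw [Nat.floor_lt hpos, Ln_succ]
      push_cast
      have h5 := H.hl N
      have : (0 : ℝ) < l N := by exact_mod_cast (by omega : 0 < l N)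
      push Not at s2
      nlinarith
    omega
  · rw [div_le_iff₀ hL]; push_cast; linarith
  · rw [lt_div_iff₀ hL]; push_cast; linarith

lemma beta_bounds (H : Hyp q l) : 0 ≤ betaZero l ∧ betaZero l ≤ 5 / 2 := by
  have key : ∀ n, 0 ≤ Real.logb (l n) (2 * (l n : ℝ) ^ 2 - (5 / 3) * (l n : ℝ) - 1 / 3) ∧
      Real.logb (l n) (2 * (l n : ℝ) ^ 2 - (5 / 3) * (l n : ℝ) - 1 / 3) ≤ 5 / 2 := by
    intro n
    have h5 : (5 : ℝ) ≤ l n := by exact_mod_cast H.hl n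
    constructor
    · exact Real.logb_nonneg (by linarith) (by nlinarith)
    · rw [Real.logb_le_iff_le_rpow (by linarith) (by nlinarith)]
      have h1 : (l n : ℝ) ^ (5 / 2 : ℝ) = (l n : ℝ) ^ 2 * Real.sqrt (l n) := by
        rw [Real.sqrt_eq_rpow, show (5 / 2 : ℝ) = (2 : ℕ) + 1 / 2 by norm_num,
          Real.rpow_add (by linarith), Real.rpow_natCast]
      rw [h1]
      have h2 : (2 : ℝ) ≤ Real.sqrt (l n) := Real.le_sqrt_of_sq_le (by linarith)
      nlinarith [sq_nonneg (l n : ℝ)]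
  exact ⟨Real.iInf_nonneg fun n => (key n).1,
    (ciInf_le ⟨0, by rintro _ ⟨n, rfl⟩; exact (key n).1⟩ 0).trans (key 0).2⟩

lemma rpow_bounds (H : Hyp q l) {d : ℝ} (h1 : 1 ≤ d) (h3 : d < 3) :
    1 ≤ d ^ betaZero l ∧ d ^ betaZero l ≤ 16 := by
  obtain ⟨b1, b2⟩ := beta_bounds H
  refine ⟨Real.one_le_rpow h1 b1, ?_⟩
  refine (Real.rpow_le_rpow_of_exponent_le h1 b2).trans
    ((Real.rpow_le_rpow (by linarith) h3.le (by norm_num)).trans ?_)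
  have e : (3 : ℝ) ^ (5 / 2 : ℝ) = 3 ^ 2 * Real.sqrt 3 := by
    rw [Real.sqrt_eq_rpow, show (5 / 2 : ℝ) = (2 : ℕ) + 1 / 2 by norm_num,
      Real.rpow_add (by norm_num), Real.rpow_natCast]
  rw [e]
  have : Real.sqrt 3 ≤ 16 / 9 := Real.sqrt_le_iff.2 ⟨by norm_num, by norm_num⟩
  linarith

lemma psi_bounds (H : Hyp q l) {N k : ℕ} (hk : 2 ≤ k) {d : ℝ}
    (hd1 : ((k : ℝ) - 1) / Ln l (N + 1) ≤ d) (hd2 : d < (k : ℝ) / Ln l (N + 1)) :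
    psiPiece l N d ≤ Rn l (N + 1) / Mn l (N + 1) * ((3 * k - 2) * ((2 * k + 1) / 3)) ∧
    Rn l (N + 1) / Mn l (N + 1) * ((1 + 11 / 4 * (k - 2)) * (1 + 11 / 18 * (k - 2))) ≤ psiPiece l N d := by
  have hL := Ln_posR H (N + 1)
  have hM := Mn_posR H (N + 1)
  have hR := Rn_pos l (N + 1)
  have h5 : (5 : ℝ) ≤ l N := by exact_mod_cast H.hl N
  have hkk : (2 : ℝ) ≤ k := by exact_mod_cast hk
  have hT : (Tn l (N + 1))⁻¹ = Rn l (N + 1) / Mn l (N + 1) := by rw [Tn, inv_div]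
  rw [div_le_iff₀ hL, mul_comm] at hd1
  rw [lt_div_iff₀ hL, mul_comm] at hd2
  rw [psiPiece, hT, mul_assoc]
  generalize (Ln l (N + 1) : ℝ) * d = z at *
  have a1 : (3 * (l N : ℝ) - 4) / ((l N : ℝ) - 1) ≤ 3 := by
    rw [div_le_iff₀ (by linarith)]; linarith
  have a2 : 11 / 4 ≤ (3 * (l N : ℝ) - 4) / ((l N : ℝ) - 1) := by
    rw [le_div_iff₀ (by linarith)]; linarith
  have b1 : ((2 / 3) * (l N : ℝ) - 8 / 9) / ((l N : ℝ) - 1) ≤ 2 / 3 := by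
    rw [div_le_iff₀ (by linarith)]; linarith
  have b2 : 11 / 18 ≤ ((2 / 3) * (l N : ℝ) - 8 / 9) / ((l N : ℝ) - 1) := by
    rw [le_div_iff₀ (by linarith)]; linarith
  generalize (3 * (l N : ℝ) - 4) / ((l N : ℝ) - 1) = α at *
  generalize ((2 / 3) * (l N : ℝ) - 8 / 9) / ((l N : ℝ) - 1) = β at *
  have A1 : 1 + α * (z - 1) ≤ 3 * k - 2 := by nlinarith
  have A2 : 1 + 11 / 4 * ((k : ℝ) - 2) ≤ 1 + α * (z - 1) := by nlinarith
  have B1 : 1 + β * (z - 1) ≤ (2 * k + 1) / 3 := by nlinarith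
  have B2 : 1 + 11 / 18 * ((k : ℝ) - 2) ≤ 1 + β * (z - 1) := by nlinarith
  constructor
  · exact mul_le_mul_of_nonneg_left (mul_le_mul A1 B1 (by linarith) (by linarith)) (by positivity)
  · exact mul_le_mul_of_nonneg_left (mul_le_mul A2 B2 (by linarith) (by linarith)) (by positivity)

lemma part_b (H : Hyp q l) {μ : Measure E2} (hμ : IsUnif q l μ) {Psi : ℝ → ℝ} (hPsi : IsPsi l Psi)
    {x y : E2} (hx : x ∈ Gasket q l) (hy : y ∈ Gasket q l) (hxy : x ≠ y) :
    ((6 : ℝ) ^ 4)⁻¹ * Psi (gdist q l x y) / (μ (Bd q l x (gdist q l x y))).toReal ≤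
        REc q l x y ∧
      REc q l x y ≤
        (2 : ℝ) ^ 8 * Psi (gdist q l x y) / (μ (Bd q l x (gdist q l x y))).toReal := by
  have hd0 : 0 < gdist q l x y :=
    lt_of_lt_of_le (dist_pos.2 hxy) (dist_le_gdist H (pdist_fin H hx hy))
  have hd3 := gdist_lt_three H hx hy
  have hR4 := (REc_lt_four H hx hy).1
  by_cases hd1 : 1 ≤ gdist q l x y
  · have hR14 := part_a_one H hx hy hd1
    have hm1 := meas_toReal_le_one H hμ x (gdist q l x y)
    have hm4 : 1 / 4 ≤ (μ (Bd q l x (gdist q l x y))).toReal := by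
      have h5 := H.hl 0
      have hl5 : (5 : ℝ) ≤ l 0 := by exact_mod_cast h5
      obtain ⟨g, hg⟩ : ∃ g, l 0 = g + 3 := ⟨l 0 - 3, by omega⟩
      have hgR : (l 0 : ℝ) = g + 3 := by rw [hg]; push_cast; ring
      have hLs : (Ln l (0 + 1) : ℝ) = l 0 := by
        rw [Ln_succ, Ln_zero]; push_cast; ring
      have hM := Mn_posR H (0 + 1)
      refine le_trans ?_ (ball_lower H hμ hx (N := 0) (p := g) (by omega) (by omega) (by
        rw [hLs, hgR, div_lt_iff₀ (by linarith)]
        nlinarith))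
      rw [le_div_iff₀ hM, Mn_succR H, hgR]
      simp only [Mn, Finset.range_zero, Finset.prod_empty, Nat.cast_one]
      linarith
    rw [hPsi.2.1 _ hd1]
    obtain ⟨p1, p2⟩ := rpow_bounds H hd1 hd3
    generalize gdist q l x y ^ betaZero l = P at *
    generalize (μ (Bd q l x (gdist q l x y))).toReal = m at *
    have hm0 : 0 < m := by linarith
    constructor
    · rw [div_le_iff₀ hm0]
      norm_num
      nlinarith
    · rw [le_div_iff₀ hm0]
      norm_num
      nlinarith
  · push Not at hd1
    obtain ⟨N, k, hk, hkl, e1, e2⟩ := exists_level H hd0 hd1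
    have hL := Ln_posR H (N + 1)
    have hL' := Ln_posR H N
    have hM := Mn_posR H (N + 1)
    have hR := Rn_pos l (N + 1)
    have hkk : (2 : ℝ) ≤ k := by exact_mod_cast hk
    have hkl' : (k : ℝ) ≤ l N := by exact_mod_cast hkl
    have r1 := part_a_lower H hx hy hk hkl e1
    have r2 := part_a_upper H hx hy hk e2
    have m1 := ballK_lower H hμ hx hk hkl e1
    have m2 := ballK_upper H hμ hx hk hkl e2
    obtain ⟨p1, p2⟩ := psi_bounds H hk e1 e2
    have hP : Psi (gdist q l x y) = psiPiece l N (gdist q l x y) := by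
      refine hPsi.1 N _ ?_ ?_
      · refine le_trans ?_ e1
        rw [inv_eq_one_div]
        exact div_le_div_of_nonneg_right (by linarith) hL.le
      · refine e2.le.trans ?_
        rw [div_le_iff₀ hL, Ln_succ]
        push_cast
        rw [← mul_assoc, inv_mul_cancel₀ hL'.ne', one_mul]
        exact hkl'
    rw [hP]
    generalize psiPiece l N (gdist q l x y) = P at *
    generalize (μ (Bd q l x (gdist q l x y))).toReal = m at *
    generalize REc q l x y = R at *
    generalize Rn l (N + 1) = r at *
    generalize (Mn l (N + 1) : ℝ) = M at *
    generalize (k : ℝ) = κ at *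
    have hc : 0 < (3 * κ - 2) * (2 * κ + 1) / (81 * κ) := by
      have : 0 < 3 * κ - 2 := by linarith
      positivity
    have hm0 : 0 < m := lt_of_lt_of_le (div_pos hc hM) m1
    constructor
    · rw [div_le_iff₀ hm0]
      calc ((6 : ℝ) ^ 4)⁻¹ * P ≤ ((6 : ℝ) ^ 4)⁻¹ * (r / M * ((3 * κ - 2) * ((2 * κ + 1) / 3))) := by
            gcongr
        _ = 1 / 48 * κ * r * ((3 * κ - 2) * (2 * κ + 1) / (81 * κ) / M) := by
            field_simp
            ring
        _ ≤ R * m := by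
            refine mul_le_mul r1 m1 (div_pos hc hM).le ?_
            exact le_trans (by positivity) r1
    · rw [le_div_iff₀ hm0]
      calc R * m ≤ (7 / 3 * κ * r) * (15 * κ / M) := by
            refine mul_le_mul r2 m2 hm0.le (by positivity)
        _ = r / M * (35 * κ ^ 2) := by ring
        _ ≤ r / M * (2 ^ 8 * ((1 + 11 / 4 * (κ - 2)) * (1 + 11 / 18 * (κ - 2)))) := by
            refine mul_le_mul_of_nonneg_left ?_ (by positivity)
            nlinarith
        _ = 2 ^ 8 * (r / M * ((1 + 11 / 4 * (κ - 2)) * (1 + 11 / 18 * (κ - 2)))) := by ring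
        _ ≤ 2 ^ 8 * P := by gcongr

end TG

/-- Two-sided comparison of `R_E(x,y)` with `k·R_n` and with
`Ψ(d(x,y))/m(B_d(x,d(x,y)))`. -/
theorem stmt12 (q : Fin 3 → E2) (hq : ∀ j k : Fin 3, j ≠ k → dist (q j) (q k) = 1)
    (l : ℕ → ℕ) (hl : ∀ m, 5 ≤ l m)
    (μ : Measure E2) (hμ : IsUnif q l μ) (Psi : ℝ → ℝ) (hPsi : IsPsi l Psi)
    (x : E2) (hx : x ∈ Gasket q l) (y : E2) (hy : y ∈ Gasket q l) :
    -- (a)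
    (∀ n : ℕ, 1 ≤ n → ∀ k : ℕ, 2 ≤ k → k ≤ l (n - 1) →
      ((k : ℝ) - 1) / (Ln l n : ℝ) ≤ gdist q l x y →
      gdist q l x y < (k : ℝ) / (Ln l n : ℝ) →
      (1 / 48) * (k : ℝ) * Rn l n ≤ REc q l x y ∧
      REc q l x y ≤ (7 / 3) * (k : ℝ) * Rn l n) ∧
    (gdist q l x y < 3) ∧ (REc q l x y < 4) ∧
    ((1 : ℝ) ≤ gdist q l x y → (1 : ℝ) / 14 ≤ REc q l x y) ∧
    -- (b)
    (x ≠ y →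
      ((6 : ℝ) ^ 4)⁻¹ * Psi (gdist q l x y) / (μ (Bd q l x (gdist q l x y))).toReal ≤
        REc q l x y ∧
      REc q l x y ≤
        (2 : ℝ) ^ 8 * Psi (gdist q l x y) / (μ (Bd q l x (gdist q l x y))).toReal) := by
  have H : TG.Hyp q l := ⟨hq, hl⟩
  refine ⟨?_, TG.gdist_lt_three H hx hy, (TG.REc_lt_four H hx hy).1, TG.part_a_one H hx hy,
    TG.part_b H hμ hPsi hx hy⟩
  intro n hn k hk hkl h1 h2
  obtain ⟨N, rfl⟩ : ∃ N, n = N + 1 := ⟨n - 1, by omega⟩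
  exact ⟨TG.part_a_lower H hx hy hk hkl h1, TG.part_a_upper H hx hy hk h2⟩

end
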